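/- Let P ⊆ A be an inclusion of separable unital C*-algebras and let E : A → P be a faithful conditional expectation of index finite type with the Rokhlin property. If A has locally finite nuclear dimension, then P has locally finite nuclear dimension. -/

import Mathlib

noncomputable section
set_option linter.unusedSectionVars false

open scoped ComplexOrder Matrix.Norms.L2Operator
open Filter Topology

/-- An element of a `*`-ring is *positive* (in the C*-algebraic sense) if it has the
form `star y * y`. -/
def IsPosElem {R : Type*} [Mul R] [Star R] (a : R) : Prop :=
  ∃ y : R, a = star y * y

/-- A linear functional on a unital complex `*`-algebra is a *tracial state* if it is unital,
positive and tracial. -/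
def IsTracialState {R : Type*} [Ring R] [StarRing R] [Module ℂ R] (τ : R →ₗ[ℂ] ℂ) : Prop :=
  τ 1 = 1 ∧ (∀ x : R, 0 ≤ τ (star x * x)) ∧ ∀ a b : R, τ (a * b) = τ (b * a)

/-- A linear map between complex `*`-algebras is *completely positive* if all of its matrix
amplifications map positive elements to positive elements. -/
def IsCompletelyPositive {A B : Type*} [Ring A] [StarRing A] [Module ℂ A]
    [Ring B] [StarRing B] [Module ℂ B] (φ : A →ₗ[ℂ] B) : Prop :=
  ∀ (k : ℕ) (x : Matrix (Fin k) (Fin k) A), IsPosElem x → IsPosElem (x.map φ)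

/-- A map has *order zero* on a subset if it preserves orthogonality there. -/
def OrderZeroOn {F D : Type*} [Mul F] [Zero F] [Mul D] [Zero D] (φ : F → D) (s : Set F) : Prop :=
  ∀ e ∈ s, ∀ f ∈ s, e * f = 0 → f * e = 0 → φ e * φ f = 0 ∧ φ f * φ e = 0

/-- The finite-dimensional C*-algebra `⊕_{i=1}^s M_{r i}(ℂ)`. -/
abbrev FDBlock (s : ℕ) (r : Fin s → ℕ) : Type :=
  ∀ i : Fin s, Matrix (Fin (r i)) (Fin (r i)) ℂ

/-- The elements of `⊕_{i=1}^s M_{r i}(ℂ)` supported on the blocks with label `j`. -/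
def blockSupp {s : ℕ} {r : Fin s → ℕ} {n : ℕ} (J : Fin s → Fin (n + 1)) (j : Fin (n + 1)) :
    Set (FDBlock s r) :=
  {x | ∀ i : Fin s, J i ≠ j → x i = 0}

/-- `DecompositionRankLE n D` : the C*-algebra `D` has decomposition rank at most `n`. -/
def DecompositionRankLE (n : ℕ) (D : Type*) [NormedRing D] [StarRing D]
    [NormedAlgebra ℂ D] : Prop :=
  ∀ (S : Finset D) (ε : ℝ), 0 < ε →
    ∃ (s : ℕ) (r : Fin s → ℕ) (J : Fin s → Fin (n + 1))
      (ψ : D →ₗ[ℂ] FDBlock s r) (φ : FDBlock s r →ₗ[ℂ] D),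
      IsCompletelyPositive ψ ∧ IsCompletelyPositive φ ∧
      (∀ a : D, ‖ψ a‖ ≤ ‖a‖) ∧ (∀ x : FDBlock s r, ‖φ x‖ ≤ ‖x‖) ∧
      (∀ j : Fin (n + 1), OrderZeroOn φ (blockSupp J j)) ∧
      ∀ a ∈ S, ‖φ (ψ a) - a‖ < ε

/-- `NuclearDimensionLE n D` : the C*-algebra `D` has nuclear dimension at most `n`. -/
def NuclearDimensionLE (n : ℕ) (D : Type*) [NormedRing D] [StarRing D]
    [NormedAlgebra ℂ D] : Prop :=
  ∀ (S : Finset D) (ε : ℝ), 0 < ε →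
    ∃ (s : ℕ) (r : Fin s → ℕ) (J : Fin s → Fin (n + 1))
      (ψ : D →ₗ[ℂ] FDBlock s r) (φ : FDBlock s r →ₗ[ℂ] D),
      IsCompletelyPositive ψ ∧ IsCompletelyPositive φ ∧
      (∀ a : D, ‖ψ a‖ ≤ ‖a‖) ∧
      (∀ j : Fin (n + 1), (∀ x ∈ blockSupp J j, ‖φ x‖ ≤ ‖x‖) ∧
        OrderZeroOn φ (blockSupp J j)) ∧
      ∀ a ∈ S, ‖φ (ψ a) - a‖ < ε

/-- A bundled unital C*-algebra. -/
structure CStarAlg : Type 1 where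
  carrier : Type
  [str : CStarAlgebra carrier]

attribute [instance] CStarAlg.str

/-- The *finite saturation* of a class `𝒞` of unital C*-algebras: the smallest class
containing `𝒞` which is closed under isomorphism, finite direct sums, matrix amplifications
and corners by nonzero projections. -/
inductive FinSat (𝒞 : CStarAlg → Prop) : CStarAlg → Prop
  | base {B : CStarAlg} : 𝒞 B → FinSat 𝒞 B
  | iso {B B' : CStarAlg} : FinSat 𝒞 B → Nonempty (B'.carrier ≃⋆ₐ[ℂ] B.carrier) →
      FinSat 𝒞 B'
  | sum {B₁ B₂ B : CStarAlg} : FinSat 𝒞 B₁ → FinSat 𝒞 B₂ →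
      Nonempty (B.carrier ≃⋆ₐ[ℂ] (B₁.carrier × B₂.carrier)) → FinSat 𝒞 B
  | matrix {B B' : CStarAlg} (k : ℕ) : FinSat 𝒞 B →
      Nonempty (B'.carrier ≃⋆ₐ[ℂ] Matrix (Fin (k + 1)) (Fin (k + 1)) B.carrier) →
      FinSat 𝒞 B'
  | corner {B B' : CStarAlg} (p : B.carrier) : FinSat 𝒞 B → p ≠ 0 → p * p = p →
      star p = p →
      (∃ ι : B'.carrier →⋆ₙₐ[ℂ] B.carrier, Function.Injective ι ∧ ι 1 = p ∧
        Set.range ι = {x : B.carrier | p * x * p = x}) →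
      FinSat 𝒞 B'

/-- `A` is a *unital local `𝒞`-algebra*. -/
def IsUnitalLocalAlg (𝒞 : CStarAlg → Prop) (A : Type*) [NormedRing A] [StarRing A]
    [NormedAlgebra ℂ A] : Prop :=
  ∀ (S : Finset A) (ε : ℝ), 0 < ε →
    ∃ B : CStarAlg, FinSat 𝒞 B ∧
      ∃ φ : B.carrier →⋆ₐ[ℂ] A, ∀ a ∈ S, ∃ b : B.carrier, ‖a - φ b‖ < ε

/-- The class of separable unital C*-algebras with decomposition rank at most `n`. -/
def drClass (n : ℕ) : CStarAlg → Prop :=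
  fun B => TopologicalSpace.SeparableSpace B.carrier ∧ DecompositionRankLE n B.carrier

/-- The class of separable unital C*-algebras with nuclear dimension at most `n`. -/
def nucClass (n : ℕ) : CStarAlg → Prop :=
  fun B => TopologicalSpace.SeparableSpace B.carrier ∧ NuclearDimensionLE n B.carrier

/-- The class of separable unital C*-algebras with finite nuclear dimension. -/
def lnucClass : CStarAlg → Prop :=
  fun B => TopologicalSpace.SeparableSpace B.carrier ∧ ∃ n : ℕ, NuclearDimensionLE n B.carrier

/-- A separable unital C*-algebra has *locally finite nuclear dimension* if it is a
unital local `C_lnuc`-algebra. -/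
def HasLocallyFiniteNuclearDimension (A : Type*) [NormedRing A] [StarRing A]
    [NormedAlgebra ℂ A] : Prop :=
  IsUnitalLocalAlg lnucClass A
/-! ### Group actions and the Rokhlin property -/

/-- `α : G → (A →⋆ₐ[ℂ] A)` is an action of the group `G` on `A` by *-automorphisms. -/
def IsGroupAction {G A : Type*} [Group G] [CStarAlgebra A] (α : G → (A →⋆ₐ[ℂ] A)) : Prop :=
  (∀ a : A, α 1 a = a) ∧ ∀ (g h : G) (a : A), α g (α h a) = α (g * h) a

/-- The fixed point algebra `A^α` of an action, as a star subalgebra of `A`. -/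
def fixedPointAlgebra {G A : Type*} [Group G] [CStarAlgebra A] (α : G → (A →⋆ₐ[ℂ] A)) :
    StarSubalgebra ℂ A where
  carrier := {a : A | ∀ g : G, α g a = a}
  mul_mem' := fun {a} {b} ha hb g => by rw [map_mul, ha g, hb g]
  add_mem' := fun {a} {b} ha hb g => by rw [map_add, ha g, hb g]
  algebraMap_mem' := fun c g => by rw [AlgHomClass.commutes]
  star_mem' := fun {a} ha g => by rw [map_star, ha g]

/-- The Rokhlin property for a finite group action, expressed in terms of representing
sequences for projections in `A_∞ = (ℓ^∞(ℕ,A)/c₀(ℕ,A)) ∩ A'`. -/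
def ActionHasRokhlin {G A : Type*} [Group G] [Fintype G] [CStarAlgebra A]
    (α : G → (A →⋆ₐ[ℂ] A)) : Prop :=
  ∃ e : G → ℕ → A,
    (∀ g, ∃ M : ℝ, ∀ k, ‖e g k‖ ≤ M) ∧
    (∀ g, Tendsto (fun k => ‖e g k * e g k - e g k‖) atTop (𝓝 0)) ∧
    (∀ g, Tendsto (fun k => ‖star (e g k) - e g k‖) atTop (𝓝 0)) ∧
    (∀ g (a : A), Tendsto (fun k => ‖e g k * a - a * e g k‖) atTop (𝓝 0)) ∧
    Tendsto (fun k => ‖(∑ g : G, e g k) - 1‖) atTop (𝓝 0) ∧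
    (∀ g h, Tendsto (fun k => ‖α g (e h k) - e (g * h) k‖) atTop (𝓝 0))

/-! ### Inclusions of unital C*-algebras, conditional expectations, Watatani index -/

variable {P A : Type*}

/-- `E : A →ₗ[ℂ] P` is a conditional expectation onto the subalgebra `P` (included in `A`
via the injective unital *-homomorphism `ι`). -/
structure IsCondExpect [CStarAlgebra P] [CStarAlgebra A] (ι : P →⋆ₐ[ℂ] A)
    (E : A →ₗ[ℂ] P) : Prop where
  restricts : ∀ p : P, E (ι p) = p
  pos : ∀ x : A, IsPosElem (E (star x * x))
  bimodule : ∀ (p q : P) (x : A), E (ι p * x * ι q) = p * E x * q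

/-- `{(u i, v i)}` is a quasi-basis for the conditional expectation `E`; the existence of a
quasi-basis says precisely that `E` is of index-finite type. -/
def IsQuasiBasis [CStarAlgebra P] [CStarAlgebra A] (ι : P →⋆ₐ[ℂ] A) (E : A →ₗ[ℂ] P)
    {m : ℕ} (u v : Fin m → A) : Prop :=
  ∀ a : A, (a = ∑ i, u i * ι (E (v i * a))) ∧ (a = ∑ i, ι (E (a * u i)) * v i)

/-- The Rokhlin property for a conditional expectation of index-finite type with index
`ind = ∑ u i * v i` : there is a projection `e` in `A_∞ = (ℓ^∞(ℕ,A)/c₀(ℕ,A)) ∩ A'`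
(given by a representing sequence) with `E^∞(e) = (Index E)⁻¹ · 1` such that `x ↦ x e`
is injective on `A`. -/
def CondExpectHasRokhlin [CStarAlgebra P] [CStarAlgebra A] (ι : P →⋆ₐ[ℂ] A)
    (E : A →ₗ[ℂ] P) (ind : A) : Prop :=
  ∃ e : ℕ → A,
    (∃ M : ℝ, ∀ k, ‖e k‖ ≤ M) ∧
    Tendsto (fun k => ‖e k * e k - e k‖) atTop (𝓝 0) ∧
    Tendsto (fun k => ‖star (e k) - e k‖) atTop (𝓝 0) ∧
    (∀ a : A, Tendsto (fun k => ‖e k * a - a * e k‖) atTop (𝓝 0)) ∧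
    (∃ w : A, w * ind = 1 ∧ ind * w = 1 ∧
      Tendsto (fun k => ‖ι (E (e k)) - w‖) atTop (𝓝 0)) ∧
    (∀ x : A, Tendsto (fun k => ‖x * e k‖) atTop (𝓝 0) → x = 0)

/-! ### Cuntz comparison, dimension functions, strict comparison, almost divisibility -/

/-- Cuntz subequivalence for positive matrices over a C*-algebra (the topology on matrices
over a C*-algebra is the norm topology, which agrees with the product topology). -/
def CuntzSub {R : Type*} [NonUnitalNonAssocSemiring R] [Star R] [TopologicalSpace R]
    {m k : Type*} [Fintype m] [Fintype k] (a : Matrix m m R) (b : Matrix k k R) : Prop :=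
  ∃ v : ℕ → Matrix m k R, Tendsto (fun j => v j * b * (v j).conjTranspose) atTop (𝓝 a)

/-- `matNthRoot a j` is the (unique, if it exists) positive `j`-th root `a^{1/j}` of a
positive matrix `a` over a C*-algebra. -/
def matNthRoot {R : Type*} [Ring R] [StarRing R] {m : Type*} [Fintype m] [DecidableEq m]
    (a : Matrix m m R) (j : ℕ) : Matrix m m R :=
  open scoped Classical in
  if h : ∃ b : Matrix m m R, IsPosElem b ∧ b ^ j = a then h.choose else 0

/-- The standard extension `τ ⊗ Tr` of a functional `τ` to matrices. -/
def traceExt {R : Type*} [Ring R] [Module ℂ R] {m : Type*} [Fintype m]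
    (τ : R →ₗ[ℂ] ℂ) (x : Matrix m m R) : ℂ :=
  ∑ i, τ (x i i)

/-- The dimension function `d_τ(a) = lim_{n → ∞} τ(a^{1/n})` associated to a tracial
state `τ` (the limit exists, so it agrees with the `limsup` used here). -/
def dimFun {R : Type*} [Ring R] [StarRing R] [Module ℂ R] {m : Type*} [Fintype m]
    [DecidableEq m] (τ : R →ₗ[ℂ] ℂ) (a : Matrix m m R) : ℝ :=
  Filter.limsup (fun j : ℕ => (traceExt τ (matNthRoot a (j + 1))).re) atTop

/-- A unital C*-algebra `R` has *strict comparison* (of positive elements, with respect to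
tracial states) if `d_τ(a) < d_τ(b)` for all tracial states `τ` implies `a ≾ b`. -/
def HasStrictComparison (R : Type*) [Ring R] [StarRing R] [Module ℂ R]
    [TopologicalSpace R] : Prop :=
  ∀ (m k : ℕ) (a : Matrix (Fin m) (Fin m) R) (b : Matrix (Fin k) (Fin k) R),
    IsPosElem a → IsPosElem b →
    (∀ τ : R →ₗ[ℂ] ℂ, IsTracialState τ → dimFun τ a < dimFun τ b) →
    CuntzSub a b

/-- The Cuntz semigroup `W(R)` is *almost divisible*: for every positive contraction `a`
over `R` and every `k ≠ 0` there is `x = ⟨c⟩ ∈ W(R)` with `k ⬝ x ≤ ⟨a⟩ ≤ (k+1) ⬝ x`. -/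
def AlmostDivisible (R : Type*) [Ring R] [StarRing R] [TopologicalSpace R] : Prop :=
  ∀ (m : ℕ) (a : Matrix (Fin m) (Fin m) R),
    IsPosElem a → IsPosElem ((1 : Matrix (Fin m) (Fin m) R) - a) →
    ∀ k : ℕ, k ≠ 0 →
      ∃ (l : ℕ) (c : Matrix (Fin l) (Fin l) R), IsPosElem c ∧
        CuntzSub (Matrix.blockDiagonal fun _ : Fin k => c) a ∧
        CuntzSub a (Matrix.blockDiagonal fun _ : Fin (k + 1) => c)

/-- A unital C*-algebra is *pure* if it has strict comparison and almost divisible Cuntz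
semigroup. -/
def IsPure (R : Type*) [Ring R] [StarRing R] [Module ℂ R] [TopologicalSpace R] : Prop :=
  HasStrictComparison R ∧ AlmostDivisible R

/-- The order on projections over `R` is determined by traces. -/
def ProjOrderDeterminedByTraces (R : Type*) [Ring R] [StarRing R] [Module ℂ R] : Prop :=
  ∀ (k l : ℕ) (p : Matrix (Fin k) (Fin k) R) (q : Matrix (Fin l) (Fin l) R),
    p * p = p → star p = p → q * q = q → star q = q →
    (∀ τ : R →ₗ[ℂ] ℂ, IsTracialState τ → (traceExt τ p).re < (traceExt τ q).re) →
    ∃ v : Matrix (Fin l) (Fin k) R,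
      v.conjTranspose * v = p ∧ IsPosElem (q - v * v.conjTranspose)

/-- A unital C*-algebra has stable rank one if its invertible elements are dense. -/
def HasStableRankOne (R : Type*) [Ring R] [TopologicalSpace R] : Prop :=
  Dense {x : R | IsUnit x}

/-- A unital C*-algebra is simple if it has no nontrivial closed two-sided ideals. -/
def IsSimpleCStarAlgebra (A : Type*) [CStarAlgebra A] : Prop :=
  ∀ I : TwoSidedIdeal A, IsClosed (I : Set A) → I = ⊥ ∨ I = ⊤
/-! ### Corners `pRp` by a projection `p` -/

section CornerSection

variable {R : Type*} [Ring R] [StarRing R] [Algebra ℂ R] [StarModule ℂ R]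

/-- The corner `p R p` of a unital C*-algebra `R` by a projection `p`, as a unital
`*`-algebra with unit `p`. -/
def Corner (p : R) (_hp : p * p = p) (_hsp : star p = p) : Type _ :=
  {x : R // p * x * p = x}

namespace Corner

variable {p : R} {hp : p * p = p} {hsp : star p = p}

theorem mem_mul_left (hp : p * p = p) {x : R} (hx : p * x * p = x) : p * x = x := by
  conv_lhs => rw [← hx]
  simp only [← mul_assoc]
  rw [hp, hx]

theorem mem_mul_right (hp : p * p = p) {x : R} (hx : p * x * p = x) : x * p = x := by
  conv_lhs => rw [← hx]
  rw [mul_assoc, mul_assoc, hp, ← mul_assoc, hx]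

instance : Add (Corner p hp hsp) :=
  ⟨fun x y => ⟨x.1 + y.1, by rw [mul_add, add_mul, x.2, y.2]⟩⟩

instance : Zero (Corner p hp hsp) :=
  ⟨⟨0, by rw [mul_zero, zero_mul]⟩⟩

instance : Neg (Corner p hp hsp) :=
  ⟨fun x => ⟨-x.1, by rw [mul_neg, neg_mul, x.2]⟩⟩

instance : Mul (Corner p hp hsp) :=
  ⟨fun x y => ⟨x.1 * y.1, by
    rw [← mul_assoc p x.1 y.1, mem_mul_left hp x.2, mul_assoc x.1 y.1 p,
      mem_mul_right hp y.2]⟩⟩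

instance : One (Corner p hp hsp) :=
  ⟨⟨p, by rw [hp, hp]⟩⟩

instance : SMul ℂ (Corner p hp hsp) :=
  ⟨fun c x => ⟨c • x.1, by rw [mul_smul_comm, smul_mul_assoc, x.2]⟩⟩

instance : Star (Corner p hp hsp) :=
  ⟨fun x => ⟨star x.1, by
    conv_rhs => rw [← x.2]
    rw [star_mul, star_mul, hsp, ← mul_assoc]⟩⟩

@[simp] theorem val_add (x y : Corner p hp hsp) : (x + y).1 = x.1 + y.1 := rfl
@[simp] theorem val_mul (x y : Corner p hp hsp) : (x * y).1 = x.1 * y.1 := rfl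
@[simp] theorem val_zero : (0 : Corner p hp hsp).1 = 0 := rfl
@[simp] theorem val_one : (1 : Corner p hp hsp).1 = p := rfl
@[simp] theorem val_neg (x : Corner p hp hsp) : (-x).1 = -x.1 := rfl
@[simp] theorem val_smul (c : ℂ) (x : Corner p hp hsp) : (c • x).1 = c • x.1 := rfl
@[simp] theorem val_star (x : Corner p hp hsp) : (star x).1 = star x.1 := rfl

instance instRing : Ring (Corner p hp hsp) where
  add_assoc x y z := Subtype.ext <| by simp [add_assoc]
  zero_add x := Subtype.ext <| by simp
  add_zero x := Subtype.ext <| by simp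
  add_comm x y := Subtype.ext <| by simp [add_comm]
  neg_add_cancel x := Subtype.ext <| by simp
  nsmul := nsmulRec
  zsmul := zsmulRec
  mul_assoc x y z := Subtype.ext <| by simp [mul_assoc]
  one_mul x := Subtype.ext <| by simpa using mem_mul_left hp x.2
  mul_one x := Subtype.ext <| by simpa using mem_mul_right hp x.2
  left_distrib x y z := Subtype.ext <| by simp [left_distrib]
  right_distrib x y z := Subtype.ext <| by simp [right_distrib]
  zero_mul x := Subtype.ext <| by simp
  mul_zero x := Subtype.ext <| by simp

instance instStarRing : StarRing (Corner p hp hsp) where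
  star_involutive x := Subtype.ext <| by simp
  star_mul x y := Subtype.ext <| by simp
  star_add x y := Subtype.ext <| by simp

instance instModule : Module ℂ (Corner p hp hsp) where
  one_smul x := Subtype.ext <| by simp
  mul_smul c d x := Subtype.ext <| by simp [mul_smul]
  smul_zero c := Subtype.ext <| by simp
  smul_add c x y := Subtype.ext <| by simp
  add_smul c d x := Subtype.ext <| by simp [add_smul]
  zero_smul x := Subtype.ext <| by simp

instance instTop [TopologicalSpace R] : TopologicalSpace (Corner p hp hsp) :=
  instTopologicalSpaceSubtype

end Corner

end CornerSection

/-! ### Sequence algebras: `A^∞ = ℓ^∞(ℕ, A)/c₀(ℕ, A)` via representing sequences -/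

/-- A sequence in a normed space is null (i.e. lies in `c₀(ℕ, A)`). -/
def IsNullSeq {A : Type*} [Norm A] (x : ℕ → A) : Prop :=
  Tendsto (fun n => ‖x n‖) atTop (𝓝 0)

/-- A sequence in a normed space is bounded (i.e. lies in `ℓ^∞(ℕ, A)`). -/
def IsBddSeq {A : Type*} [Norm A] (x : ℕ → A) : Prop :=
  ∃ M : ℝ, ∀ n, ‖x n‖ ≤ M

/-- A linear map `β : A →ₗ[ℂ] ℓ^∞(ℕ, P)` represents a unital *-homomorphism
`A → P^∞ = ℓ^∞(ℕ, P)/c₀(ℕ, P)` : it takes values in bounded sequences and is unital,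
multiplicative and star-preserving modulo `c₀(ℕ, P)`. -/
structure RepresentsHomToSeqAlg {A P : Type*} [CStarAlgebra A] [CStarAlgebra P]
    (β : A →ₗ[ℂ] (ℕ → P)) : Prop where
  bdd : ∀ x : A, IsBddSeq (β x)
  unital : IsNullSeq (β 1 - 1)
  mul : ∀ x y : A, IsNullSeq (β (x * y) - β x * β y)
  star : ∀ x : A, IsNullSeq (β (star x) - star (β x))

/-- A Banach limit: a linear functional on (bounded) complex sequences which is unital,
shift-invariant, positive and bounded. -/
structure IsBanachLimit (L : (ℕ → ℂ) →ₗ[ℂ] ℂ) : Prop where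
  unital : L 1 = 1
  shift : ∀ x : ℕ → ℂ, IsBddSeq x → L (fun n => x (n + 1)) = L x
  pos : ∀ x : ℕ → ℂ, IsBddSeq x → (∀ n, 0 ≤ x n) → 0 ≤ L x
  norm_le : ∀ (x : ℕ → ℂ) (M : ℝ), (∀ n, ‖x n‖ ≤ M) → ‖L x‖ ≤ M

/-- A C*-algebra is *exact* iff it is nuclearly embeddable (Kirchberg): it admits a faithful
representation `π : A → B(H)` which approximately factors through matrix algebras by
completely positive contractions in the point-norm topology. -/
def IsExactCStar (A : Type*) [CStarAlgebra A] : Prop :=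
  ∃ (H : Type) (_ : NormedAddCommGroup H) (_ : InnerProductSpace ℂ H) (_ : CompleteSpace H)
    (π : A →⋆ₐ[ℂ] (H →L[ℂ] H)), Function.Injective π ∧
      ∀ (S : Finset A) (ε : ℝ), 0 < ε →
        ∃ (k : ℕ) (ψ : A →ₗ[ℂ] Matrix (Fin k) (Fin k) ℂ)
          (φ : Matrix (Fin k) (Fin k) ℂ →ₗ[ℂ] (H →L[ℂ] H)),
          IsCompletelyPositive ψ ∧ IsCompletelyPositive φ ∧
          (∀ a : A, ‖ψ a‖ ≤ ‖a‖) ∧ (∀ x, ‖φ x‖ ≤ ‖x‖) ∧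
          ∀ a ∈ S, ‖φ (ψ a) - π a‖ < ε



section basics
variable {D G : Type*} [CStarAlgebra D] [CStarAlgebra G]

theorem posElem_iff {D : Type*} [CStarAlgebra D] [PartialOrder D] [StarOrderedRing D] {a : D} :
    IsPosElem a ↔ 0 ≤ a := by
  rw [CStarAlgebra.nonneg_iff_eq_star_mul_self]; rfl

theorem posElem_star {R : Type*} [Ring R] [StarRing R] {a : R} (h : IsPosElem a) : star a = a := by
  obtain ⟨y, rfl⟩ := h; simp

theorem posElem_conj {R : Type*} [Ring R] [StarRing R] {a : R} (h : IsPosElem a) (z : R) :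
    IsPosElem (star z * a * z) := by
  obtain ⟨y, rfl⟩ := h; exact ⟨y * z, by simp [mul_assoc]⟩

theorem posElem_conj' {R : Type*} [Ring R] [StarRing R] {a : R} (h : IsPosElem a) (z : R) :
    IsPosElem (z * a * star z) := by
  simpa using posElem_conj h (star z)

theorem posElem_add {D : Type*} [CStarAlgebra D] {a b : D} (ha : IsPosElem a) (hb : IsPosElem b) :
    IsPosElem (a + b) := by
  letI := CStarAlgebra.spectralOrder D
  haveI := CStarAlgebra.spectralOrderedRing D
  rw [posElem_iff] at *; exact add_nonneg ha hb

theorem posElem_sum {D : Type*} [CStarAlgebra D] {κ : Type*} (s : Finset κ) (f : κ → D)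
    (h : ∀ i ∈ s, IsPosElem (f i)) : IsPosElem (∑ i ∈ s, f i) := by
  letI := CStarAlgebra.spectralOrder D
  haveI := CStarAlgebra.spectralOrderedRing D
  simp only [posElem_iff] at *; exact Finset.sum_nonneg h

theorem posElem_smul {D : Type*} [CStarAlgebra D] {a : D} (ha : IsPosElem a) {t : ℝ} (ht : 0 ≤ t) :
    IsPosElem ((t : ℂ) • a) := by
  obtain ⟨y, rfl⟩ := ha
  refine ⟨((Real.sqrt t : ℝ) : ℂ) • y, ?_⟩
  rw [star_smul, smul_mul_smul_comm]
  simp [← Complex.ofReal_mul, Real.mul_self_sqrt ht]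

/-- completely positive with `T 1 ≤ 1` -/
def CPC {D G : Type*} [Ring D] [StarRing D] [Module ℂ D] [Ring G] [StarRing G] [Module ℂ G]
    (T : D →ₗ[ℂ] G) : Prop :=
  IsCompletelyPositive T ∧ IsPosElem (1 - T 1)

section alg
variable {R R' R'' : Type*} [Ring R] [StarRing R] [Module ℂ R] [Ring R'] [StarRing R'] [Module ℂ R']
  [Ring R''] [StarRing R''] [Module ℂ R'']

theorem cp_pos {T : R →ₗ[ℂ] R'} (hT : IsCompletelyPositive T) {x : R} (hx : IsPosElem x) :
    IsPosElem (T x) := by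
  obtain ⟨y, rfl⟩ := hx
  obtain ⟨Z, hZ⟩ := hT 1 (Matrix.of fun _ _ => star y * y) ⟨Matrix.of fun _ _ => y, by
    ext i j; simp [Matrix.mul_apply]⟩
  refine ⟨Z 0 0, ?_⟩
  have := congrFun (congrFun hZ 0) 0
  simpa [Matrix.mul_apply] using this

theorem cp_comp {T : R →ₗ[ℂ] R'} {T' : R' →ₗ[ℂ] R''} (hT : IsCompletelyPositive T)
    (hT' : IsCompletelyPositive T') : IsCompletelyPositive (T' ∘ₗ T) := fun k x hx => by
  have := hT' k _ (hT k x hx)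
  rwa [Matrix.map_map] at this

theorem cp_two {T : R →ₗ[ℂ] R'} (hT : IsCompletelyPositive T) (y : R) :
    ∃ a b c d : R', T (y * star y) = star a * a + star c * c ∧ T y = star a * b + star c * d ∧
      T (star y) = star b * a + star d * c ∧ T 1 = star b * b + star d * d := by
  obtain ⟨Z, hZ⟩ := hT 2 !![y * star y, y; star y, 1] ⟨!![star y, 1; 0, 0], by
    ext i j; fin_cases i <;> fin_cases j <;> simp [Matrix.mul_apply]⟩
  refine ⟨Z 0 0, Z 0 1, Z 1 0, Z 1 1, ?_, ?_, ?_, ?_⟩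
  · have := congrFun (congrFun hZ 0) 0
    simpa [Matrix.mul_apply] using this
  · have := congrFun (congrFun hZ 0) 1
    simpa [Matrix.mul_apply] using this
  · have := congrFun (congrFun hZ 1) 0
    simpa [Matrix.mul_apply] using this
  · have := congrFun (congrFun hZ 1) 1
    simpa [Matrix.mul_apply] using this

theorem cp_star {T : R →ₗ[ℂ] R'} (hT : IsCompletelyPositive T) (y : R) :
    T (star y) = star (T y) := by
  obtain ⟨a, b, c, d, h1, h2, h3, h4⟩ := cp_two hT y
  rw [h2, h3]; simp

theorem cp_conj {T : R →ₗ[ℂ] R'} (hT : IsCompletelyPositive T) {T' : R →ₗ[ℂ] R'} (z : R')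
    (h : ∀ x, T' x = z * T x * star z) : IsCompletelyPositive T' := fun k x hx => by
  obtain ⟨Y, hY⟩ := hT k x hx
  refine ⟨Matrix.of fun i j => Y i j * star z, ?_⟩
  ext i j
  have := congrFun (congrFun hY i) j
  simp only [Matrix.map_apply, Matrix.mul_apply, Matrix.star_apply] at this
  simp only [Matrix.map_apply, Matrix.mul_apply, Matrix.star_apply, Matrix.of_apply, h, this, Finset.mul_sum,
    Finset.sum_mul, star_mul, star_star, mul_assoc]

theorem cp_conj_dom {T : R' →ₗ[ℂ] R''} (hT : IsCompletelyPositive T) {T' : R' →ₗ[ℂ] R''} (z : R')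
    (h : ∀ x, T' x = T (z * x * star z)) : IsCompletelyPositive T' := fun k x hx => by
  obtain ⟨Y, hY⟩ := hx
  have := hT k (Matrix.of fun i j => z * x i j * star z) ⟨Matrix.of fun i j => Y i j * star z, by
    ext i j
    subst hY
    simp only [Matrix.mul_apply, Matrix.star_apply, Matrix.of_apply, Finset.mul_sum,
      Finset.sum_mul, star_mul, star_star, mul_assoc]⟩
  convert this using 1
  ext i j; simp [h]

theorem cp_hom {T : R →ₗ[ℂ] R'} (hm : ∀ x y, T (x * y) = T x * T y)
    (hs : ∀ x, T (star x) = star (T x)) : IsCompletelyPositive T := fun k x hx => by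
  obtain ⟨Y, rfl⟩ := hx
  refine ⟨Y.map T, ?_⟩
  ext i j
  simp [Matrix.mul_apply, hm, hs]

theorem cpc_hom {T : R →ₗ[ℂ] R'} (hm : ∀ x y, T (x * y) = T x * T y)
    (hs : ∀ x, T (star x) = star (T x)) : CPC T := by
  refine ⟨cp_hom hm hs, 1 - T 1, ?_⟩
  have h1 : T 1 * T 1 = T 1 := by rw [← hm, one_mul]
  have h2 : star (T 1) = T 1 := by rw [← hs, star_one]
  simp [mul_sub, sub_mul, h1, h2]

end alg

theorem cpc_schwarz {T : D →ₗ[ℂ] G} (hT : CPC T) (y : D) :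
    IsPosElem (T (y * star y) - T y * star (T y)) := by
  obtain ⟨a, b, c, d, h1, h2, h3, h4⟩ := cp_two hT.1 y
  obtain ⟨z, hz⟩ := hT.2
  have e : T (y * star y) - T y * star (T y) =
      star (a - b * T (star y)) * (a - b * T (star y)) +
      (star (c - d * T (star y)) * (c - d * T (star y)) +
      star (z * T (star y)) * (z * T (star y))) := by
    have : star (z * T (star y)) * (z * T (star y)) = T y * (1 - T 1) * T (star y) := by
      rw [hz, star_mul, ← cp_star hT.1, star_star]; simp only [mul_assoc]
    rw [this, h4, ← cp_star hT.1]
    simp only [star_sub, star_mul, ← cp_star hT.1, star_star]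
    rw [h1]
    have e2 : T y * T (star y) = (star a * b + star c * d) * T (star y) := by rw [h2]
    have e3 : T y * T (star y) = T y * (star b * a + star d * c) := by rw [h3]
    have e4 : star a * (b * T (star y)) + star c * (d * T (star y)) = T y * T (star y) := by
      rw [e2]; noncomm_ring
    have e5 : T y * star b * a + T y * star d * c = T y * T (star y) := by
      rw [e3]; noncomm_ring
    have : (star a - T y * star b) * (a - b * T (star y)) +
        ((star c - T y * star d) * (c - d * T (star y)) +
        T y * (1 - (star b * b + star d * d)) * T (star y)) =
        star a * a + star c * c - (star a * (b * T (star y)) + star c * (d * T (star y)))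
        - (T y * star b * a + T y * star d * c) + T y * T (star y) := by noncomm_ring
    rw [this, e4, e5]; abel
  rw [e]
  exact posElem_add ⟨_, rfl⟩ (posElem_add ⟨_, rfl⟩ ⟨_, rfl⟩)

theorem norm_le_of_pos {a b : D} (ha : IsPosElem a) (hab : IsPosElem (b - a)) : ‖a‖ ≤ ‖b‖ := by
  letI := CStarAlgebra.spectralOrder D
  haveI := CStarAlgebra.spectralOrderedRing D
  rw [posElem_iff] at *
  exact CStarAlgebra.norm_le_norm_of_nonneg_of_le ha (sub_nonneg.1 hab)

theorem posElem_one_sub {a : D} (ha : IsPosElem a) (h : ‖a‖ ≤ 1) : IsPosElem (1 - a) := by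
  letI := CStarAlgebra.spectralOrder D
  haveI := CStarAlgebra.spectralOrderedRing D
  rw [posElem_iff] at *
  exact sub_nonneg.2 ((CStarAlgebra.norm_le_one_iff_of_nonneg a ha).1 h)

theorem posElem_norm_le_one {a : D} (ha : IsPosElem a) (h : IsPosElem (1 - a)) : ‖a‖ ≤ 1 := by
  letI := CStarAlgebra.spectralOrder D
  haveI := CStarAlgebra.spectralOrderedRing D
  rw [posElem_iff] at *
  exact (CStarAlgebra.norm_le_one_iff_of_nonneg a ha).2 (sub_nonneg.1 h)

theorem posElem_norm_sub {a : D} (ha : star a = a) {r : ℝ} (h : ‖a‖ ≤ r) :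
    IsPosElem ((r : ℂ) • (1 : D) - a) := by
  letI := CStarAlgebra.spectralOrder D
  haveI := CStarAlgebra.spectralOrderedRing D
  rw [posElem_iff]
  have h1 := IsSelfAdjoint.le_algebraMap_norm_self (a := a) ha
  have h2 : algebraMap ℝ D ‖a‖ ≤ algebraMap ℝ D r := algebraMap_mono D h
  have h3 : algebraMap ℝ D r = (r : ℂ) • (1 : D) := by
    rw [Algebra.algebraMap_eq_smul_one]; exact (Complex.coe_smul r (1 : D)).symm
  rw [h3] at h2
  exact sub_nonneg.2 (h1.trans h2)

theorem cpc_norm {T : D →ₗ[ℂ] G} (hT : CPC T) (y : D) : ‖T y‖ ≤ ‖y‖ := by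
  have h0 : ‖T 1‖ ≤ 1 := posElem_norm_le_one (cp_pos hT.1 ⟨1, by simp⟩) hT.2
  have h1 : ‖T y * star (T y)‖ ≤ ‖T (y * star y)‖ :=
    norm_le_of_pos ⟨star (T y), by simp⟩ (cpc_schwarz hT y)
  have h2 : ‖T (y * star y)‖ ≤ ‖y‖ ^ 2 := by
    have h3 : IsPosElem (((‖y‖ ^ 2 : ℝ) : ℂ) • (1 : D) - y * star y) :=
      posElem_norm_sub (by simp) (by rw [CStarRing.norm_self_mul_star, sq])
    have h4 := cp_pos hT.1 h3
    rw [map_sub, map_smul] at h4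
    refine (norm_le_of_pos (cp_pos hT.1 ⟨star y, by simp⟩) h4).trans ?_
    rw [norm_smul]
    simp only [Complex.norm_real, Real.norm_eq_abs, abs_pow, abs_norm]
    nlinarith [sq_nonneg ‖y‖]
  rw [CStarRing.norm_self_mul_star] at h1
  nlinarith [norm_nonneg y, norm_nonneg (T y)]

theorem cpc_of_norm {T : D →ₗ[ℂ] G} (hT : IsCompletelyPositive T) (h : ‖T 1‖ ≤ 1) : CPC T :=
  ⟨hT, posElem_one_sub (cp_pos hT ⟨1, by simp⟩) h⟩

theorem norm_one_le_one : ‖(1 : D)‖ ≤ 1 := by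
  rcases subsingleton_or_nontrivial D with h | h
  · rw [Subsingleton.elim (1 : D) 0]; simp
  · simp

theorem cpc_comp {K : Type*} [CStarAlgebra K] {T : D →ₗ[ℂ] G} {T' : G →ₗ[ℂ] K} (hT : CPC T)
    (hT' : CPC T') : CPC (T' ∘ₗ T) := by
  refine cpc_of_norm (cp_comp hT.1 hT'.1) ?_
  exact (cpc_norm hT' _).trans ((cpc_norm hT _).trans norm_one_le_one)

/-- positivity is reflected by injective star homs -/
theorem posElem_reflect (j : D →⋆ₙₐ[ℂ] G) (hj : Function.Injective j) {x : D}
    (hx : IsPosElem (j x)) : IsPosElem x := by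
  letI := CStarAlgebra.spectralOrder D
  haveI := CStarAlgebra.spectralOrderedRing D
  letI := CStarAlgebra.spectralOrder G
  haveI := CStarAlgebra.spectralOrderedRing G
  have hsa : IsSelfAdjoint x := hj (by rw [map_star]; exact posElem_star hx)
  have e1 : x = x⁺ - x⁻ := (CFC.posPart_sub_negPart x hsa).symm
  have e2 : x⁻ * x * x⁻ = - (x⁻ * x⁻ * x⁻) := by
    have : x⁻ * x = - (x⁻ * x⁻) := by
      nth_rw 2 [← CFC.posPart_sub_negPart x hsa]
      rw [mul_sub, CFC.negPart_mul_posPart, zero_sub]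
    rw [this, neg_mul]
  have hn : 0 ≤ x⁻ := CFC.negPart_nonneg x
  have hns : star x⁻ = x⁻ := (IsSelfAdjoint.of_nonneg hn)
  have h3 : 0 ≤ x⁻ * x⁻ * x⁻ := by
    have := star_left_conjugate_nonneg hn x⁻
    rwa [hns] at this
  have h4 : IsPosElem (j (x⁻ * x⁻ * x⁻)) := by
    obtain ⟨y, hy⟩ := posElem_iff.2 h3
    exact ⟨j y, by rw [hy, map_mul, map_star]⟩
  have h5 : IsPosElem (-j (x⁻ * x⁻ * x⁻)) := by
    rw [← map_neg, ← e2]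
    have := posElem_conj hx (j x⁻)
    rwa [← map_star, hns, ← map_mul, ← map_mul] at this
  have h6 : j (x⁻ * x⁻ * x⁻) = 0 := by
    rw [posElem_iff] at h4 h5
    exact le_antisymm (neg_nonneg.1 h5) h4
  have h7 : x⁻ * x⁻ * x⁻ = 0 := hj (by rw [h6, map_zero])
  have h8 : x⁻ * x⁻ = 0 := by
    have : star (x⁻ * x⁻) * (x⁻ * x⁻) = 0 := by
      rw [star_mul, hns, ← mul_assoc, h7, zero_mul]
    exact CStarRing.star_mul_self_eq_zero_iff _ |>.1 this
  have h9 : x⁻ = 0 := by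
    have : star (x⁻) * (x⁻) = 0 := by rw [hns, h8]
    exact CStarRing.star_mul_self_eq_zero_iff _ |>.1 this
  rw [posElem_iff, e1, h9, sub_zero]
  exact CFC.posPart_nonneg x

theorem cp_reflect {K : Type*} [Ring K] [StarRing K] [Module ℂ K] {T : K →ₗ[ℂ] D}
    {T' : K →ₗ[ℂ] G} (j : D →⋆ₙₐ[ℂ] G) (hj : Function.Injective j)
    (h : ∀ x, j (T x) = T' x) (hT' : IsCompletelyPositive T') : IsCompletelyPositive T :=
  fun k x hx => by
  let J : CStarMatrix (Fin k) (Fin k) D →⋆ₙₐ[ℂ] CStarMatrix (Fin k) (Fin k) G := CStarMatrix.mapₙₐ j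
  have hJ : Function.Injective J := fun M N hMN => by
    ext i i'
    exact hj (congrFun (congrFun hMN i) i')
  have h1 : IsPosElem (J (CStarMatrix.ofMatrix (x.map T))) := by
    obtain ⟨Y, hY⟩ := hT' k x hx
    refine ⟨CStarMatrix.ofMatrix Y, ?_⟩
    ext i i'
    have := congrFun (congrFun hY i) i'
    simp only [Matrix.map_apply] at this
    change j (T (x i i')) = _
    rw [h, this]
    rfl
  letI := CStarAlgebra.spectralOrder D
  haveI := CStarAlgebra.spectralOrderedRing D
  letI := CStarAlgebra.spectralOrder G
  haveI := CStarAlgebra.spectralOrderedRing G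
  obtain ⟨Y, hY⟩ := posElem_reflect J hJ h1
  exact ⟨Y, hY⟩

end basics


/-- index data for a finite-dimensional C*-algebra -/
structure FDx : Type 1 where
  ι : Type
  [fι : Fintype ι]
  [dι : DecidableEq ι]
  n : ι → Type
  [fn : ∀ i, Fintype (n i)]
  [dn : ∀ i, DecidableEq (n i)]

attribute [instance] FDx.fι FDx.dι FDx.fn FDx.dn

/-- the finite-dimensional C*-algebra -/
abbrev FDx.alg (F : FDx) : Type := ∀ i : F.ι, Matrix (F.n i) (F.n i) ℂ

/-- order zero maps -/
def OZ {F D : Type*} [Mul F] [Zero F] [Mul D] [Zero D] (φ : F → D) : Prop :=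
  ∀ e f, e * f = 0 → f * e = 0 → φ e * φ f = 0

/-- finite nuclear dimension, with the colours separated -/
def ColorApprox (κ : Type) [Fintype κ] (D : Type*) [CStarAlgebra D] : Prop :=
  ∀ (S : Finset D) (ε : ℝ), 0 < ε →
    ∃ (F : κ → FDx) (ψ : ∀ j, D →ₗ[ℂ] (F j).alg) (φ : ∀ j, (F j).alg →ₗ[ℂ] D),
      (∀ j, CPC (ψ j)) ∧ (∀ j, CPC (φ j)) ∧ (∀ j, OZ (φ j)) ∧
      ∀ a ∈ S, ‖∑ j, φ j (ψ j a) - a‖ < ε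

theorem colorApprox_of_nd {n : ℕ} {D : Type*} [CStarAlgebra D] (h : NuclearDimensionLE n D) :
    ColorApprox (Fin (n + 1)) D := by
  intro S ε hε
  obtain ⟨s, r, J, ψ, φ, hψ, hφ, hψ1, hφ1, hap⟩ := h S ε hε
  let π : Fin (n + 1) → FDBlock s r →ₗ[ℂ] FDBlock s r := fun j =>
    { toFun := fun x i => if J i = j then x i else 0
      map_add' := fun x y => by ext1 i; by_cases h : J i = j <;> simp [h]
      map_smul' := fun c x => by ext1 i; by_cases h : J i = j <;> simp [h] }
  have hπ1 : ∀ j x y, π j (x * y) = π j x * π j y := fun j x y => by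
    ext1 i; by_cases h : J i = j <;> simp [π, h]
  have hπ2 : ∀ j x, π j (star x) = star (π j x) := fun j x => by
    ext1 i; by_cases h : J i = j <;> simp [π, h]
  have hπ3 : ∀ j x, π j x ∈ blockSupp (r := r) J j := fun j x i hi => by simp [π, hi]
  refine ⟨fun _ => ⟨Fin s, fun i => Fin (r i)⟩, fun _ => ψ, fun j => φ ∘ₗ π j, ?_, ?_, ?_, ?_⟩
  · intro j
    exact cpc_of_norm hψ ((hψ1 1).trans norm_one_le_one)
  · intro j
    refine cpc_of_norm (cp_comp (cp_hom (hπ1 j) (hπ2 j)) hφ) ?_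
    refine ((hφ1 j).1 _ (hπ3 j 1)).trans ?_
    exact (cpc_norm (cpc_hom (hπ1 j) (hπ2 j)) 1).trans norm_one_le_one
  · intro j e f hef hfe
    refine ((hφ1 j).2 _ (hπ3 j e) _ (hπ3 j f) ?_ ?_).1
    · rw [← hπ1, hef, map_zero]
    · rw [← hπ1, hfe, map_zero]
  · intro a ha
    have : ∑ j, (φ ∘ₗ π j) (ψ a) = φ (ψ a) := by
      simp only [LinearMap.comp_apply, ← map_sum]
      congr 1
      ext1 i
      simp [π]
    have h2 := hap a ha
    rw [← this] at h2
    exact h2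

theorem cp_sum {κ : Type*} {R D : Type*} [Ring R] [StarRing R] [Module ℂ R] [CStarAlgebra D]
    (s : Finset κ) (T : κ → R →ₗ[ℂ] D) (h : ∀ j ∈ s, IsCompletelyPositive (T j)) :
    IsCompletelyPositive (∑ j ∈ s, T j) := by
  intro k x hx
  letI := CStarAlgebra.spectralOrder D
  haveI := CStarAlgebra.spectralOrderedRing D
  have : ∀ j ∈ s, IsPosElem (CStarMatrix.ofMatrix (x.map (T j))) := fun j hj => h j hj k x hx
  obtain ⟨Y, hY⟩ := posElem_sum s _ this
  refine ⟨Y, ?_⟩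
  refine Eq.trans ?_ hY
  ext i i'
  simp only [Matrix.map_apply, LinearMap.sum_apply]
  have h2 : ∀ s : Finset κ, (∑ j ∈ s, CStarMatrix.ofMatrix (x.map (T j))) i i' =
      ∑ j ∈ s, T j (x i i') := fun s => by
    classical
    induction s using Finset.induction_on with
    | empty => simp
    | insert a s ha ih => rw [Finset.sum_insert ha, Finset.sum_insert ha, CStarMatrix.add_apply, ih]; rfl
  exact (h2 s).symm

theorem cp_pi {ι : Type*} [Fintype ι] {R : Type*} {Q : ι → Type*} [Ring R] [StarRing R] [Module ℂ R]
    [∀ i, Ring (Q i)] [∀ i, StarRing (Q i)] [∀ i, Module ℂ (Q i)] (T : R →ₗ[ℂ] ∀ i, Q i)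
    (h : ∀ i, IsCompletelyPositive (LinearMap.proj i ∘ₗ T)) : IsCompletelyPositive T := by
  intro k x hx
  choose Y hY using fun i => h i k x hx
  refine ⟨Matrix.of fun a b i => Y i a b, ?_⟩
  ext a b i
  have := congrFun (congrFun (hY i) a) b
  simpa [Matrix.mul_apply] using this

theorem nd_of_colorApprox {κ : Type} [Fintype κ] {D : Type*} [CStarAlgebra D]
    (h : ColorApprox κ D) : NuclearDimensionLE (Fintype.card κ) D := by
  classical
  intro S ε hε
  obtain ⟨F, ψ, φ, hψ, hφ, hoz, hap⟩ := h S ε hε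
  let e := (Fintype.equivFin (Σ j, (F j).ι)).symm
  let N := Fintype.card (Σ j, (F j).ι)
  let g : ∀ p : (Σ j, (F j).ι), Fin (Fintype.card ((F p.1).n p.2)) ≃ (F p.1).n p.2 :=
    fun p => (Fintype.equivFin _).symm
  let r : Fin N → ℕ := fun i => Fintype.card ((F (e i).1).n (e i).2)
  let Q : (Σ j, (F j).ι) → Type :=
    fun p => Matrix (Fin (Fintype.card ((F p.1).n p.2))) (Fin (Fintype.card ((F p.1).n p.2))) ℂ
  let L := Equiv.piCongrLeft Q e
  have hL : ∀ (y : FDBlock N r) i, L y (e i) = y i := fun y i =>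
    Equiv.piCongrLeft_apply_apply Q e y i
  have hLadd : ∀ (x y : FDBlock N r) p, L (x + y) p = (L x p + L y p : Q p) := fun x y p => by
    obtain ⟨i, rfl⟩ := e.surjective p; rw [hL, hL, hL]; rfl
  have hLmul : ∀ (x y : FDBlock N r) p, L (x * y) p = (L x p * L y p : Q p) := fun x y p => by
    obtain ⟨i, rfl⟩ := e.surjective p; rw [hL, hL, hL]; rfl
  have hLsmul : ∀ (c : ℂ) (x : FDBlock N r) p, L (c • x) p = (c • L x p : Q p) := fun c x p => by
    obtain ⟨i, rfl⟩ := e.surjective p; rw [hL, hL]; rfl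
  have hLstar : ∀ (x : FDBlock N r) p, L (star x) p = (star (L x p) : Q p) := fun x p => by
    obtain ⟨i, rfl⟩ := e.surjective p; rw [hL, hL]; rfl
  have hLeq : ∀ (x : ∀ p, Q p) p, L (fun i => x (e i)) p = x p := fun x p => by
    obtain ⟨i, rfl⟩ := e.surjective p; rw [hL]
  let ψ' : D →ₗ[ℂ] FDBlock N r :=
    { toFun := fun a i => (ψ (e i).1 a (e i).2).submatrix (g (e i)) (g (e i))
      map_add' := fun x y => by ext i a b; simp
      map_smul' := fun c x => by ext i a b; simp }
  let ρ : ∀ j, FDBlock N r →ₗ[ℂ] (F j).alg := fun j =>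
    { toFun := fun y a => (show Q ⟨j, a⟩ from L y ⟨j, a⟩).submatrix (g ⟨j, a⟩).symm (g ⟨j, a⟩).symm
      map_add' := fun x y => by
        ext1 a; rw [hLadd]; rfl
      map_smul' := fun c x => by
        ext1 a; rw [hLsmul]; rfl }
  have hρ : ∀ j y a, ρ j y a = (show Q ⟨j, a⟩ from L y ⟨j, a⟩).submatrix (g ⟨j, a⟩).symm (g ⟨j, a⟩).symm :=
    fun j y a => rfl
  have hρmul : ∀ j x y, ρ j (x * y) = ρ j x * ρ j y := fun j x y => by
    ext1 a; rw [hρ, hLmul, Pi.mul_apply, hρ, hρ]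
    exact (Matrix.submatrix_mul_equiv _ _ _ _ _).symm
  have hρstar : ∀ j x, ρ j (star x) = star (ρ j x) := fun j x => by
    ext1 a; rw [hρ, hLstar, Pi.star_apply, hρ]; rfl
  have hρψ : ∀ j a, ρ j (ψ' a) = ψ j a := fun j a => by
    ext1 b
    have : L (ψ' a) ⟨j, b⟩ = ((ψ j a b).submatrix (g ⟨j, b⟩) (g ⟨j, b⟩) : Q ⟨j, b⟩) :=
      hLeq (fun p => (ψ p.1 a p.2).submatrix (g p) (g p)) ⟨j, b⟩
    rw [hρ, this]
    ext; simp
  let col : κ → Fin (Fintype.card κ + 1) := fun j => (Fintype.equivFin κ j).castSucc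
  have hcol : Function.Injective col := fun a b hab =>
    (Fintype.equivFin κ).injective (Fin.castSucc_injective _ hab)
  let J : Fin N → Fin (Fintype.card κ + 1) := fun i => col (e i).1
  have hz : ∀ (c : Fin (Fintype.card κ + 1)) (j : κ), col j ≠ c → ∀ x ∈ blockSupp (r := r) J c,
      ρ j x = 0 := fun c j hj x hx => by
    ext1 a
    have : ∀ p : (Σ j, (F j).ι), col p.1 ≠ c → L x p = (0 : Q p) := fun p hp => by
      obtain ⟨i, rfl⟩ := e.surjective p
      rw [hL]; exact hx i hp
    rw [hρ, this ⟨j, a⟩ hj]; rfl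
  have key : ∀ c : Fin (Fintype.card κ + 1), (∃ j, ∀ x ∈ blockSupp (r := r) J c,
      (∑ j, φ j ∘ₗ ρ j) x = φ j (ρ j x)) ∨ (∀ x ∈ blockSupp (r := r) J c,
      (∑ j, φ j ∘ₗ ρ j) x = 0) := fun c => by
    by_cases hc : ∃ j, col j = c
    · left
      obtain ⟨j, hj⟩ := hc
      refine ⟨j, fun x hx => ?_⟩
      rw [LinearMap.sum_apply, Finset.sum_eq_single j]
      · rfl
      · intro b _ hb
        rw [LinearMap.comp_apply, hz c b (fun h => hb (hcol (h.trans hj.symm))) x hx, map_zero]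
      · simp
    · right
      intro x hx
      rw [LinearMap.sum_apply]
      refine Finset.sum_eq_zero fun b _ => ?_
      rw [LinearMap.comp_apply, hz c b (fun h => hc ⟨b, h⟩) x hx, map_zero]
  have hψ' : CPC ψ' := by
    constructor
    · refine cp_pi _ fun i => ?_
      let σ : (F (e i).1).alg →ₗ[ℂ] Matrix (Fin (r i)) (Fin (r i)) ℂ :=
        { toFun := fun x => (x (e i).2).submatrix (g (e i)) (g (e i))
          map_add' := fun x y => by ext a b; simp
          map_smul' := fun c x => by ext a b; simp }
      refine cp_comp (T' := σ) (hψ (e i).1).1 (cp_hom ?_ ?_)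
      · intro x y
        exact (Matrix.submatrix_mul_equiv _ _ _ _ _).symm
      · intro x; rfl
    · choose z hz using fun j => (hψ j).2
      refine ⟨fun i => (z (e i).1 (e i).2).submatrix (g (e i)) (g (e i)), ?_⟩
      ext1 i
      have := congrArg (fun M => M.submatrix (g (e i)) (g (e i))) (congrFun (hz (e i).1) (e i).2)
      refine Eq.trans (Eq.trans ?_ this) ?_
      · ext a b
        simp only [Pi.sub_apply, Pi.one_apply, Matrix.sub_apply, Matrix.submatrix_apply]
        congr 1
        rw [Matrix.one_apply, Matrix.one_apply]
        simp
      · exact (Matrix.submatrix_mul_equiv _ _ _ _ _).symm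
  refine ⟨N, r, J, ψ', ∑ j, φ j ∘ₗ ρ j, hψ'.1,
    cp_sum _ _ fun j _ => cp_comp (cp_hom (hρmul j) (hρstar j)) (hφ j).1, cpc_norm hψ', ?_, ?_⟩
  · intro c
    rcases key c with ⟨j, hj⟩ | h0
    · constructor
      · intro x hx
        rw [hj x hx]
        exact (cpc_norm (hφ j) _).trans (cpc_norm (cpc_hom (hρmul j) (hρstar j)) x)
      · intro x hx y hy hxy hyx
        rw [hj x hx, hj y hy]
        constructor
        · exact hoz j _ _ (by rw [← hρmul, hxy, map_zero]) (by rw [← hρmul, hyx, map_zero])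
        · exact hoz j _ _ (by rw [← hρmul, hyx, map_zero]) (by rw [← hρmul, hxy, map_zero])
    · constructor
      · intro x hx
        rw [h0 x hx]; simp
      · intro x hx y hy hxy hyx
        rw [h0 x hx]; simp
  · intro a ha
    have h2 := hap a ha
    rw [LinearMap.sum_apply]
    simp only [LinearMap.comp_apply, hρψ]
    exact h2


section oz
variable {D G : Type*} [CStarAlgebra D] [CStarAlgebra G]

theorem mul_eq_zero_of_pos {z y c : D} (h : IsPosElem (c - y * star y)) (h0 : z * c * star z = 0) :
    z * y = 0 := by
  have h1 := posElem_conj' h z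
  have h2 : z * (c - y * star y) * star z = 0 - (z * y) * star (z * y) := by
    rw [mul_sub, sub_mul, h0, star_mul]; simp only [mul_assoc]
  rw [h2] at h1
  have h3 := norm_le_of_pos (a := (z * y) * star (z * y)) ⟨star (z * y), by simp⟩ h1
  rw [norm_zero] at h3
  have h4 := norm_le_zero_iff.1 h3
  exact (CStarRing.mul_star_self_eq_zero_iff _).1 h4

theorem oz_proj_aux {φ : G →ₗ[ℂ] D} (hφ : CPC φ) (hoz : OZ φ) {p : G} (hp : p * p = p)
    (hps : star p = p) (x : G) : φ (1 - p) * φ (p * x) = 0 := by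
  have h1 : φ (1 - p) * φ p = 0 := hoz _ _ (by simp [sub_mul, hp]) (by simp [mul_sub, hp])
  have h2 := cpc_schwarz hφ (p * x)
  have h3 : IsPosElem (((‖x‖ ^ 2 : ℝ) : ℂ) • (1 : G) - x * star x) :=
    posElem_norm_sub (by simp) (by rw [CStarRing.norm_self_mul_star, sq])
  have h4 := cp_pos hφ.1 (posElem_conj' h3 p)
  have h5 : p * (((‖x‖ ^ 2 : ℝ) : ℂ) • (1 : G) - x * star x) * star p =
      ((‖x‖ ^ 2 : ℝ) : ℂ) • p - (p * x) * star (p * x) := by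
    rw [mul_sub, sub_mul, star_mul, mul_smul_comm, smul_mul_assoc, mul_one, hps, hp]
    simp only [mul_assoc]
  rw [h5, map_sub, map_smul] at h4
  have h6 := posElem_add h4 h2
  rw [sub_add_sub_cancel] at h6
  refine mul_eq_zero_of_pos h6 ?_
  rw [mul_smul_comm, h1]; simp

theorem oz_proj {φ : G →ₗ[ℂ] D} (hφ : CPC φ) (hoz : OZ φ) {p : G} (hp : p * p = p)
    (hps : star p = p) (x : G) : φ p * φ x = φ 1 * φ (p * x) := by
  have h1 := oz_proj_aux hφ hoz hp hps x
  have h2 := oz_proj_aux hφ hoz (p := 1 - p) (by simp [mul_sub, sub_mul, hp]) (by simp [hps]) x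
  rw [sub_sub_cancel, sub_mul, one_mul, map_sub, mul_sub, sub_eq_zero] at h2
  rw [map_sub, sub_mul, sub_eq_zero] at h1
  rw [h2, h1]

theorem fd_span (F : FDx) (M : Submodule ℂ F.alg)
    (hM : ∀ p : F.alg, p * p = p → star p = p → p ∈ M) (x : F.alg) : x ∈ M := by
  have hE : ∀ i a b, (Pi.single i (Matrix.single a b (1 : ℂ)) : F.alg) ∈ M := by
    intro i a b
    by_cases hab : a = b
    · subst hab
      apply hM
      · rw [← Pi.single_mul]; simp
      · rw [← Pi.single_star]; simp [Matrix.star_eq_conjTranspose]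
    · have key : ∀ z : ℂ, z * star z = 1 → (Pi.single i ((1 / 2 : ℂ) • (Matrix.single a a 1 +
        Matrix.single b b 1 + z • Matrix.single a b 1 + star z • Matrix.single b a 1)) : F.alg) ∈ M := by
        intro z hz
        have hz' : star z * z = 1 := by rw [mul_comm]; exact hz
        apply hM
        · rw [← Pi.single_mul]
          congr 1
          have hba : b ≠ a := fun h => hab h.symm
          simp only [smul_mul_smul_comm, add_mul, mul_add, smul_add, mul_smul_comm, smul_mul_assoc,
            Matrix.single_mul_single_same, Matrix.single_mul_single_of_ne, hab, hba, ne_eq,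
            not_false_eq_true, mul_one, smul_smul, hz, hz', smul_zero, add_zero, zero_add, one_smul]
          have hz1 : 1 / 2 * (1 / 2 * (star z * z)) = (1 / 4 : ℂ) := by rw [hz']; norm_num
          have hz2 : 1 / 2 * (1 / 2 * (z * star z)) = (1 / 4 : ℂ) := by rw [hz]; norm_num
          match_scalars <;> first | ring1 | linear_combination (1 / 4 : ℂ) * hz
        · rw [← Pi.single_star]
          congr 1
          simp only [star_smul, star_add, Matrix.star_eq_conjTranspose, Matrix.conjTranspose_single,
            star_one, star_star]
          have : star (1 / 2 : ℂ) = 1 / 2 := by simp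
          rw [this]
          module
      have k1 := key 1 (by simp)
      have k2 := key (-1) (by simp)
      have k3 := key Complex.I (by simp)
      have k4 := key (-Complex.I) (by simp)
      have := M.smul_mem (1 / 2 : ℂ) (M.sub_mem (M.sub_mem k1 k2) (M.smul_mem Complex.I (M.sub_mem k3 k4)))
      convert this using 1
      rw [← Pi.single_sub, ← Pi.single_sub, ← Pi.single_smul, ← Pi.single_sub, ← Pi.single_smul]
      congr 1
      ext c d
      simp only [Matrix.smul_apply, Matrix.add_apply, Matrix.sub_apply, smul_eq_mul, star_neg, star_one,
        Complex.star_def, Complex.conj_I]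
      linear_combination (Matrix.single a b (1:ℂ) c d - Matrix.single b a 1 c d) / 2 * Complex.I_sq
  have hx : x = ∑ i, ∑ a, ∑ b, x i a b • (Pi.single i (Matrix.single a b (1 : ℂ)) : F.alg) := by
    conv_lhs => rw [← Finset.univ_sum_single x]
    refine Finset.sum_congr rfl fun i _ => ?_
    conv_lhs => rw [Matrix.matrix_eq_sum_single (x i)]
    have h1 : ∀ N : Matrix (F.n i) (F.n i) ℂ, (Pi.single i N : F.alg) =
        LinearMap.single ℂ (fun i => Matrix (F.n i) (F.n i) ℂ) i N := fun N => rfl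
    simp only [h1, map_sum, ← map_smul, Matrix.smul_single, smul_eq_mul, mul_one]
  rw [hx]
  exact M.sum_mem fun i _ => M.sum_mem fun a _ => M.sum_mem fun b _ => M.smul_mem _ (hE i a b)

theorem oz_mul {F : FDx} {φ : F.alg →ₗ[ℂ] D} (hφ : CPC φ) (hoz : OZ φ) (y x : F.alg) :
    φ y * φ x = φ 1 * φ (y * x) := by
  let M : Submodule ℂ F.alg :=
    { carrier := {y | ∀ x, φ y * φ x = φ 1 * φ (y * x)}
      add_mem' := fun {a b} ha hb x => by rw [map_add, add_mul, ha, hb, add_mul, map_add, mul_add]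
      zero_mem' := fun x => by simp
      smul_mem' := fun c a ha x => by
        rw [map_smul, smul_mul_assoc, ha, smul_mul_assoc, map_smul, mul_smul_comm] }
  exact fd_span F M (fun p hp hps x => oz_proj hφ hoz hp hps x) y x

theorem oz_comm {F : FDx} {φ : F.alg →ₗ[ℂ] D} (hφ : CPC φ) (hoz : OZ φ) (x : F.alg) :
    φ 1 * φ x = φ x * φ 1 := by
  rw [oz_mul hφ hoz x 1, mul_one]

end oz


section polar
variable {B : Type*} [CStarAlgebra B] [PartialOrder B] [StarOrderedRing B]

theorem resolvent_exists (s : B) (hs : 0 ≤ s) {e : ℝ} (he : 0 < e) :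
    ∃ R : B, s * R + e • R = 1 ∧ star R = R ∧ s * R = R * s ∧ ‖s * R‖ ≤ 1 := by
  have hsp : ∀ t ∈ spectrum ℝ s, 0 ≤ t := fun t ht => spectrum_nonneg_of_nonneg hs ht
  have hc : ContinuousOn (fun t : ℝ => (t + e)⁻¹) (spectrum ℝ s) :=
    ContinuousOn.inv₀ (by fun_prop) fun t ht => by have := hsp t ht; positivity
  have hsa : IsSelfAdjoint s := IsSelfAdjoint.of_nonneg hs
  have e1 : s * cfc (fun t : ℝ => (t + e)⁻¹) s = cfc (fun t : ℝ => t * (t + e)⁻¹) s := by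
    rw [cfc_mul (fun t => t) _ s (by fun_prop) hc, cfc_id' ℝ s]
  refine ⟨cfc (fun t : ℝ => (t + e)⁻¹) s, ?_, ?_, ?_, ?_⟩
  · rw [e1, ← cfc_smul e _ s hc, ← cfc_add _ _ _ (by fun_prop) (by fun_prop)]
    rw [← cfc_const_one ℝ s]
    refine cfc_congr fun t ht => ?_
    have := hsp t ht
    simp only [smul_eq_mul]
    field_simp
  · exact (cfc_predicate (p := IsSelfAdjoint) _ s)
  · exact (cfc_commute_cfc id (fun t : ℝ => (t + e)⁻¹) s |> fun h => by simpa [cfc_id ℝ s] using h.eq)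
  · rw [e1]
    refine norm_cfc_le zero_le_one fun t ht => ?_
    have := hsp t ht
    rw [Real.norm_eq_abs, abs_of_nonneg (by positivity)]
    rw [← div_eq_mul_inv, div_le_one (by positivity)]; linarith

theorem norm_mul_eq_of_star {y s : B} (h : star y * y = star s * s) (X : B) : ‖y * X‖ = ‖s * X‖ := by
  have : ‖y * X‖ * ‖y * X‖ = ‖s * X‖ * ‖s * X‖ := by
    rw [← CStarRing.norm_star_mul_self, ← CStarRing.norm_star_mul_self, star_mul, star_mul]
    congr 1
    calc star X * star y * (y * X) = star X * (star y * y) * X := by simp only [mul_assoc]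
      _ = _ := by rw [h]; simp only [mul_assoc]
  nlinarith [norm_nonneg (y * X), norm_nonneg (s * X), mul_self_nonneg (‖y * X‖ - ‖s * X‖)]

theorem polar_lemma {y0 b : B} {η : ℝ} (hb : 0 ≤ b) (hb1 : ‖b‖ ≤ 1) (hη : 0 ≤ η) (hη1 : η < 1)
    (h1 : (1 - η) • (b * b) ≤ star y0 * y0) (h2 : star y0 * y0 ≤ b * b) :
    ∃ (y : B) (z : ℕ → B), Tendsto (fun n => y0 * z n) atTop (𝓝 y) ∧ star y * y = b * b ∧
      ‖y - y0‖ ≤ η := by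
  set s := CFC.sqrt (star y0 * y0) with hs_def
  have hs : 0 ≤ s := CFC.sqrt_nonneg _
  have hss : s * s = star y0 * y0 := CFC.sqrt_mul_sqrt_self _ (star_mul_self_nonneg y0)
  have hsa : star s = s := IsSelfAdjoint.of_nonneg hs
  have hba : star b = b := IsSelfAdjoint.of_nonneg hb
  have hsy : star y0 * y0 = star s * s := by rw [hsa, hss]
  have hsb : s ≤ b := by
    have := CFC.sqrt_le_sqrt _ _ h2
    rwa [CFC.sqrt_mul_self b hb] at this
  have hbs : ‖b - s‖ ≤ η := by
    have h3 : CFC.sqrt ((1 - η) • (b * b)) ≤ s := CFC.sqrt_le_sqrt _ _ h1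
    have h4 : CFC.sqrt ((1 - η) • (b * b)) = Real.sqrt (1 - η) • b := by
      have : (1 - η) • (b * b) = (Real.sqrt (1 - η) • b) * (Real.sqrt (1 - η) • b) := by
        rw [smul_mul_smul_comm, Real.mul_self_sqrt (by linarith)]
      rw [this, CFC.sqrt_mul_self _ (smul_nonneg (Real.sqrt_nonneg _) hb)]
    rw [h4] at h3
    have h5 : b - s ≤ η • b := by
      have h6 : (1 - η) • b ≤ Real.sqrt (1 - η) • b :=
        smul_le_smul_of_nonneg_right (by
          apply Real.le_sqrt_of_sq_le; nlinarith) hb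
      have : b - s ≤ b - (1 - η) • b := sub_le_sub_left (h6.trans h3) b
      rwa [sub_smul, one_smul, sub_sub_cancel] at this
    calc ‖b - s‖ ≤ ‖η • b‖ := CStarAlgebra.norm_le_norm_of_nonneg_of_le (sub_nonneg.2 hsb) h5
      _ ≤ η := by rw [norm_smul, Real.norm_eq_abs, abs_of_nonneg hη]; nlinarith
  let e : ℕ → ℝ := fun n => 1 / ((n : ℝ) + 1)
  have he : ∀ n, 0 < e n := fun n => by positivity
  choose R hR1 hR2 hR3 hR4 using fun n => resolvent_exists s hs (he n)
  let W : ℕ → B := fun n => s * (R n * b)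
  have hbW : ∀ n, b - W n = e n • (R n * b) := fun n => by
    have : b = (s * R n + e n • R n) * b := by rw [hR1, one_mul]
    conv_lhs => rw [this]
    simp only [W]
    rw [add_mul, smul_mul_assoc, mul_assoc, add_sub_cancel_left]
  set C := (1 - η)⁻¹ with hC
  have hC0 : 0 < C := inv_pos.2 (by linarith)
  have hnorm : ∀ n, ‖b - W n‖ ^ 2 ≤ C * (e n) ^ 2 := fun n => by
    have k1 : b * b ≤ C • (s * s) := by
      rw [hss]
      have := smul_le_smul_of_nonneg_left h1 hC0.le
      rwa [smul_smul, hC, inv_mul_cancel₀ (by linarith), one_smul] at this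
    have k2 : ‖R n * b‖ ^ 2 ≤ C := by
      have k3 : R n * (b * b) * R n ≤ C • (R n * (s * s) * R n) := by
        have := star_left_conjugate_le_conjugate k1 (R n)
        rwa [hR2, mul_smul_comm, smul_mul_assoc] at this
      have k4 : R n * (b * b) * R n = (R n * b) * star (R n * b) := by
        rw [star_mul, hR2, hba]; simp only [mul_assoc]
      have k5 : R n * (s * s) * R n = star (s * R n) * (s * R n) := by
        rw [star_mul, hR2, hsa]; simp only [mul_assoc]
      rw [k4] at k3
      have k6 := CStarAlgebra.norm_le_norm_of_nonneg_of_le (mul_star_self_nonneg _) k3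
      rw [CStarRing.norm_self_mul_star, norm_smul, k5, CStarRing.norm_star_mul_self,
        Real.norm_eq_abs, abs_of_pos hC0] at k6
      have : ‖s * R n‖ * ‖s * R n‖ ≤ 1 := by nlinarith [hR4 n, norm_nonneg (s * R n)]
      nlinarith
    rw [hbW, norm_smul, Real.norm_eq_abs, abs_of_pos (he n), mul_pow]
    nlinarith [sq_nonneg (e n)]
  have hWlim : Tendsto W atTop (𝓝 b) := by
    rw [tendsto_iff_norm_sub_tendsto_zero]
    have he0 : Tendsto e atTop (𝓝 0) := tendsto_one_div_add_atTop_nhds_zero_nat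
    have : Tendsto (fun n => Real.sqrt C * e n) atTop (𝓝 0) := by simpa using he0.const_mul (Real.sqrt C)
    refine squeeze_zero (fun n => norm_nonneg _) (fun n => ?_) this
    rw [norm_sub_rev]
    refine abs_le_of_sq_le_sq' ?_ (by have := he n; positivity) |>.2
    rw [mul_pow, Real.sq_sqrt hC0.le]; exact hnorm n
  let Y : ℕ → B := fun n => y0 * (R n * b)
  have hYW : ∀ n m, ‖Y n - Y m‖ = ‖W n - W m‖ := fun n m => by
    simp only [Y, W]
    rw [← mul_sub, ← mul_sub]
    exact norm_mul_eq_of_star hsy _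
  have hcau : CauchySeq Y := by
    have hW := hWlim.cauchySeq
    rw [Metric.cauchySeq_iff] at hW ⊢
    intro ε hε
    obtain ⟨N, hN⟩ := hW ε hε
    refine ⟨N, fun m hm n hn => ?_⟩
    rw [dist_eq_norm, hYW, ← dist_eq_norm]; exact hN m hm n hn
  obtain ⟨y, hy⟩ := cauchySeq_tendsto_of_complete hcau
  refine ⟨y, fun n => R n * b, hy, ?_, ?_⟩
  · have l1 : Tendsto (fun n => star (Y n) * Y n) atTop (𝓝 (star y * y)) := (hy.star).mul hy
    have l2 : Tendsto (fun n => star (W n) * W n) atTop (𝓝 (star b * b)) := (hWlim.star).mul hWlim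
    have : (fun n => star (Y n) * Y n) = fun n => star (W n) * W n := by
      funext n
      simp only [Y, W, star_mul y0, star_mul s]
      calc star (R n * b) * star y0 * (y0 * (R n * b)) =
          star (R n * b) * (star y0 * y0) * (R n * b) := by simp only [mul_assoc]
        _ = _ := by rw [hsy]; simp only [mul_assoc]
    rw [this] at l1
    rw [tendsto_nhds_unique l1 l2, hba]
  · have l1 : Tendsto (fun n => ‖Y n - y0‖) atTop (𝓝 ‖y - y0‖) := (hy.sub_const y0).norm
    have l2 : Tendsto (fun n => ‖W n - s‖) atTop (𝓝 ‖b - s‖) := (hWlim.sub_const s).norm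
    have : (fun n => ‖Y n - y0‖) = fun n => ‖W n - s‖ := by
      funext n
      have a1 : Y n - y0 = y0 * (R n * b - 1) := by simp only [Y]; rw [mul_sub, mul_one]
      have a2 : W n - s = s * (R n * b - 1) := by simp only [W]; rw [mul_sub, mul_one]
      rw [a1, a2]; exact norm_mul_eq_of_star hsy _
    rw [this] at l1
    rw [tendsto_nhds_unique l1 l2]; exact hbs

end polar


theorem diag_conj_pos {n : Type*} [Fintype n] [DecidableEq n] (U : Matrix n n ℂ) (f : n → ℝ)
    (hf : ∀ a, 0 ≤ f a) : IsPosElem (U * Matrix.diagonal (fun a => (f a : ℂ)) * star U) := by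
  refine posElem_conj' ?_ U
  refine ⟨Matrix.diagonal (fun a => (Real.sqrt (f a) : ℂ)), ?_⟩
  rw [Matrix.star_eq_conjTranspose, Matrix.diagonal_conjTranspose, Matrix.diagonal_mul_diagonal]
  congr 1
  funext a
  simp [← Complex.ofReal_mul, Real.mul_self_sqrt (hf a)]

theorem block_cut {n : Type} [Fintype n] [DecidableEq n] (h : Matrix n n ℂ) (hh : IsPosElem h)
    {δ : ℝ} (hδ : 0 < δ) : ∃ (s : Finset n) (V : Matrix n s ℂ), V.conjTranspose * V = 1 ∧
      IsPosElem (h - (δ : ℂ) • (V * V.conjTranspose)) ∧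
      IsPosElem ((δ : ℂ) • 1 - (1 - V * V.conjTranspose) * h * (1 - V * V.conjTranspose)) := by
  classical
  have hps : h.PosSemidef := by
    obtain ⟨y, rfl⟩ := hh
    exact Matrix.posSemidef_conjTranspose_mul_self y
  set U : Matrix n n ℂ := (hps.1.eigenvectorUnitary : Matrix n n ℂ) with hU
  set l := hps.1.eigenvalues with hl
  have hl0 : ∀ a, 0 ≤ l a := fun a => hps.eigenvalues_nonneg a
  have hUU : star U * U = 1 := Unitary.coe_star_mul_self _
  have hUU' : U * star U = 1 := Unitary.coe_mul_star_self _
  have hspec : h = U * Matrix.diagonal (fun a => (l a : ℂ)) * star U := by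
    have := hps.1.conjStarAlgAut_star_eigenvectorUnitary
    rw [Unitary.conjStarAlgAut_star_apply] at this
    have e : Matrix.diagonal (fun a => (l a : ℂ)) = star U * h * U := this.symm
    rw [e]
    calc h = (U * star U) * h * (U * star U) := by rw [hUU']; simp
      _ = _ := by simp only [mul_assoc]
  let s : Finset n := Finset.univ.filter fun a => δ ≤ l a
  let V : Matrix n s ℂ := U.submatrix id Subtype.val
  have hp : V * V.conjTranspose = U * Matrix.diagonal (fun a => ((if δ ≤ l a then 1 else 0 : ℝ) : ℂ)) * star U := by
    ext i j
    rw [Matrix.mul_apply, Matrix.mul_apply]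
    simp only [V, Matrix.submatrix_apply, Matrix.conjTranspose_apply, id, Matrix.mul_diagonal,
      Matrix.star_apply]
    rw [Finset.sum_coe_sort s (fun a => U i a * star (U j a))]
    rw [Finset.sum_filter]
    refine Finset.sum_congr rfl fun a _ => ?_
    split_ifs <;> simp
  have h1 : (1 : Matrix n n ℂ) = U * Matrix.diagonal (fun a => ((1 : ℝ) : ℂ)) * star U := by
    simp [hUU']
  have hmul : ∀ f g : n → ℝ, (U * Matrix.diagonal (fun a => (f a : ℂ)) * star U) *
      (U * Matrix.diagonal (fun a => (g a : ℂ)) * star U) =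
      U * Matrix.diagonal (fun a => ((f a * g a : ℝ) : ℂ)) * star U := fun f g => by
    calc _ = U * Matrix.diagonal (fun a => (f a : ℂ)) * (star U * U) *
        Matrix.diagonal (fun a => (g a : ℂ)) * star U := by simp only [mul_assoc]
      _ = _ := by
        rw [hUU, mul_one, mul_assoc U, Matrix.diagonal_mul_diagonal]; simp
  have hsub : ∀ f g : n → ℝ, (U * Matrix.diagonal (fun a => (f a : ℂ)) * star U) -
      (U * Matrix.diagonal (fun a => (g a : ℂ)) * star U) =
      U * Matrix.diagonal (fun a => ((f a - g a : ℝ) : ℂ)) * star U := fun f g => by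
    rw [← sub_mul, ← mul_sub, Matrix.diagonal_sub]; simp
  have hsm : ∀ f : n → ℝ, (δ : ℂ) • (U * Matrix.diagonal (fun a => (f a : ℂ)) * star U) =
      U * Matrix.diagonal (fun a => ((δ * f a : ℝ) : ℂ)) * star U := fun f => by
    rw [← smul_mul_assoc, ← mul_smul_comm, ← Matrix.diagonal_smul]
    congr 3; funext a; simp
  refine ⟨s, V, ?_, ?_, ?_⟩
  · ext a b
    have := congrFun (congrFun hUU a.1) b.1
    rw [Matrix.mul_apply] at this
    rw [Matrix.mul_apply]
    simp only [V, Matrix.submatrix_apply, Matrix.conjTranspose_apply, id]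
    simp only [Matrix.star_apply] at this
    rw [this, Matrix.one_apply, Matrix.one_apply]
    by_cases hab : a = b
    · rw [if_pos hab, if_pos (congrArg _ hab)]
    · rw [if_neg hab, if_neg (fun h => hab (Subtype.ext h))]
  · rw [hp, hspec, hsm, hsub]
    refine diag_conj_pos _ _ fun a => ?_
    split_ifs with hc
    · linarith
    · simpa using hl0 a
  · rw [hp, h1, hspec, hsm, hsub, hmul, hmul, hsub]
    refine diag_conj_pos _ _ fun a => ?_
    split_ifs with hc
    · simpa using hδ.le
    · simp only [sub_zero, one_mul, mul_one]; linarith [not_le.1 hc]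

theorem fd_cut (F : FDx) (h : F.alg) (hh : IsPosElem h) {δ : ℝ} (hδ : 0 < δ) :
    ∃ (F' : FDx) (κ : F'.alg →ₗ[ℂ] F.alg) (ρ : F.alg →ₗ[ℂ] F'.alg),
      (∀ x y, κ (x * y) = κ x * κ y) ∧ (∀ x, κ (star x) = star (κ x)) ∧ CPC ρ ∧
      (∀ x, κ (ρ x) = κ 1 * x * κ 1) ∧ IsPosElem (h - (δ : ℂ) • κ 1) ∧
      IsPosElem ((δ : ℂ) • 1 - (1 - κ 1) * h * (1 - κ 1)) := by
  obtain ⟨y, hy⟩ := hh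
  choose s V hV1 hV2 hV3 using fun i => block_cut (h i) ⟨y i, congrFun hy i⟩ hδ
  let F' : FDx := ⟨F.ι, fun i => s i⟩
  let κ : F'.alg →ₗ[ℂ] F.alg :=
    { toFun := fun x i => V i * x i * (V i).conjTranspose
      map_add' := fun x y => by ext1 i; simp [Matrix.mul_add, Matrix.add_mul]
      map_smul' := fun c x => by ext1 i; simp }
  let ρ : F.alg →ₗ[ℂ] F'.alg :=
    { toFun := fun x i => (V i).conjTranspose * x i * V i
      map_add' := fun x y => by ext1 i; simp [Matrix.mul_add, Matrix.add_mul]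
      map_smul' := fun c x => by ext1 i; simp }
  have hκ1 : ∀ i, κ 1 i = V i * (V i).conjTranspose := fun i => by simp [κ]
  have hm : ∀ x y, κ (x * y) = κ x * κ y := by
    intro x y
    ext1 i
    change V i * (x i * y i) * (V i).conjTranspose = (V i * x i * (V i).conjTranspose) * (V i * y i * (V i).conjTranspose)
    have : (V i * x i * (V i).conjTranspose) * (V i * y i * (V i).conjTranspose) =
      V i * x i * ((V i).conjTranspose * V i) * y i * (V i).conjTranspose := by simp only [Matrix.mul_assoc]
    rw [this, hV1]; simp only [Matrix.mul_one, Matrix.mul_assoc]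
  have hst : ∀ x, κ (star x) = star (κ x) := by
    intro x
    ext1 i
    change V i * (x i).conjTranspose * (V i).conjTranspose = (V i * x i * (V i).conjTranspose).conjTranspose
    simp [Matrix.mul_assoc]
  have hκρ : ∀ x, κ (ρ x) = κ 1 * x * κ 1 := by
    intro x
    ext1 i
    rw [Pi.mul_apply, Pi.mul_apply, hκ1]
    change V i * ((V i).conjTranspose * x i * V i) * (V i).conjTranspose = _
    simp only [Matrix.mul_assoc]
  refine ⟨F', κ, ρ, hm, hst, ?_, hκρ, ?_, ?_⟩
  · constructor
    · let j : F'.alg →⋆ₙₐ[ℂ] F.alg :=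
        { κ with
          map_mul' := hm
          map_zero' := map_zero κ
          map_star' := hst }
      have hj : Function.Injective j := by
        intro x y hxy
        ext1 i
        have h1 : V i * x i * (V i).conjTranspose = V i * y i * (V i).conjTranspose := congrFun hxy i
        have h2 := congrArg (fun M => (V i).conjTranspose * M * V i) h1
        have h3 : ∀ M : Matrix (s i) (s i) ℂ, (V i).conjTranspose * (V i * M * (V i).conjTranspose) * V i = M := by
          intro M
          calc _ = ((V i).conjTranspose * V i) * M * ((V i).conjTranspose * V i) := by
                simp only [Matrix.mul_assoc]
            _ = M := by rw [hV1]; simp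
        simp only [h3] at h2
        exact h2
      have hid : IsCompletelyPositive (LinearMap.id : F.alg →ₗ[ℂ] F.alg) :=
        cp_hom (fun _ _ => rfl) (fun _ => rfl)
      have hps : star (κ 1) = κ 1 := by rw [← hst, star_one]
      refine cp_reflect (T' := LinearMap.mulLeftRight ℂ (κ 1, κ 1)) j hj ?_ (cp_conj hid (κ 1) ?_)
      · intro x; rw [LinearMap.mulLeftRight_apply]; exact hκρ x
      · intro x; rw [LinearMap.mulLeftRight_apply, hps]; rfl
    · refine ⟨0, ?_⟩
      have : ρ 1 = 1 := by
        ext1 i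
        change (V i).conjTranspose * (1 : Matrix (F.n i) (F.n i) ℂ) * V i = (1 : Matrix (s i) (s i) ℂ)
        rw [Matrix.mul_one, hV1]
      simp [this]
  · choose z hz using hV2
    refine ⟨z, ?_⟩
    ext1 i
    rw [Pi.sub_apply, Pi.smul_apply, hκ1]; exact hz i
  · choose z hz using hV3
    refine ⟨z, ?_⟩
    ext1 i
    rw [Pi.sub_apply, Pi.smul_apply, Pi.mul_apply, Pi.mul_apply, Pi.sub_apply, hκ1]; exact hz i


section ozcut
variable {B : Type*} [CStarAlgebra B] [PartialOrder B] [StarOrderedRing B]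

theorem cfc_data {k : B} (hk : 0 ≤ k) {τ : ℝ} (hτ : 0 < τ) :
    ∃ k' h1 : B, 0 ≤ k' ∧ ‖k'‖ ≤ 1 ∧ k * h1 * k' = k' ∧ ‖h1‖ ≤ 1 / τ ∧ ‖k * h1‖ ≤ 1 ∧
      star (k * h1) = k * h1 ∧ ‖(1 - k') * k * (1 - k')‖ ≤ τ ∧ ∀ x, Commute k x → Commute k' x := by
  have hsp : ∀ t ∈ spectrum ℝ k, 0 ≤ t := fun t ht => spectrum_nonneg_of_nonneg hk ht
  have hsa : IsSelfAdjoint k := IsSelfAdjoint.of_nonneg hk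
  have hm : ∀ t : ℝ, max t τ ≠ 0 := fun t => (lt_of_lt_of_le hτ (le_max_right _ _)).ne'
  have hm' : ∀ t : ℝ, 0 < max t τ := fun t => (lt_of_lt_of_le hτ (le_max_right _ _))
  let f : ℝ → ℝ := fun t => max (t - τ) 0 / max t τ
  let h : ℝ → ℝ := fun t => 1 / max t τ
  have hfc : Continuous f := Continuous.div (by fun_prop) (by fun_prop) hm
  have hhc : Continuous h := Continuous.div (by fun_prop) (by fun_prop) hm
  have hf0 : ∀ t, 0 ≤ f t := fun t => div_nonneg (le_max_right _ _) (hm' t).le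
  have hf1 : ∀ t, f t ≤ 1 := fun t => (div_le_one (hm' t)).2 (by
    apply max_le
    · linarith [le_max_left t τ]
    · exact (hm' t).le)
  have hkh : k * cfc h k = cfc (fun t => t * h t) k := by
    rw [cfc_mul (fun t => t) h k (by fun_prop) hhc.continuousOn, cfc_id' ℝ k]
  refine ⟨cfc f k, cfc h k, cfc_nonneg fun t _ => hf0 t, ?_, ?_, ?_, ?_, ?_, ?_, ?_⟩
  · refine norm_cfc_le zero_le_one fun t _ => ?_
    rw [Real.norm_eq_abs, abs_of_nonneg (hf0 t)]; exact hf1 t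
  · rw [hkh, ← cfc_mul (fun t => t * h t) f k (by fun_prop) (by fun_prop)]
    refine cfc_congr fun t ht => ?_
    simp only [f, h]
    rcases le_total t τ with htt | htt
    · rw [max_eq_right (a := t - τ) (by linarith)]; simp
    · rw [max_eq_left (a := t) htt]
      have : t ≠ 0 := by linarith
      field_simp
  · refine norm_cfc_le (by positivity) fun t _ => ?_
    simp only [h]
    rw [Real.norm_eq_abs, abs_of_nonneg (by have := hm' t; positivity)]
    exact one_div_le_one_div_of_le hτ (le_max_right _ _)
  · rw [hkh]
    refine norm_cfc_le zero_le_one fun t ht => ?_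
    have := hsp t ht
    simp only [h]
    rw [Real.norm_eq_abs, abs_of_nonneg (by have := hm' t; positivity), mul_one_div,
      div_le_one (hm' t)]
    exact le_max_left _ _
  · rw [hkh]; exact (cfc_predicate (p := IsSelfAdjoint) _ k)
  · have e1 : (1 : B) - cfc f k = cfc (fun t => 1 - f t) k := by
      rw [cfc_sub (fun _ => 1) f k (by fun_prop) (by fun_prop), cfc_const_one ℝ k]
    have e2 : (1 - cfc f k) * k * (1 - cfc f k) = cfc (fun t => (1 - f t) * t * (1 - f t)) k := by
      rw [e1, cfc_mul (fun t => (1 - f t) * t) (fun t => 1 - f t) k (by fun_prop) (by fun_prop),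
        cfc_mul (fun t => (1 - f t)) (fun t => t) k (by fun_prop) (by fun_prop), cfc_id' ℝ k]
    rw [e2]
    refine norm_cfc_le hτ.le fun t ht => ?_
    have h0 := hsp t ht
    have h1 := hf1 t
    have h2 := hf0 t
    have h3 : 0 ≤ 1 - f t := by linarith
    rw [Real.norm_eq_abs, abs_of_nonneg (by positivity)]
    rcases le_total t τ with htt | htt
    · calc (1 - f t) * t * (1 - f t) ≤ 1 * t * 1 := by
            apply mul_le_mul (mul_le_mul_of_nonneg_right (by linarith) h0) (by linarith) h3 (by linarith)
        _ ≤ τ := by linarith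
    · have ht0 : 0 < t := lt_of_lt_of_le hτ htt
      have e3 : f t = (t - τ) / t := by
        simp only [f]; rw [max_eq_left (a := t) htt, max_eq_left (by linarith)]
      have e4 : (1 - f t) * t = τ := by rw [e3]; field_simp; ring
      rw [e4]; nlinarith
  · intro x hx
    exact hx.cfc_real f

theorem oz_cut {F : FDx} {φ : F.alg →ₗ[ℂ] B} (hφ : CPC φ) (hoz : OZ φ) {d : B} (hd : 0 ≤ d)
    (hd1 : ‖d‖ ≤ 1) {ε : ℝ} (hε : 0 < ε) (hε1 : ε < 1)
    (hk : ‖(1 - d) * φ 1‖ ≤ (ε / 8) ^ 3 / 2) :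
    ∃ φ' : F.alg →ₗ[ℂ] B, CPC φ' ∧ OZ φ' ∧
      (∀ x, ∃ z : ℕ → B, Tendsto (fun n => d * z n * d) atTop (𝓝 (φ' x))) ∧
      ∀ x, ‖x‖ ≤ 1 → ‖φ' x - φ x‖ ≤ ε := by
  set τ := (ε / 8) ^ 2 with hτ
  have hτ0 : 0 < τ := by positivity
  set η := ε / 8 with hη
  have hη0 : 0 < η := by positivity
  set k := φ 1 with hkdef
  have hk0 : 0 ≤ k := posElem_iff.1 (cp_pos hφ.1 ⟨1, by simp⟩)
  obtain ⟨k', h1, hk'0, hk'1, hkk, hh1, hg1, hgs, hkτ, hcomm⟩ := cfc_data hk0 hτ0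
  set g := k * h1 with hg
  have hk's : star k' = k' := IsSelfAdjoint.of_nonneg hk'0
  have hds : star d = d := IsSelfAdjoint.of_nonneg hd
  have hgk : k' * g = k' := by
    have := congrArg star hkk
    rwa [star_mul, hk's, hgs] at this
  have hdg : ‖(1 - d) * g‖ ≤ η / 2 := by
    rw [hg, ← mul_assoc]
    calc ‖(1 - d) * k * h1‖ ≤ ‖(1 - d) * k‖ * ‖h1‖ := norm_mul_le _ _
      _ ≤ (η ^ 3 / 2) * (1 / τ) := by gcongr
      _ = η / 2 := by rw [hτ]; field_simp
  have hy0k : ‖d * k' - k'‖ ≤ η / 2 := by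
    have : d * k' - k' = - ((1 - d) * g * k') := by rw [mul_assoc, hkk]; noncomm_ring
    rw [this, norm_neg]
    calc _ ≤ ‖(1 - d) * g‖ * ‖k'‖ := norm_mul_le _ _
      _ ≤ η / 2 * 1 := by gcongr
      _ = _ := mul_one _
  have hd1' : d ≤ 1 := (CStarAlgebra.norm_le_one_iff_of_nonneg d hd).1 hd1
  have hdd : d * d ≤ 1 := by
    have h2 : star d * d ≤ 1 := by
      refine (CStarAlgebra.norm_le_one_iff_of_nonneg _ (star_mul_self_nonneg d)).1 ?_
      rw [CStarRing.norm_star_mul_self]; nlinarith [norm_nonneg d]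
    rwa [hds] at h2
  have e0 : star (d * k') * (d * k') = k' * (d * d) * k' := by
    rw [star_mul, hds, hk's]; simp only [mul_assoc]
  have hpol2 : star (d * k') * (d * k') ≤ k' * k' := by
    rw [e0]
    have := star_left_conjugate_le_conjugate hdd k'
    rwa [hk's, mul_one] at this
  have hpol1 : (1 - η) • (k' * k') ≤ star (d * k') * (d * k') := by
    rw [e0]
    set M := g * (1 - d * d) * g with hM
    have hMs : IsSelfAdjoint M := by
      have q1 : star (1 - d * d) = 1 - d * d := by rw [star_sub, star_mul, hds, star_one]
      have q2 : star (g * (1 - d * d) * g) = star g * (star (1 - d * d) * star g) := by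
        clear_value g
        simp only [star_mul]
      rw [IsSelfAdjoint, hM, q2, hgs, q1]
      exact (mul_assoc _ _ _).symm
    have hMn : ‖M‖ ≤ η := by
      have : M = g * ((1 + d) * ((1 - d) * g)) := by rw [hM]; noncomm_ring
      rw [this]
      have h3 : ‖1 + d‖ ≤ 2 := (norm_add_le _ _).trans (by linarith [norm_one_le_one (D := B)])
      calc _ ≤ ‖g‖ * ‖(1 + d) * ((1 - d) * g)‖ := norm_mul_le _ _
        _ ≤ 1 * (‖1 + d‖ * ‖(1 - d) * g‖) := by gcongr; exact norm_mul_le _ _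
        _ ≤ 1 * (2 * (η / 2)) := by gcongr
        _ = η := by ring
    have hMle : M ≤ η • 1 := by
      refine (IsSelfAdjoint.le_algebraMap_norm_self (a := M) hMs).trans ?_
      rw [Algebra.algebraMap_eq_smul_one]
      exact smul_le_smul_of_nonneg_right hMn zero_le_one
    have h5 := star_left_conjugate_le_conjugate hMle k'
    have h6 : star k' * M * k' = k' * k' - k' * (d * d) * k' := by
      have : star k' * M * k' = (k' * g) * (1 - d * d) * (g * k') := by
        rw [hM, hk's]; simp only [mul_assoc]
      rw [this, hgk, hkk]; noncomm_ring
    have h7 : star k' * (η • 1) * k' = η • (k' * k') := by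
      rw [mul_smul_comm, smul_mul_assoc, mul_one, hk's]
    rw [h6, h7, sub_le_comm] at h5
    rwa [sub_smul, one_smul]
  obtain ⟨y, z, hyz, hyy, hyn⟩ := polar_lemma hk'0 hk'1 hη0.le (by linarith) hpol1 hpol2
  have hyk : ‖y - k'‖ ≤ 3 / 2 * η := by
    have : y - k' = (y - d * k') + (d * k' - k') := by abel
    rw [this]
    exact (norm_add_le _ _).trans (by linarith)
  have hy1 : ‖y‖ ≤ 1 := by
    have : ‖y‖ * ‖y‖ ≤ 1 := by
      rw [← CStarRing.norm_star_mul_self, hyy]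
      exact (norm_mul_le _ _).trans (by nlinarith [norm_nonneg k'])
    nlinarith [norm_nonneg y]
  let φ' : F.alg →ₗ[ℂ] B := LinearMap.mulLeftRight ℂ (y, star y) ∘ₗ φ
  have hφ' : ∀ x, φ' x = y * φ x * star y := fun x => by
    simp only [φ', LinearMap.comp_apply, LinearMap.mulLeftRight_apply]
  refine ⟨φ', ?_, ?_, ?_, ?_⟩
  · refine cpc_of_norm (cp_conj hφ.1 y hφ') ?_
    rw [hφ']
    have h2 : ‖φ 1‖ ≤ 1 := (cpc_norm hφ 1).trans norm_one_le_one
    calc ‖y * φ 1 * star y‖ ≤ ‖y‖ * ‖φ 1‖ * ‖star y‖ :=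
          (norm_mul_le _ _).trans (by gcongr; exact norm_mul_le _ _)
      _ ≤ 1 * 1 * 1 := by rw [norm_star]; gcongr
      _ = 1 := by ring
  · intro e f hef hfe
    have hc : k' * φ e = φ e * k' := (hcomm _ (oz_comm hφ hoz e)).eq
    rw [hφ', hφ']
    have hc2 : φ e * (k' * k') = k' * k' * φ e := by
      rw [← mul_assoc, ← hc, mul_assoc, ← hc, ← mul_assoc]
    calc y * φ e * star y * (y * φ f * star y) = y * (φ e * (star y * y)) * φ f * star y := by
          simp only [mul_assoc]
      _ = y * (k' * k') * (φ e * φ f) * star y := by rw [hyy, hc2]; simp only [mul_assoc]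
      _ = 0 := by rw [hoz e f hef hfe]; simp
  · intro x
    refine ⟨fun n => k' * z n * φ x * star (k' * z n), ?_⟩
    rw [hφ']
    have := (hyz.mul_const (φ x)).mul hyz.star
    refine this.congr fun n => ?_
    simp only [star_mul, hds, mul_assoc]
  · intro x hx
    have hφx : ‖φ x‖ ≤ 1 := (cpc_norm hφ x).trans hx
    have hc : k' * φ x = φ x * k' := (hcomm _ (oz_comm hφ hoz x)).eq
    have hle : φ x * star (φ x) ≤ k := by
      have a1 := cpc_schwarz hφ x
      have a2 : IsPosElem ((1 : F.alg) - x * star x) := posElem_one_sub ⟨star x, by simp⟩ (by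
        rw [CStarRing.norm_self_mul_star]; nlinarith [norm_nonneg x])
      have a3 := posElem_add (cp_pos hφ.1 a2) a1
      rw [map_sub, sub_add_sub_cancel, posElem_iff] at a3
      exact sub_nonneg.1 a3
    have hsm : ‖(1 - k') * φ x‖ ≤ η := by
      have a1 := star_left_conjugate_le_conjugate hle (1 - k')
      have a2 : star (1 - k') = 1 - k' := by rw [star_sub, hk's, star_one]
      have a3 : star (1 - k') * (φ x * star (φ x)) * (1 - k') =
          ((1 - k') * φ x) * star ((1 - k') * φ x) := by
        rw [star_mul, a2]; simp only [mul_assoc]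
      rw [a3, a2] at a1
      have a4 := (CStarAlgebra.norm_le_norm_of_nonneg_of_le (mul_star_self_nonneg _) a1).trans hkτ
      rw [CStarRing.norm_self_mul_star, hτ] at a4
      nlinarith [norm_nonneg ((1 - k') * φ x)]
    have hdec : φ' x - φ x = (y - k') * (φ x * star y) + k' * φ x * star (y - k')
        - k' * ((1 - k') * φ x) - (1 - k') * φ x := by
      rw [hφ', star_sub, hk's]
      have : k' * ((1 - k') * φ x) = k' * φ x - k' * φ x * k' := by
        rw [sub_mul, one_mul, mul_sub, hc]; simp only [mul_assoc]
        rw [← mul_assoc k', hc, mul_assoc]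
      rw [this]
      noncomm_ring
    rw [hdec]
    have b1 : ‖(y - k') * (φ x * star y)‖ ≤ 3 / 2 * η := by
      calc _ ≤ ‖y - k'‖ * (‖φ x‖ * ‖star y‖) :=
            (norm_mul_le _ _).trans (by gcongr; exact norm_mul_le _ _)
        _ ≤ 3 / 2 * η * (1 * 1) := by rw [norm_star]; gcongr
        _ = _ := by ring
    have b2 : ‖k' * φ x * star (y - k')‖ ≤ 3 / 2 * η := by
      calc _ ≤ ‖k'‖ * ‖φ x‖ * ‖star (y - k')‖ :=
            (norm_mul_le _ _).trans (by gcongr; exact norm_mul_le _ _)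
        _ ≤ 1 * 1 * (3 / 2 * η) := by rw [norm_star]; gcongr
        _ = _ := by ring
    have b3 : ‖k' * ((1 - k') * φ x)‖ ≤ η := by
      calc _ ≤ ‖k'‖ * ‖(1 - k') * φ x‖ := norm_mul_le _ _
        _ ≤ 1 * η := by gcongr
        _ = _ := by ring
    have b4 := (norm_sub_le ((y - k') * (φ x * star y) + k' * φ x * star (y - k')
        - k' * ((1 - k') * φ x)) ((1 - k') * φ x))
    have b5 := (norm_sub_le ((y - k') * (φ x * star y) + k' * φ x * star (y - k'))
        (k' * ((1 - k') * φ x)))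
    have b6 := norm_add_le ((y - k') * (φ x * star y)) (k' * φ x * star (y - k'))
    linarith

end ozcut


section cutapprox
variable {B : Type*} [CStarAlgebra B] [PartialOrder B] [StarOrderedRing B]

theorem compress_small {F : FDx} {p h Z : F.alg} {δ : ℝ} (hδ : 0 ≤ δ) (hps : star p = p)
    (hpp : p * p = p)
    (hZ : IsPosElem (h - Z * star Z))
    (hp : IsPosElem (((δ ^ 2 : ℝ) : ℂ) • 1 - (1 - p) * h * (1 - p))) : ‖(1 - p) * Z‖ ≤ δ := by
  have hqs : star (1 - p) = 1 - p := by rw [star_sub, star_one, hps]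
  have h1 := posElem_conj hZ (1 - p)
  have h2 := posElem_add h1 hp
  have e : star (1 - p) * (h - Z * star Z) * (1 - p) +
      (((δ ^ 2 : ℝ) : ℂ) • 1 - (1 - p) * h * (1 - p)) =
      ((δ ^ 2 : ℝ) : ℂ) • 1 - ((1 - p) * Z) * star ((1 - p) * Z) := by
    rw [star_mul, hqs]; noncomm_ring
  rw [e] at h2
  have h3 := norm_le_of_pos ⟨star ((1 - p) * Z), by rw [star_star]⟩ h2
  rw [CStarRing.norm_self_mul_star] at h3
  have h4 : ‖((δ ^ 2 : ℝ) : ℂ) • (1 : F.alg)‖ ≤ δ ^ 2 * 1 := by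
    rw [norm_smul, Complex.norm_real, Real.norm_eq_abs, abs_of_nonneg (by positivity)]
    gcongr; exact norm_one_le_one
  exact abs_le_of_sq_le_sq' (by nlinarith) hδ |>.2

theorem norm_compress {F : FDx} {p Z : F.alg} {δ : ℝ} (hδ : 0 ≤ δ) (hps : star p = p)
    (hpp : p * p = p) (h1 : ‖(1 - p) * Z‖ ≤ δ) (h2 : ‖(1 - p) * star Z‖ ≤ δ) :
    ‖p * Z * p - Z‖ ≤ 2 * δ := by
  have e : p * Z * p - Z = - ((1 - p) * Z) - p * star ((1 - p) * star Z) := by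
    rw [star_mul, star_star, star_sub, star_one, hps]; noncomm_ring
  rw [e]
  have hp1 : ‖p‖ ≤ 1 := by
    refine posElem_norm_le_one ⟨p, by rw [hps, hpp]⟩ ⟨1 - p, ?_⟩
    rw [star_sub, star_one, hps, mul_sub, sub_mul, sub_mul, hpp]; simp
  calc _ ≤ ‖- ((1 - p) * Z)‖ + ‖p * star ((1 - p) * star Z)‖ := norm_sub_le _ _
    _ ≤ δ + 1 * δ := by
        rw [norm_neg]
        refine add_le_add h1 ((norm_mul_le _ _).trans ?_)
        rw [norm_star]; gcongr
    _ = _ := by ring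

theorem one_color {F : FDx} {ψ : B →ₗ[ℂ] F.alg} {φ : F.alg →ₗ[ℂ] B} (hψ : CPC ψ) (hφ : CPC φ)
    (hoz : OZ φ) {d d' : B} (hd : 0 ≤ d) (hd1 : ‖d‖ ≤ 1) (hd' : 0 ≤ d') (hd'1 : ‖d'‖ ≤ 1)
    {ε ε' c : ℝ} (hε : 0 < ε) (hε1 : ε < 1) (hc0 : 0 ≤ c) (hε' : 0 ≤ ε')
    (hle : φ (ψ (d * d)) ≤ d * d + ε' • 1) (hdd' : ‖(1 - d') * d‖ ≤ c)
    (hc : c ^ 2 + ε' ≤ (ε / 4) ^ 2 * ((ε / 2 / 8) ^ 3 / 2) ^ 2) :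
    ∃ (F' : FDx) (ψ' : B →ₗ[ℂ] F'.alg) (φ' : F'.alg →ₗ[ℂ] B), CPC ψ' ∧ CPC φ' ∧ OZ φ' ∧
      (∀ x, ∃ z : ℕ → B, Tendsto (fun n => d' * z n * d') atTop (𝓝 (φ' x))) ∧
      ∀ x, ‖x‖ ≤ 1 → ‖φ' (ψ' x) - φ (ψ (d * x * d))‖ ≤ ε := by
  have hds : star d = d := IsSelfAdjoint.of_nonneg hd
  have hd's : star d' = d' := IsSelfAdjoint.of_nonneg hd'
  set δ := ε / 4 with hδ
  have hδ0 : 0 < δ := by positivity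
  have hhpos : IsPosElem (ψ (d * d)) := cp_pos hψ.1 ⟨d, by rw [hds]⟩
  obtain ⟨F', κ, ρ, hκm, hκs, hρ, hκρ, hp1, hp2⟩ := fd_cut F (ψ (d * d)) hhpos
    (δ := δ ^ 2) (by positivity)
  set p := κ 1 with hpdef
  have hpp : p * p = p := by rw [hpdef, ← hκm, one_mul]
  have hps : star p = p := by rw [hpdef, ← hκs, star_one]
  have hκ : CPC κ := cpc_hom hκm hκs
  have hφκ : CPC (φ ∘ₗ κ) := cpc_comp hκ hφ
  have hozκ : OZ (φ ∘ₗ κ) := fun e f hef hfe => by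
    simp only [LinearMap.comp_apply]
    refine hoz _ _ ?_ ?_
    · rw [← hκm, hef, map_zero]
    · rw [← hκm, hfe, map_zero]
  have hk0 : 0 ≤ φ p := posElem_iff.1 (cp_pos hφ.1 ⟨p, by rw [hps, hpp]⟩)
  have hk1 : ‖φ p‖ ≤ 1 := by
    have := (cpc_norm hφκ 1).trans norm_one_le_one
    simpa using this
  have hkle : (δ ^ 2) • φ p ≤ d * d + ε' • 1 := by
    have h1 := cp_pos hφ.1 hp1
    rw [map_sub, map_smul, posElem_iff, sub_nonneg] at h1
    refine le_trans (le_of_eq ?_) (h1.trans hle)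
    exact (Complex.coe_smul _ _).symm
  have hks : star (φ p) = φ p := IsSelfAdjoint.of_nonneg hk0
  have hkk : φ p * φ p ≤ φ p := by
    have h1 : φ p ≤ 1 := (CStarAlgebra.norm_le_one_iff_of_nonneg _ hk0).1 hk1
    have hsq : 0 ≤ CFC.sqrt (φ p) := CFC.sqrt_nonneg _
    have hsqs : star (CFC.sqrt (φ p)) = CFC.sqrt (φ p) := IsSelfAdjoint.of_nonneg hsq
    have h2 := star_left_conjugate_le_conjugate h1 (CFC.sqrt (φ p))
    have h3 : CFC.sqrt (φ p) * CFC.sqrt (φ p) = φ p := CFC.sqrt_mul_sqrt_self _ hk0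
    rw [hsqs, mul_one, h3] at h2
    have h4 : CFC.sqrt (φ p) * φ p * CFC.sqrt (φ p) = φ p * φ p := by
      calc _ = CFC.sqrt (φ p) * (CFC.sqrt (φ p) * CFC.sqrt (φ p)) * CFC.sqrt (φ p) := by rw [h3]
        _ = (CFC.sqrt (φ p) * CFC.sqrt (φ p)) * (CFC.sqrt (φ p) * CFC.sqrt (φ p)) := by
            simp only [mul_assoc]
        _ = _ := by rw [h3]
    rwa [h4] at h2
  have hqs : star (1 - d') = 1 - d' := by rw [star_sub, star_one, hd's]
  have hq1 : ‖1 - d'‖ ≤ 1 := by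
    have a1 := posElem_one_sub (posElem_iff.2 hd') hd'1
    refine posElem_norm_le_one a1 ?_
    rw [sub_sub_cancel]; exact posElem_iff.2 hd'
  have hnorm : ‖(1 - d') * φ p‖ ≤ (ε / 2 / 8) ^ 3 / 2 := by
    have a1 : (δ ^ 2) • (φ p * φ p) ≤ d * d + ε' • 1 :=
      (smul_le_smul_of_nonneg_left hkk (by positivity)).trans hkle
    have a2 := star_left_conjugate_le_conjugate a1 (1 - d')
    have e1 : star (1 - d') * ((δ ^ 2) • (φ p * φ p)) * (1 - d') =
        (δ ^ 2) • (((1 - d') * φ p) * star ((1 - d') * φ p)) := by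
      rw [star_mul, hqs, hks, mul_smul_comm, smul_mul_assoc]; simp only [mul_assoc]
    have e2 : star (1 - d') * (d * d + ε' • 1) * (1 - d') =
        ((1 - d') * d) * star ((1 - d') * d) + ε' • ((1 - d') * (1 - d')) := by
      rw [star_mul, hqs, hds, mul_add, add_mul, mul_smul_comm, smul_mul_assoc, mul_one]
      simp only [mul_assoc]
    rw [e1, e2] at a2
    have a3 := CStarAlgebra.norm_le_norm_of_nonneg_of_le
      (smul_nonneg (by positivity) (mul_star_self_nonneg _)) a2
    rw [norm_smul, CStarRing.norm_self_mul_star, Real.norm_eq_abs, abs_of_nonneg (by positivity)] at a3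
    have a4 : ‖((1 - d') * d) * star ((1 - d') * d) + ε' • ((1 - d') * (1 - d'))‖ ≤ c ^ 2 + ε' := by
      refine (norm_add_le _ _).trans (add_le_add ?_ ?_)
      · rw [CStarRing.norm_self_mul_star]; nlinarith [norm_nonneg ((1 - d') * d)]
      · rw [norm_smul, Real.norm_eq_abs, abs_of_nonneg hε']
        calc _ ≤ ε' * (1 * 1) := by
              gcongr; exact (norm_mul_le _ _).trans (by gcongr)
          _ = ε' := by ring
    have a5 := (a3.trans a4).trans hc
    have a6 : ‖(1 - d') * φ p‖ * ‖(1 - d') * φ p‖ ≤ ((ε / 2 / 8) ^ 3 / 2) ^ 2 :=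
      le_of_mul_le_mul_left a5 (by positivity)
    exact abs_le_of_sq_le_sq' (by nlinarith) (by positivity) |>.2
  obtain ⟨φ', hφ', hozφ', hlim, happ⟩ := oz_cut hφκ hozκ hd' hd'1 (ε := ε / 2) (by positivity)
    (by linarith) hnorm
  let ψd : B →ₗ[ℂ] F.alg := ψ ∘ₗ LinearMap.mulLeftRight ℂ (d, d)
  have hψd : ∀ x, ψd x = ψ (d * x * d) := fun x => by
    simp only [ψd, LinearMap.comp_apply, LinearMap.mulLeftRight_apply]
  have hψdc : CPC ψd := by
    refine cpc_of_norm (cp_conj_dom hψ.1 d fun x => by rw [hψd, hds]) ?_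
    rw [hψd]
    refine (cpc_norm hψ _).trans ?_
    calc ‖d * 1 * d‖ ≤ 1 * 1 := by rw [mul_one]; exact (norm_mul_le _ _).trans (by gcongr)
      _ = 1 := by ring
  refine ⟨F', ρ ∘ₗ ψd, φ', cpc_comp hψdc hρ, hφ', hozφ', hlim, fun x hx => ?_⟩
  have hsmall : ∀ x : B, ‖x‖ ≤ 1 → ‖(1 - p) * ψ (d * x * d)‖ ≤ δ := by
    intro x hx
    refine compress_small (h := ψ (d * d)) hδ0.le hps hpp ?_ hp2
    have a1 := cpc_schwarz hψ (d * x * d)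
    have a2 : IsPosElem (d * d - d * x * d * star (d * x * d)) := by
      have b1 : IsPosElem ((1 : B) - (x * d) * star (x * d)) := by
        refine posElem_one_sub ⟨star (x * d), by rw [star_star]⟩ ?_
        rw [CStarRing.norm_self_mul_star]
        have : ‖x * d‖ ≤ 1 := (norm_mul_le _ _).trans (by nlinarith [norm_nonneg x, norm_nonneg d])
        nlinarith [norm_nonneg (x * d)]
      have b2 := posElem_conj b1 d
      have e : star d * (1 - (x * d) * star (x * d)) * d = d * d - d * x * d * star (d * x * d) := by
        simp only [star_mul, hds, mul_sub, sub_mul, mul_one, mul_assoc]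
      rwa [e] at b2
    have a3 := posElem_add (cp_pos hψ.1 a2) a1
    rwa [map_sub, sub_add_sub_cancel] at a3
  have h1 := hsmall x hx
  have h2 := hsmall (star x) (by rwa [norm_star])
  have h3 : ψ (d * star x * d) = star (ψ (d * x * d)) := by
    rw [← cp_star hψ.1]; simp only [star_mul, hds, mul_assoc]
  rw [h3] at h2
  have h4 := norm_compress hδ0.le hps hpp h1 h2
  have h5 : ‖(ρ ∘ₗ ψd) x‖ ≤ 1 := (cpc_norm (cpc_comp hψdc hρ) x).trans hx
  have h6 := happ _ h5
  have h7 : (φ ∘ₗ κ) ((ρ ∘ₗ ψd) x) = φ (p * ψ (d * x * d) * p) := by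
    simp only [LinearMap.comp_apply, hκρ, hψd]
  rw [h7] at h6
  have h8 : ‖φ (p * ψ (d * x * d) * p) - φ (ψ (d * x * d))‖ ≤ 2 * δ := by
    rw [← map_sub]; exact (cpc_norm hφ _).trans h4
  calc _ ≤ _ := norm_sub_le_norm_sub_add_norm_sub _ (φ (p * ψ (d * x * d) * p)) _
    _ ≤ ε / 2 + 2 * δ := add_le_add h6 h8
    _ = ε := by rw [hδ]; ring

end cutapprox

theorem cut_approx {B : Type*} [CStarAlgebra B] {κ : Type} [Fintype κ] (hB : ColorApprox κ B)
    {ε : ℝ} (hε : 0 < ε) : ∃ c : ℝ, 0 < c ∧ ∀ d d' : B, IsPosElem d → ‖d‖ ≤ 1 → IsPosElem d' →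
      ‖d'‖ ≤ 1 → ‖(1 - d') * d‖ ≤ c → ∀ S : Finset B,
      ∃ (F : κ → FDx) (ψ : ∀ j, B →ₗ[ℂ] (F j).alg) (φ : ∀ j, (F j).alg →ₗ[ℂ] B),
        (∀ j, CPC (ψ j)) ∧ (∀ j, CPC (φ j)) ∧ (∀ j, OZ (φ j)) ∧
        (∀ j x, ∃ z : ℕ → B, Tendsto (fun n => d' * z n * d') atTop (𝓝 (φ j x))) ∧
        ∀ a ∈ S, ‖a‖ ≤ 1 → ‖∑ j, φ j (ψ j a) - d * a * d‖ ≤ ε := by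
  letI := CStarAlgebra.spectralOrder B
  haveI := CStarAlgebra.spectralOrderedRing B
  set N : ℝ := Fintype.card κ + 1 with hN
  have hN0 : 0 < N := by positivity
  set η := min (1 / 2) (ε / 2 / N) with hη
  have hη0 : 0 < η := lt_min (by norm_num) (by positivity)
  have hη1 : η < 1 := lt_of_le_of_lt (min_le_left _ _) (by norm_num)
  set K := (η / 4) ^ 2 * ((η / 2 / 8) ^ 3 / 2) ^ 2 with hK
  have hK0 : 0 < K := by positivity
  refine ⟨Real.sqrt (K / 2), by positivity, fun d d' hd hd1 hd' hd'1 hdd S => ?_⟩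
  have hds := posElem_star hd
  set ε' := min (K / 2) (ε / 2) with hε'
  have hε'0 : 0 < ε' := lt_min (by positivity) (by positivity)
  classical
  obtain ⟨F, ψ, φ, hψ, hφ, hoz, happ⟩ := hB (insert (d * d) (S.image fun x => d * x * d)) ε' hε'0
  have hsum := happ (d * d) (by simp)
  have hpos : ∀ j, IsPosElem (φ j (ψ j (d * d))) := fun j =>
    cp_pos (hφ j).1 (cp_pos (hψ j).1 ⟨d, by rw [hds]⟩)
  have hle : ∀ j, φ j (ψ j (d * d)) ≤ d * d + ε' • 1 := by
    intro j
    have h1 : φ j (ψ j (d * d)) ≤ ∑ j, φ j (ψ j (d * d)) :=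
      Finset.single_le_sum (f := fun j => φ j (ψ j (d * d)))
        (fun i _ => posElem_iff.1 (hpos i)) (Finset.mem_univ j)
    have h2 := posElem_norm_sub (a := ∑ j, φ j (ψ j (d * d)) - d * d) (by
      rw [star_sub, posElem_star (posElem_sum _ _ fun i _ => hpos i), star_mul, hds]) hsum.le
    rw [posElem_iff, sub_nonneg, sub_le_iff_le_add, Complex.coe_smul, add_comm] at h2
    exact h1.trans h2
  have hone := fun j => one_color (hψ j) (hφ j) (hoz j) (posElem_iff.1 hd) hd1 (posElem_iff.1 hd') hd'1
    hη0 hη1 (Real.sqrt_nonneg _) hε'0.le (hle j) hdd (by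
      rw [Real.sq_sqrt (by positivity)]
      have := min_le_left (K / 2) (ε / 2); linarith)
  choose F' ψ' φ' h1 h2 h3 h4 h5 using hone
  refine ⟨F', ψ', φ', h1, h2, h3, h4, fun a ha ha1 => ?_⟩
  have h6 := happ (d * a * d) (Finset.mem_insert_of_mem (Finset.mem_image_of_mem _ ha))
  have h7 : ‖∑ j, φ' j (ψ' j a) - ∑ j, φ j (ψ j (d * a * d))‖ ≤ ε / 2 := by
    rw [← Finset.sum_sub_distrib]
    calc _ ≤ ∑ j : κ, η := norm_sum_le_of_le _ fun j _ => h5 j a ha1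
      _ = Fintype.card κ * η := by simp
      _ ≤ N * (ε / 2 / N) := by
          gcongr
          · rw [hN]; linarith
          · exact min_le_right _ _
      _ = ε / 2 := by field_simp
  calc _ ≤ _ := norm_sub_le_norm_sub_add_norm_sub _ (∑ j, φ j (ψ j (d * a * d))) _
    _ ≤ ε / 2 + ε / 2 := add_le_add h7 (h6.le.trans (min_le_right _ _))
    _ = ε := by ring


theorem lift_map {N G : Type*} [CStarAlgebra N] [CStarAlgebra G] (j : N →⋆ₙₐ[ℂ] G)
    (hj : Function.Injective j) {F : FDx} {φ : F.alg →ₗ[ℂ] G} (hφ : CPC φ) (hoz : OZ φ)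
    (hr : ∀ x, φ x ∈ Set.range j) :
    ∃ φ' : F.alg →ₗ[ℂ] N, CPC φ' ∧ OZ φ' ∧ ∀ x, j (φ' x) = φ x := by
  choose g hg using hr
  let φ' : F.alg →ₗ[ℂ] N :=
    { toFun := g
      map_add' := fun x y => hj (by rw [map_add, hg, hg, hg, map_add])
      map_smul' := fun c x => hj (by rw [RingHom.id_apply, map_smul, hg, hg, map_smul]) }
  have h : ∀ x, j (φ' x) = φ x := hg
  refine ⟨φ', cpc_of_norm (cp_reflect j hj h hφ.1) ?_, fun e f hef hfe => hj ?_, h⟩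
  · rw [← NonUnitalStarAlgHom.norm_map j hj, h]
    exact (cpc_norm hφ _).trans norm_one_le_one
  · rw [map_mul, h, h, hoz e f hef hfe, map_zero]

theorem cut_approx' {B : Type*} [CStarAlgebra B] {κ : Type} [Fintype κ] (hB : ColorApprox κ B)
    {ε R : ℝ} (hε : 0 < ε) (hR : 0 < R) : ∃ c : ℝ, 0 < c ∧ ∀ d d' : B, IsPosElem d → ‖d‖ ≤ 1 →
      IsPosElem d' → ‖d'‖ ≤ 1 → ‖(1 - d') * d‖ ≤ c → ∀ S : Finset B,
      ∃ (F : κ → FDx) (ψ : ∀ j, B →ₗ[ℂ] (F j).alg) (φ : ∀ j, (F j).alg →ₗ[ℂ] B),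
        (∀ j, CPC (ψ j)) ∧ (∀ j, CPC (φ j)) ∧ (∀ j, OZ (φ j)) ∧
        (∀ j x, ∃ z : ℕ → B, Tendsto (fun n => d' * z n * d') atTop (𝓝 (φ j x))) ∧
        ∀ a ∈ S, ‖a‖ ≤ R → ‖∑ j, φ j (ψ j a) - d * a * d‖ ≤ ε := by
  obtain ⟨c, hc, H⟩ := cut_approx hB (ε := ε / R) (by positivity)
  refine ⟨c, hc, fun d d' h1 h2 h3 h4 h5 S => ?_⟩
  classical
  obtain ⟨F, ψ, φ, a1, a2, a3, a4, a5⟩ := H d d' h1 h2 h3 h4 h5 (S.image fun a => (R : ℂ)⁻¹ • a)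
  refine ⟨F, ψ, φ, a1, a2, a3, a4, fun a ha haR => ?_⟩
  have hRc : (R : ℂ) ≠ 0 := by exact_mod_cast hR.ne'
  have hn : ‖(R : ℂ)⁻¹‖ = R⁻¹ := by
    rw [norm_inv, Complex.norm_real, Real.norm_eq_abs, abs_of_pos hR]
  have := a5 _ (Finset.mem_image_of_mem _ ha) (by
    rw [norm_smul, hn, inv_mul_le_iff₀ hR, mul_one]; exact haR)
  simp only [map_smul, ← Finset.smul_sum, mul_smul_comm, smul_mul_assoc, ← smul_sub] at this
  rw [norm_smul, hn, inv_mul_le_iff₀ hR] at this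
  refine this.trans (le_of_eq ?_)
  field_simp

theorem bound_finset {B : Type*} [NormedRing B] (S : Finset B) : ∃ R : ℝ, 0 < R ∧ ∀ a ∈ S, ‖a‖ ≤ R := by
  refine ⟨∑ a ∈ S, ‖a‖ + 1, by positivity, fun a ha => ?_⟩
  have := Finset.single_le_sum (f := fun a => ‖a‖) (fun i _ => norm_nonneg i) ha
  exact this.trans (by linarith)

theorem colorApprox_corner {N B : Type*} [CStarAlgebra N] [CStarAlgebra B] (j : N →⋆ₙₐ[ℂ] B)
    (hj : Function.Injective j) {p : B} (hpp : p * p = p) (hps : star p = p)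
    (hr : Set.range j = {x : B | p * x * p = x}) {κ : Type} [Fintype κ] (hB : ColorApprox κ B) :
    ColorApprox κ N := by
  intro S ε hε
  classical
  obtain ⟨R, hR, hSR⟩ := bound_finset (S.image j)
  obtain ⟨c, hc, H⟩ := cut_approx' hB (ε := ε / 2) (by positivity) hR
  have hp : IsPosElem p := ⟨p, by rw [hps, hpp]⟩
  have hp1 : ‖p‖ ≤ 1 := posElem_norm_le_one hp ⟨1 - p, by
    rw [star_sub, star_one, hps, mul_sub, sub_mul, sub_mul, hpp]; simp⟩
  obtain ⟨F, ψ, φ, a1, a2, a3, a4, a5⟩ := H p p hp hp1 hp hp1 (by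
    rw [sub_mul, one_mul, hpp, sub_self, norm_zero]; exact hc.le) (S.image j)
  have hmem : ∀ i x, φ i x ∈ Set.range j := fun i x => by
    rw [hr]
    obtain ⟨z, hz⟩ := a4 i x
    have h2 := (hz.const_mul p).mul_const p
    refine tendsto_nhds_unique (h2.congr fun n => ?_) hz
    calc p * (p * z n * p) * p = (p * p) * z n * (p * p) := by simp only [mul_assoc]
      _ = _ := by rw [hpp]
  choose φ' b1 b2 b3 using fun i => lift_map j hj (a2 i) (a3 i) (hmem i)
  let J : N →ₗ[ℂ] B := { toFun := j, map_add' := map_add j, map_smul' := fun c x => map_smul j c x }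
  have hJ : CPC J := cpc_hom (fun x y => map_mul j x y) (fun x => map_star j x)
  refine ⟨F, fun i => ψ i ∘ₗ J, φ', fun i => cpc_comp hJ (a1 i), b1, b2, fun a ha => ?_⟩
  have h1 := a5 (j a) (Finset.mem_image_of_mem _ ha) (hSR _ (Finset.mem_image_of_mem _ ha))
  have h2 : p * j a * p = j a := by
    have : j a ∈ Set.range j := ⟨a, rfl⟩
    rwa [hr] at this
  have h3 : j (∑ i, φ' i ((ψ i ∘ₗ J) a) - a) = ∑ i, φ i (ψ i (j a)) - p * j a * p := by
    rw [map_sub, map_sum, h2]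
    simp only [b3]
    rfl
  rw [← NonUnitalStarAlgHom.norm_map j hj, h3]
  linarith

theorem colorApprox_iso {N B : Type*} [CStarAlgebra N] [CStarAlgebra B] (j : N ≃⋆ₐ[ℂ] B)
    {κ : Type} [Fintype κ] (hB : ColorApprox κ B) : ColorApprox κ N := by
  refine colorApprox_corner (j : N →⋆ₙₐ[ℂ] B) j.injective (p := 1) (by simp) (by simp) ?_ hB
  ext x; simp

theorem colorApprox_prod {B₁ B₂ : Type*} [CStarAlgebra B₁] [CStarAlgebra B₂] {κ₁ κ₂ : Type}
    [Fintype κ₁] [Fintype κ₂] (h1 : ColorApprox κ₁ B₁) (h2 : ColorApprox κ₂ B₂) :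
    ColorApprox (κ₁ ⊕ κ₂) (B₁ × B₂) := by
  intro S ε hε
  classical
  obtain ⟨F1, ψ1, φ1, a1, a2, a3, a4⟩ := h1 (S.image Prod.fst) ε hε
  obtain ⟨F2, ψ2, φ2, b1, b2, b3, b4⟩ := h2 (S.image Prod.snd) ε hε
  refine ⟨fun i => Sum.casesOn i F1 F2,
    fun i => Sum.casesOn i (fun i => ψ1 i ∘ₗ LinearMap.fst ℂ B₁ B₂)
      (fun i => ψ2 i ∘ₗ LinearMap.snd ℂ B₁ B₂),
    fun i => Sum.casesOn i (fun i => LinearMap.inl ℂ B₁ B₂ ∘ₗ φ1 i)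
      (fun i => LinearMap.inr ℂ B₁ B₂ ∘ₗ φ2 i), ?_, ?_, ?_, ?_⟩
  · rintro (i | i)
    · exact cpc_comp (cpc_hom (fun _ _ => rfl) (fun _ => rfl)) (a1 i)
    · exact cpc_comp (cpc_hom (fun _ _ => rfl) (fun _ => rfl)) (b1 i)
  · rintro (i | i)
    · exact cpc_comp (a2 i) (cpc_hom (fun _ _ => by ext <;> simp) (fun _ => by ext <;> simp))
    · exact cpc_comp (b2 i) (cpc_hom (fun _ _ => by ext <;> simp) (fun _ => by ext <;> simp))
  · rintro (i | i) e f hef hfe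
    · have := a3 i e f hef hfe
      ext
      · exact this
      · simp
    · have := b3 i e f hef hfe
      ext
      · simp
      · exact this
  · intro a ha
    have c1 := a4 a.1 (Finset.mem_image_of_mem _ ha)
    have c2 := b4 a.2 (Finset.mem_image_of_mem _ ha)
    rw [Fintype.sum_sum_type]
    rw [Prod.norm_def, max_lt_iff]
    constructor
    · refine lt_of_eq_of_lt (congrArg norm ?_) c1
      simp [Prod.fst_sum]
    · refine lt_of_eq_of_lt (congrArg norm ?_) c2
      simp [Prod.snd_sum]

section sep
open TopologicalSpace

theorem sep_of_inj {N B : Type*} [CStarAlgebra N] [CStarAlgebra B] [SeparableSpace B]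
    (j : N →⋆ₙₐ[ℂ] B) (hj : Function.Injective j) : SeparableSpace N := by
  haveI : SecondCountableTopology B := UniformSpace.secondCountable_of_separable B
  haveI := (NonUnitalStarAlgHom.isometry j hj).isEmbedding.secondCountableTopology
  infer_instance

end sep


section amp
variable {R R' : Type*} [Ring R] [StarRing R] [Module ℂ R] [Ring R'] [StarRing R'] [Module ℂ R']

theorem cp_amp {T : R →ₗ[ℂ] R'} (hT : IsCompletelyPositive T) (K : Type) [Fintype K] [DecidableEq K] :
    IsCompletelyPositive (T.mapMatrix : Matrix K K R →ₗ[ℂ] Matrix K K R') := by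
  intro k x hx
  obtain ⟨Y, rfl⟩ := hx
  let e : Fin k × K ≃ Fin (Fintype.card (Fin k × K)) := Fintype.equivFin _
  obtain ⟨Z, hZ⟩ := hT _ (Matrix.of fun a b =>
      (star Y * Y) (e.symm a).1 (e.symm b).1 (e.symm a).2 (e.symm b).2)
    ⟨Matrix.of fun a b => Y (e.symm a).1 (e.symm b).1 (e.symm a).2 (e.symm b).2, by
      ext a b
      simp only [Matrix.of_apply, Matrix.mul_apply, Matrix.star_apply, Matrix.sum_apply]
      rw [← Equiv.sum_comp e, Fintype.sum_prod_type]
      simp⟩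
  refine ⟨Matrix.of fun i j => Matrix.of fun s t => Z (e (i, s)) (e (j, t)), ?_⟩
  ext i j s t
  have := congrFun (congrFun hZ (e (i, s))) (e (j, t))
  simp only [Matrix.map_apply, Matrix.of_apply, Equiv.symm_apply_apply, Matrix.mul_apply,
    Matrix.star_apply, Matrix.sum_apply] at this
  rw [← Equiv.sum_comp e, Fintype.sum_prod_type] at this
  simp only [Matrix.map_apply, Matrix.of_apply, Matrix.mul_apply, Matrix.star_apply,
    Matrix.sum_apply, LinearMap.mapMatrix_apply]
  exact this

theorem cpc_amp {T : R →ₗ[ℂ] R'} (hT : CPC T) (K : Type) [Fintype K] [DecidableEq K] :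
    CPC (T.mapMatrix : Matrix K K R →ₗ[ℂ] Matrix K K R') := by
  refine ⟨cp_amp hT.1 K, ?_⟩
  obtain ⟨z, hz⟩ := hT.2
  refine ⟨Matrix.diagonal fun _ => z, ?_⟩
  rw [Matrix.star_eq_conjTranspose, Matrix.diagonal_conjTranspose, Matrix.diagonal_mul_diagonal]
  ext s t
  by_cases h : s = t
  · subst h; simpa using hz
  · simp [h]

theorem cpc_comp_hom {R'' : Type*} [Ring R''] [StarRing R''] [Module ℂ R''] {T : R →ₗ[ℂ] R'}
    {T' : R' →ₗ[ℂ] R''} (hT : CPC T) (h1 : T' 1 = 1) (hm : ∀ x y, T' (x * y) = T' x * T' y)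
    (hs : ∀ x, T' (star x) = star (T' x)) : CPC (T' ∘ₗ T) := by
  refine ⟨cp_comp hT.1 (cp_hom hm hs), ?_⟩
  obtain ⟨z, hz⟩ := hT.2
  refine ⟨T' z, ?_⟩
  rw [← hs, ← hm, ← hz, map_sub, h1]; rfl

theorem cpc_hom_comp {R'' : Type*} [Ring R''] [StarRing R''] [Module ℂ R''] {T : R →ₗ[ℂ] R'}
    {T' : R' →ₗ[ℂ] R''} (hT : CPC T') (h1 : T 1 = 1) (hm : ∀ x y, T (x * y) = T x * T y)
    (hs : ∀ x, T (star x) = star (T x)) : CPC (T' ∘ₗ T) := by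
  refine ⟨cp_comp (cp_hom hm hs) hT.1, ?_⟩
  simp only [LinearMap.comp_apply, h1]; exact hT.2

end amp

/-- matrices over a finite-dimensional algebra -/
def FDx.mat (F : FDx) (K : Type) [Fintype K] [DecidableEq K] : FDx := ⟨F.ι, fun i => F.n i × K⟩

def FDx.toMat (F : FDx) (K : Type) [Fintype K] [DecidableEq K] :
    (F.mat K).alg →ₗ[ℂ] Matrix K K F.alg where
  toFun y := Matrix.of fun s t i => Matrix.of fun a b => y i (a, s) (b, t)
  map_add' x y := rfl
  map_smul' c y := rfl

def FDx.ofMat (F : FDx) (K : Type) [Fintype K] [DecidableEq K] :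
    Matrix K K F.alg →ₗ[ℂ] (F.mat K).alg where
  toFun x := fun i => Matrix.of fun a b => x a.2 b.2 i a.1 b.1
  map_add' x y := rfl
  map_smul' c y := rfl

section
variable (F : FDx) (K : Type) [Fintype K] [DecidableEq K]

theorem toMat_ofMat (x : Matrix K K F.alg) : F.toMat K (F.ofMat K x) = x := rfl

theorem ofMat_toMat (x : (F.mat K).alg) : F.ofMat K (F.toMat K x) = x := rfl

theorem toMat_mul (x y : (F.mat K).alg) : F.toMat K (x * y) = F.toMat K x * F.toMat K y := by
  ext s t i a b
  have h : F.toMat K (x * y) s t i a b = ∑ c : F.n i × K, x i (a, s) c * y i c (b, t) := rfl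
  have h2 : ∀ s' t' a' b', x i (a', s') (b', t') = F.toMat K x s' t' i a' b' := fun _ _ _ _ => rfl
  have h3 : ∀ s' t' a' b', y i (a', s') (b', t') = F.toMat K y s' t' i a' b' := fun _ _ _ _ => rfl
  rw [h, Fintype.sum_prod_type_right]
  simp only [Matrix.mul_apply, Finset.sum_apply, Matrix.sum_apply, Pi.mul_apply, h2, h3]

theorem toMat_star (x : (F.mat K).alg) : F.toMat K (star x) = star (F.toMat K x) := rfl

theorem toMat_one : F.toMat K 1 = 1 := by
  ext s t i a b
  have h : F.toMat K 1 s t i a b = if (a, s) = (b, t) then 1 else 0 := rfl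
  rw [h]
  by_cases hs : s = t
  · subst hs; by_cases ha : a = b
    · subst ha; simp
    · simp [ha]
  · simp [hs]

theorem ofMat_mul (x y : Matrix K K F.alg) : F.ofMat K (x * y) = F.ofMat K x * F.ofMat K y := by
  rw [← toMat_ofMat F K x, ← toMat_ofMat F K y, ← toMat_mul]; rfl

theorem ofMat_one : F.ofMat K 1 = 1 := by
  rw [← toMat_one]; rfl
end

section
variable {B B' : Type*} [CStarAlgebra B] [CStarAlgebra B'] {K : Type} [Fintype K] [DecidableEq K]
  (e : B' ≃⋆ₐ[ℂ] Matrix K K B)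

theorem norm_single (s t : K) (b : B) : ‖e.symm (Matrix.single s t b)‖ ≤ ‖b‖ := by
  let f : B →⋆ₙₐ[ℂ] B' :=
    { toFun := fun b => e.symm (Matrix.single t t b)
      map_smul' := fun c x => by
        rw [← Matrix.smul_single, map_smul]; rfl
      map_zero' := by rw [Matrix.single_zero, map_zero]
      map_add' := fun x y => by rw [Matrix.single_add, map_add]
      map_mul' := fun x y => by rw [← map_mul, Matrix.single_mul_single_same]
      map_star' := fun x => by
        rw [← map_star, Matrix.star_eq_conjTranspose, Matrix.conjTranspose_single] }
  have h1 : star (e.symm (Matrix.single s t b)) * e.symm (Matrix.single s t b) = f (star b * b) := by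
    rw [← map_star, ← map_mul, Matrix.star_eq_conjTranspose, Matrix.conjTranspose_single,
      Matrix.single_mul_single_same]; rfl
  have h2 := NonUnitalStarAlgHom.norm_apply_le f (star b * b)
  rw [← h1, CStarRing.norm_star_mul_self, CStarRing.norm_star_mul_self] at h2
  exact abs_le_of_sq_le_sq' (by nlinarith) (norm_nonneg b) |>.2

theorem symm_eq_sum (M : Matrix K K B) :
    e.symm M = ∑ s, ∑ t, e.symm (Matrix.single s t (M s t)) := by
  conv_lhs => rw [Matrix.matrix_eq_sum_single M]
  simp only [map_sum]

theorem norm_symm_le (M : Matrix K K B) : ‖e.symm M‖ ≤ ∑ s, ∑ t, ‖M s t‖ := by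
  rw [symm_eq_sum]
  refine norm_sum_le_of_le _ fun s _ => norm_sum_le_of_le _ fun t _ => norm_single e s t _

theorem colorApprox_matrix (e : B' ≃⋆ₐ[ℂ] Matrix K K B) {κ : Type} [Fintype κ] (hB : ColorApprox κ B) :
    ColorApprox κ B' := by
  intro S ε hε
  classical
  set N : ℝ := Fintype.card K * Fintype.card K + 1 with hN
  have hN0 : 0 < N := by positivity
  obtain ⟨F, ψ, φ, h1, h2, h3, h4⟩ := hB
    (S.biUnion fun a => Finset.univ.image fun q : K × K => e a q.1 q.2) (ε / N) (by positivity)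
  let E : B' →ₗ[ℂ] Matrix K K B := e.toAlgEquiv.toLinearMap
  let E' : Matrix K K B →ₗ[ℂ] B' := e.symm.toAlgEquiv.toLinearMap
  have hE : ∀ x, E x = e x := fun _ => rfl
  have hE' : ∀ x, E' x = e.symm x := fun _ => rfl
  refine ⟨fun j => (F j).mat K, fun j => (F j).ofMat K ∘ₗ (ψ j).mapMatrix ∘ₗ E,
    fun j => E' ∘ₗ (φ j).mapMatrix ∘ₗ (F j).toMat K, fun j => ?_, fun j => ?_, fun j => ?_, ?_⟩
  · refine cpc_comp_hom (cpc_hom_comp (cpc_amp (h1 j) K) ?_ ?_ ?_) (ofMat_one _ _)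
      (ofMat_mul _ _) fun _ => rfl
    · rw [hE, map_one]
    · intro x y; simp only [hE, map_mul]
    · intro x; simp only [hE, map_star]
  · refine cpc_comp_hom (cpc_hom_comp (cpc_amp (h2 j) K) (toMat_one _ _) (toMat_mul _ _)
      (toMat_star _ _)) ?_ ?_ ?_
    · rw [hE', map_one]
    · intro x y; simp only [hE', map_mul]
    · intro x; simp only [hE', map_star]
  · intro x y hxy hyx
    simp only [LinearMap.comp_apply, hE']
    rw [← map_mul]
    have : (φ j).mapMatrix ((F j).toMat K x) * (φ j).mapMatrix ((F j).toMat K y) = 0 := by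
      ext s t
      simp only [Matrix.mul_apply, LinearMap.mapMatrix_apply, Matrix.map_apply]
      rw [Finset.sum_congr rfl fun u _ => oz_mul (h2 j) (h3 j) _ _]
      rw [← Finset.mul_sum, ← map_sum, ← Matrix.mul_apply, ← toMat_mul, hxy]
      simp
    rw [this, map_zero]
  · intro a ha
    have h5 : ∑ j, (E' ∘ₗ (φ j).mapMatrix ∘ₗ (F j).toMat K)
        (((F j).ofMat K ∘ₗ (ψ j).mapMatrix ∘ₗ E) a) - a =
        e.symm (Matrix.of fun s t => ∑ j, φ j (ψ j (e a s t)) - e a s t) := by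
      conv_lhs => rw [← e.symm_apply_apply a]
      simp only [LinearMap.comp_apply, hE', toMat_ofMat, hE]
      rw [← map_sum, ← map_sub]
      congr 1
      ext s t
      simp [Matrix.sum_apply]
    rw [h5]
    refine (norm_symm_le e _).trans_lt ?_
    calc _ ≤ ∑ s : K, ∑ t : K, ε / N := by
          refine Finset.sum_le_sum fun s _ => Finset.sum_le_sum fun t _ => ?_
          refine (h4 _ ?_).le
          exact Finset.mem_biUnion.2 ⟨a, ha, Finset.mem_image.2 ⟨(s, t), Finset.mem_univ _, rfl⟩⟩
      _ = (Fintype.card K * Fintype.card K) * (ε / N) := by simp; ring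
      _ < N * (ε / N) := by
          have : 0 < ε / N := by positivity
          refine mul_lt_mul_of_pos_right ?_ this
          rw [hN]; linarith
      _ = ε := by field_simp

open TopologicalSpace in
theorem sep_matrix (e : B' ≃⋆ₐ[ℂ] Matrix K K B) [SeparableSpace B] : SeparableSpace B' := by
  haveI : SecondCountableTopology B := UniformSpace.secondCountable_of_separable B
  let g : (K → K → B) → B' := fun M => ∑ s, ∑ t, e.symm (Matrix.single s t (M s t))
  have hg : Continuous g := by
    refine continuous_finsetSum _ fun s _ => continuous_finsetSum _ fun t _ => ?_
    let l : B →ₗ[ℂ] B' :=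
      { toFun := fun b => e.symm (Matrix.single s t b)
        map_add' := fun x y => by rw [Matrix.single_add, map_add]
        map_smul' := fun c x => by rw [← Matrix.smul_single, map_smul]; rfl }
    have hl : Continuous l := AddMonoidHomClass.continuous_of_bound l 1 fun b => by
      rw [one_mul]; exact norm_single e s t b
    exact hl.comp ((continuous_apply t).comp (continuous_apply s))
  have hs : Function.Surjective g := fun b => ⟨e b, by
    change ∑ s, ∑ t, e.symm (Matrix.single s t (e b s t)) = b
    rw [← symm_eq_sum]; simp⟩
  exact hs.denseRange.separableSpace hg

end

theorem sep_iso {N B : Type*} [CStarAlgebra N] [CStarAlgebra B] [TopologicalSpace.SeparableSpace B]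
    (j : N ≃⋆ₐ[ℂ] B) : TopologicalSpace.SeparableSpace N :=
  sep_of_inj (j : N →⋆ₙₐ[ℂ] B) j.injective

theorem finSat_lnuc {B : CStarAlg} (h : FinSat lnucClass B) :
    TopologicalSpace.SeparableSpace B.carrier ∧ ∃ (κ : Type) (_ : Fintype κ), ColorApprox κ B.carrier := by
  induction h with
  | base h =>
    obtain ⟨h1, n, h2⟩ := h
    exact ⟨h1, _, _, colorApprox_of_nd h2⟩
  | iso h e ih =>
    obtain ⟨e⟩ := e
    obtain ⟨h1, κ, _, h2⟩ := ih
    exact ⟨sep_iso e, κ, _, colorApprox_iso e h2⟩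
  | sum h h' e ih ih' =>
    obtain ⟨e⟩ := e
    obtain ⟨h1, κ, _, h2⟩ := ih
    obtain ⟨h1', κ', _, h2'⟩ := ih'
    exact ⟨sep_iso e, κ ⊕ κ', inferInstance,
      colorApprox_iso e (colorApprox_prod h2 h2')⟩
  | matrix k h e ih =>
    obtain ⟨e⟩ := e
    obtain ⟨h1, κ, _, h2⟩ := ih
    exact ⟨sep_matrix e, κ, _, colorApprox_matrix e h2⟩
  | corner p h hp hpp hps hi ih =>
    obtain ⟨h1, κ, _, h2⟩ := ih
    obtain ⟨j, hj, hj1, hr⟩ := hi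
    exact ⟨sep_of_inj j hj, κ, _, colorApprox_corner j hj hpp hps hr h2⟩


section unitize

theorem approx_unit {B : Type*} [CStarAlgebra B] (c : B) (hc : IsPosElem c) :
    ∃ d z : ℕ → B, (∀ l, IsPosElem (d l)) ∧ (∀ l, ‖d l‖ ≤ 1) ∧ (∀ l, d l = c * z l) ∧
      (∀ l, d l = z l * c) ∧ Tendsto (fun l => d l * c) atTop (𝓝 c) ∧
      Tendsto (fun l => c * d l) atTop (𝓝 c) := by
  letI := CStarAlgebra.spectralOrder B
  haveI := CStarAlgebra.spectralOrderedRing B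
  have hc0 : 0 ≤ c := posElem_iff.1 hc
  have hsa : IsSelfAdjoint c := IsSelfAdjoint.of_nonneg hc0
  have hsp : ∀ t ∈ spectrum ℝ c, 0 ≤ t := fun t ht => spectrum_nonneg_of_nonneg hc0 ht
  let g : ℕ → ℝ → ℝ := fun l t => (l + 1) / (1 + (l + 1) * |t|)
  have hp : ∀ (l : ℕ) (t : ℝ), 0 < 1 + ((l : ℝ) + 1) * |t| := fun l t => by positivity
  have hg : ∀ l, Continuous (g l) := fun l =>
    Continuous.div (by fun_prop) (by fun_prop) fun t => (hp l t).ne'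
  have e1 : ∀ l, c * cfc (g l) c = cfc (fun t => t * g l t) c := fun l => by
    have := hg l
    rw [cfc_mul (fun t => t) (g l) c (by fun_prop) (by fun_prop), cfc_id' ℝ c]
  have e2 : ∀ l, cfc (g l) c * c = cfc (fun t => t * g l t) c := fun l => by
    have := hg l
    rw [cfc_congr (g := fun t => g l t * t) (fun t _ => mul_comm _ _),
      cfc_mul (g l) (fun t => t) c (by fun_prop) (by fun_prop), cfc_id' ℝ c]
  have hle : ∀ (l : ℕ) (t : ℝ), 0 ≤ t → t * g l t ≤ 1 := fun l t ht => by
    simp only [g]; rw [abs_of_nonneg ht, mul_div_assoc', div_le_one (by positivity)]; nlinarith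
  have hnn : ∀ (l : ℕ) (t : ℝ), 0 ≤ t → 0 ≤ t * g l t := fun l t ht => by
    have := hp l t
    simp only [g]; positivity
  have hb : ∀ l : ℕ, ‖c * cfc (g l) c * c - c‖ ≤ 1 / ((l : ℝ) + 1) := fun l => by
    have := hg l
    have e3 : c * cfc (g l) c * c - c = cfc (fun t => t * g l t * t - t) c := by
      rw [e1, cfc_sub (fun t => t * g l t * t) (fun t => t) c (by fun_prop) (by fun_prop),
        cfc_mul (fun t => t * g l t) (fun t => t) c (by fun_prop) (by fun_prop), cfc_id' ℝ c]
    rw [e3]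
    refine norm_cfc_le (by positivity) fun t ht => ?_
    have ht0 := hsp t ht
    have h1 : t * g l t * t - t = - (t / (1 + (l + 1) * t)) := by
      simp only [g]; rw [abs_of_nonneg ht0]; have := hp l t; rw [abs_of_nonneg ht0] at this
      field_simp; ring
    rw [h1, norm_neg, Real.norm_eq_abs, abs_of_nonneg (by positivity),
      div_le_div_iff₀ (by positivity) (by positivity)]
    nlinarith
  have hcomm : ∀ l, c * (c * cfc (g l) c) = c * cfc (g l) c * c := fun l => by
    rw [mul_assoc, e2, e1]
  have hlim : Tendsto (fun l => c * cfc (g l) c * c) atTop (𝓝 c) :=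
    tendsto_iff_norm_sub_tendsto_zero.2 (squeeze_zero (fun _ => norm_nonneg _) hb
      tendsto_one_div_add_atTop_nhds_zero_nat)
  refine ⟨fun l => c * cfc (g l) c, fun l => cfc (g l) c, fun l => ?_, fun l => ?_, fun l => rfl,
    fun l => (e1 l).trans (e2 l).symm, hlim, ?_⟩
  · change IsPosElem (c * cfc (g l) c)
    rw [posElem_iff, e1]
    exact cfc_nonneg fun t ht => hnn l t (hsp t ht)
  · change ‖c * cfc (g l) c‖ ≤ 1
    rw [e1]
    refine norm_cfc_le zero_le_one fun t ht => ?_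
    rw [Real.norm_eq_abs, abs_of_nonneg (hnn l t (hsp t ht))]
    exact hle l t (hsp t ht)
  · simpa only [hcomm] using hlim

theorem closed_tendsto {B : Type*} [NormedRing B] (T : ℕ → B → B)
    (hT : ∀ l x y, ‖T l x - T l y‖ ≤ ‖x - y‖) :
    IsClosed {x | Tendsto (fun l => T l x) atTop (𝓝 x)} := by
  refine isClosed_of_closure_subset fun x hx => ?_
  rw [Set.mem_setOf_eq, Metric.tendsto_atTop]
  intro ε hε
  obtain ⟨y, hy, hxy⟩ := Metric.mem_closure_iff.1 hx (ε / 3) (by positivity)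
  obtain ⟨n, hn⟩ := (Metric.tendsto_atTop.1 hy) (ε / 3) (by positivity)
  refine ⟨n, fun l hl => ?_⟩
  have h1 := hn l hl
  rw [dist_eq_norm] at *
  have h2 := hT l x y
  have e : T l x - x = (T l x - T l y) + (T l y - y) - (x - y) := by abel
  rw [e]
  have := norm_sub_le ((T l x - T l y) + (T l y - y)) (x - y)
  have := norm_add_le (T l x - T l y) (T l y - y)
  linarith


/-- hereditary subalgebra generated by an approximate unit -/
def HH {B : Type*} [CStarAlgebra B] (d : ℕ → B) (x : B) : Prop :=
  Tendsto (fun l => d l * x) atTop (𝓝 x) ∧ Tendsto (fun l => x * d l) atTop (𝓝 x)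

section
variable {B : Type*} [CStarAlgebra B] {d : ℕ → B}

theorem HH_closed (hd1 : ∀ l, ‖d l‖ ≤ 1) : IsClosed {x | HH d x} := by
  refine IsClosed.inter (closed_tendsto (fun l x => d l * x) fun l x y => ?_)
    (closed_tendsto (fun l x => x * d l) fun l x y => ?_)
  · rw [← mul_sub]
    exact (norm_mul_le _ _).trans (mul_le_of_le_one_left (norm_nonneg _) (hd1 l))
  · rw [← sub_mul]
    exact (norm_mul_le _ _).trans (mul_le_of_le_one_right (norm_nonneg _) (hd1 l))

theorem HH_zero : HH d 0 := by constructor <;> simp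

theorem HH_add {x y : B} (hx : HH d x) (hy : HH d y) : HH d (x + y) := by
  refine ⟨?_, ?_⟩
  · simpa only [mul_add] using hx.1.add hy.1
  · simpa only [add_mul] using hx.2.add hy.2

theorem HH_smul {x : B} (hx : HH d x) (t : ℂ) : HH d (t • x) := by
  refine ⟨?_, ?_⟩
  · simpa only [mul_smul_comm] using hx.1.const_smul t
  · simpa only [smul_mul_assoc] using hx.2.const_smul t

theorem HH_mid {x y : B} (hx : HH d x) (hy : HH d y) (z : B) : HH d (x * z * y) := by
  refine ⟨?_, ?_⟩
  · simpa only [mul_assoc] using hx.1.mul_const (z * y)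
  · simpa only [mul_assoc] using hy.2.const_mul (x * z)

theorem HH_mul {x y : B} (hx : HH d x) (hy : HH d y) : HH d (x * y) := by
  simpa using HH_mid hx hy 1

theorem HH_star (hds : ∀ l, star (d l) = d l) {x : B} (hx : HH d x) : HH d (star x) := by
  refine ⟨?_, ?_⟩
  · simpa only [star_mul, hds] using hx.2.star
  · simpa only [star_mul, hds] using hx.1.star

/-- the unitization inside `B × ℂ` -/
def NN (d : ℕ → B) (hds : ∀ l, star (d l) = d l) : StarSubalgebra ℂ (B × ℂ) where
  carrier := {w | HH d (w.1 - w.2 • 1)}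
  mul_mem' {x y} hx hy := by
    simp only [Set.mem_setOf_eq] at *
    have e : (x * y).1 - (x * y).2 • 1 = (x.1 - x.2 • 1) * (y.1 - y.2 • 1) +
        (x.2 • (y.1 - y.2 • 1) + y.2 • (x.1 - x.2 • 1)) := by
      simp only [Prod.fst_mul, Prod.snd_mul, mul_sub, sub_mul, smul_sub, mul_smul_comm,
        smul_mul_assoc, mul_one, one_mul, smul_smul, mul_comm y.2 x.2]
      abel
    rw [e]
    exact HH_add (HH_mul hx hy) (HH_add (HH_smul hy _) (HH_smul hx _))
  add_mem' {x y} hx hy := by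
    simp only [Set.mem_setOf_eq] at *
    have e : (x + y).1 - (x + y).2 • 1 = (x.1 - x.2 • 1) + (y.1 - y.2 • 1) := by
      simp only [Prod.fst_add, Prod.snd_add, add_smul]; abel
    rw [e]; exact HH_add hx hy
  algebraMap_mem' r := by
    simp only [Set.mem_setOf_eq, Prod.algebraMap_apply, Algebra.algebraMap_eq_smul_one]
    simp [HH_zero]
  star_mem' {x} hx := by
    simp only [Set.mem_setOf_eq] at *
    have e : (star x).1 - (star x).2 • 1 = star (x.1 - x.2 • 1) := by simp
    rw [e]; exact HH_star hds hx

theorem mem_NN {hds : ∀ l, star (d l) = d l} {w : B × ℂ} : w ∈ NN d hds ↔ HH d (w.1 - w.2 • 1) :=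
  Iff.rfl

theorem NN_closed (hds : ∀ l, star (d l) = d l) (hd1 : ∀ l, ‖d l‖ ≤ 1) :
    IsClosed (NN d hds : Set (B × ℂ)) :=
  (HH_closed hd1).preimage (f := fun w : B × ℂ => w.1 - w.2 • (1 : B)) (by fun_prop)

end

end unitize


section unitize2
variable {B : Type*} [CStarAlgebra B] {d : ℕ → B}

/-- the one-dimensional algebra -/
def FD1 : FDx := ⟨Unit, fun _ => Unit⟩

def fdval (y : FD1.alg) : ℂ := y () () ()

theorem fdval_mul (x y : FD1.alg) : fdval (x * y) = fdval x * fdval y := by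
  have h : fdval (x * y) = ∑ k : Unit, x () () k * y () k () := rfl
  rw [h, Fintype.sum_unique]
  rfl

theorem fd1_ext {x y : FD1.alg} (h : fdval x = fdval y) : x = y := by
  funext i
  ext a b
  exact h

theorem colorApprox_unitize {N : Type*} [CStarAlgebra N] (j : N →⋆ₐ[ℂ] B × ℂ)
    (hj : Function.Injective j) (hr : Set.range j = {w | HH d (w.1 - w.2 • 1)})
    (hdp : ∀ l, IsPosElem (d l)) (hd1 : ∀ l, ‖d l‖ ≤ 1) (hdd : ∀ l, HH d (d l))
    {κ : Type} [Fintype κ] (hB : ColorApprox κ B) : ColorApprox (Option κ) N := by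
  intro S ε hε
  classical
  obtain ⟨R, hR, hSR⟩ := bound_finset (S.image fun w => (j w).1)
  obtain ⟨c, hc, H⟩ := cut_approx' hB (ε := ε / 4) (R := R) (by positivity) hR
  have hN : ∀ w : N, HH d ((j w).1 - (j w).2 • 1) := fun w => by
    have : j w ∈ Set.range j := ⟨w, rfl⟩
    rw [hr] at this; exact this
  have hlim : ∀ x, HH d x → Tendsto (fun l => ‖d l * x * d l - x‖) atTop (𝓝 0) := fun x hx => by
    refine squeeze_zero (fun _ => norm_nonneg _) (g := fun l => ‖d l * x - x‖ + ‖x * d l - x‖)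
      (fun l => ?_) ?_
    · have e : d l * x * d l - x = (d l * x - x) * d l + (x * d l - x) := by noncomm_ring
      rw [e]
      refine (norm_add_le _ _).trans (add_le_add_left ?_ _)
      exact (norm_mul_le _ _).trans (mul_le_of_le_one_right (norm_nonneg _) (hd1 l))
    · simpa using (tendsto_iff_norm_sub_tendsto_zero.1 hx.1).add
        (tendsto_iff_norm_sub_tendsto_zero.1 hx.2)
  have hm : ∀ᶠ l in atTop, ∀ w ∈ S, ‖d l * ((j w).1 - (j w).2 • 1) * d l - ((j w).1 - (j w).2 • 1)‖
      < ε / 4 := by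
    rw [Filter.eventually_all_finset]
    intro w _
    exact (hlim _ (hN w)).eventually_lt_const (by positivity)
  obtain ⟨m, hm⟩ := hm.exists
  have hl : ∀ᶠ l in atTop, ‖d l * d m - d m‖ < c :=
    (tendsto_iff_norm_sub_tendsto_zero.1 (hdd m).1).eventually_lt_const hc
  obtain ⟨l, hl⟩ := hl.exists
  obtain ⟨F, ψ, φ, a1, a2, a3, a4, a5⟩ := H (d m) (d l) (hdp m) (hd1 m) (hdp l) (hd1 l) (by
    have e : (1 - d l) * d m = -(d l * d m - d m) := by noncomm_ring
    rw [e, norm_neg]; exact hl.le) (S.image fun w => (j w).1)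
  have hds : star (d m) = d m := posElem_star (hdp m)
  have hdm2 : IsPosElem (d m * d m) := ⟨d m, by rw [hds]⟩
  have hdm2n : ‖d m * d m‖ ≤ 1 :=
    (norm_mul_le _ _).trans (mul_le_one₀ (hd1 m) (norm_nonneg _) (hd1 m))
  have hone : IsPosElem (1 - d m * d m) := posElem_one_sub hdm2 hdm2n
  let F' : Option κ → FDx := fun o => match o with
    | none => FD1
    | some i => F i
  let ψ0 : N →ₗ[ℂ] FD1.alg :=
    { toFun := fun w => fun _ => Matrix.of fun _ _ => (j w).2
      map_add' := fun x y => fd1_ext (by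
        change (j (x + y)).2 = (j x).2 + (j y).2
        rw [map_add]; rfl)
      map_smul' := fun x y => fd1_ext (by
        change (j (x • y)).2 = x • (j y).2
        rw [map_smul]; rfl) }
  have hψ0 : ∀ w, fdval (ψ0 w) = (j w).2 := fun w => rfl
  let Φ0 : FD1.alg →ₗ[ℂ] B × ℂ :=
    { toFun := fun y => fdval y • (1 - d m * d m, 1)
      map_add' := fun x y => by rw [← add_smul]; rfl
      map_smul' := fun x y => by rw [RingHom.id_apply, smul_smul]; rfl }
  have hΦ0 : ∀ y, Φ0 y = fdval y • (1 - d m * d m, 1) := fun y => rfl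
  let ψ' : ∀ o, N →ₗ[ℂ] (F' o).alg := fun o => match o with
    | none => ψ0
    | some i => ψ i ∘ₗ ((LinearMap.fst ℂ B ℂ) ∘ₗ (j.toAlgHom.toLinearMap))
  let Φ' : ∀ o, (F' o).alg →ₗ[ℂ] B × ℂ := fun o => match o with
    | none => Φ0
    | some i => (LinearMap.inl ℂ B ℂ) ∘ₗ φ i
  have hCψ : ∀ o, CPC (ψ' o) := fun o => match o with
    | none => cpc_hom (T := ψ0) (fun x y => fd1_ext (by rw [fdval_mul]; simp [hψ0]))
        (fun x => fd1_ext (by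
          change (j (star x)).2 = star (j x).2
          rw [map_star]; rfl))
    | some i => cpc_hom_comp (a1 i)
        (by change (j 1).1 = 1; rw [map_one]; rfl)
        (fun x y => by change (j (x * y)).1 = (j x).1 * (j y).1; rw [map_mul]; rfl)
        (fun x => by change (j (star x)).1 = star (j x).1; rw [map_star]; rfl)
  have hCφ : ∀ o, CPC (Φ' o) := fun o => match o with
    | none => by
        obtain ⟨t, ht⟩ := hone
        let T : FD1.alg →ₗ[ℂ] B × ℂ :=
          { toFun := fun y => fdval y • 1
            map_add' := fun x y => by rw [← add_smul]; rfl
            map_smul' := fun x y => by rw [RingHom.id_apply, smul_smul]; rfl }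
        have hT : IsCompletelyPositive T := cp_hom (fun x y => by
          change fdval (x * y) • (1 : B × ℂ) = (fdval x • (1 : B × ℂ)) * (fdval y • (1 : B × ℂ))
          rw [fdval_mul, smul_mul_smul_comm, one_mul]) (fun x => by
          change fdval (star x) • (1 : B × ℂ) = star (fdval x • (1 : B × ℂ))
          rw [star_smul, star_one]; rfl)
        refine cpc_of_norm (cp_conj hT (star t, 1) (T' := Φ0) fun x => ?_) ?_
        · change fdval x • (1 - d m * d m, (1 : ℂ)) = (star t, (1 : ℂ)) * (fdval x • (1 : B × ℂ)) *
            star (star t, (1 : ℂ))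
          rw [mul_smul_comm, smul_mul_assoc, ht]
          congr 1
          ext <;> simp
        · change ‖(1 : ℂ) • (1 - d m * d m, (1 : ℂ))‖ ≤ 1
          rw [one_smul, Prod.norm_def]
          refine max_le ?_ (by simp)
          exact posElem_norm_le_one ⟨t, ht⟩ (by rw [sub_sub_cancel]; exact hdm2)
    | some i => cpc_comp (a2 i) (cpc_hom (by simp) (fun x => by ext <;> simp))
  have hOZ : ∀ o, OZ (Φ' o) := fun o => match o with
    | none => fun e f hef hfe => by
        change (fdval e • (1 - d m * d m, (1 : ℂ))) * (fdval f • (1 - d m * d m, (1 : ℂ))) = 0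
        rw [smul_mul_smul_comm, ← fdval_mul, hef]
        change (0 : ℂ) • _ = 0
        rw [zero_smul]
    | some i => fun e f hef hfe => by
        change (φ i e, (0 : ℂ)) * (φ i f, (0 : ℂ)) = 0
        rw [Prod.mk_mul_mk, a3 i e f hef hfe]; simp
  have hφHH : ∀ i x, HH d (φ i x) := fun i x => by
    obtain ⟨z, hz⟩ := a4 i x
    exact (HH_closed hd1).mem_of_tendsto hz (Eventually.of_forall fun n =>
      HH_mid (hdd l) (hdd l) (z n))
  have hrange : ∀ o x, Φ' o x ∈ Set.range (j : N →⋆ₙₐ[ℂ] B × ℂ) := fun o x => by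
    change Φ' o x ∈ Set.range j
    rw [hr]
    match o, x with
    | none, x =>
      change HH d ((fdval x • (1 - d m * d m)) - (fdval x • (1 : ℂ)) • 1)
      have e : (fdval x • (1 - d m * d m)) - (fdval x • (1 : ℂ)) • 1
          = (-fdval x) • (d m * d m) := by
        rw [smul_eq_mul, mul_one, smul_sub, neg_smul]; abel
      rw [e]
      exact HH_smul (HH_mul (hdd m) (hdd m)) _
    | some i, x =>
      change HH d (φ i x - (0 : ℂ) • 1)
      rw [zero_smul, sub_zero]; exact hφHH i x
  have hlift := fun o => lift_map (j : N →⋆ₙₐ[ℂ] B × ℂ) hj (hCφ o) (hOZ o) (hrange o)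
  choose φ' b1 b2 b3 using hlift
  refine ⟨F', ψ', φ', hCψ, b1, b2, fun w hw => ?_⟩
  have hb3 : ∀ o x, j (φ' o x) = Φ' o x := b3
  have hnorm : ‖∑ o, φ' o (ψ' o w) - w‖ = ‖j (∑ o, φ' o (ψ' o w) - w)‖ :=
    (NonUnitalStarAlgHom.norm_map (j : N →⋆ₙₐ[ℂ] B × ℂ) hj _).symm
  rw [hnorm, map_sub, map_sum, Fintype.sum_option]
  simp only [hb3]
  change ‖fdval (ψ0 w) • (1 - d m * d m, (1 : ℂ)) + ∑ i, ((φ i (ψ i (j w).1)), (0 : ℂ)) - j w‖ < ε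
  rw [hψ0]
  have e : (j w).2 • (1 - d m * d m, (1 : ℂ)) + ∑ i, ((φ i (ψ i (j w).1)), (0 : ℂ)) - j w =
     ((∑ i, (φ i (ψ i (j w).1)) - d m * (j w).1 * d m) +
       (d m * ((j w).1 - (j w).2 • 1) * d m - ((j w).1 - (j w).2 • 1)), 0) := by
    ext
    · simp only [Prod.fst_sub, Prod.fst_add, Prod.smul_fst, Prod.fst_sum, mul_sub, sub_mul,
        smul_sub, mul_smul_comm, smul_mul_assoc, mul_one]
      abel
    · simp [Prod.snd_sum]
  rw [e, Prod.norm_def]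
  have h1 := a5 _ (Finset.mem_image_of_mem (fun w => (j w).1) hw)
    (hSR _ (Finset.mem_image_of_mem _ hw))
  have h2 := hm w hw
  refine max_lt ?_ (by simpa using hε)
  refine (norm_add_le _ _).trans_lt ?_
  linarith

theorem unitize_thm {B : Type} [CStarAlgebra B] [TopologicalSpace.SeparableSpace B]
    {κ : Type} [Fintype κ] (hB : ColorApprox κ B) (c : B) (hc : IsPosElem c) :
    ∃ N : CStarAlg, lnucClass N ∧ ∃ α : N.carrier →⋆ₐ[ℂ] B × ℂ,
      (∀ w, (∃ z : ℕ → B, Tendsto (fun n => c * z n) atTop (𝓝 ((α w).1 - (α w).2 • 1))) ∧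
        ∃ z : ℕ → B, Tendsto (fun n => z n * c) atTop (𝓝 ((α w).1 - (α w).2 • 1))) ∧
      ∀ z, ∃ w, α w = (c * z * c, 0) := by
  obtain ⟨d, z, hdp, hd1, hz1, hz2, ht1, ht2⟩ := approx_unit c hc
  have hds : ∀ l, star (d l) = d l := fun l => posElem_star (hdp l)
  have hcH : HH d c := ⟨ht1, ht2⟩
  have hdd : ∀ l, HH d (d l) := fun l => by
    refine ⟨?_, ?_⟩
    · have := ht1.mul_const (z l)
      simpa only [mul_assoc, ← hz1] using this
    · have := ht2.const_mul (z l)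
      simpa only [← mul_assoc, ← hz2] using this
  haveI : IsClosed (NN d hds : Set (B × ℂ)) := NN_closed hds hd1
  letI : CStarAlgebra (NN d hds) := StarSubalgebra.cstarAlgebra _
  let α : (NN d hds) →⋆ₐ[ℂ] B × ℂ := (NN d hds).subtype
  have hα : Function.Injective α := Subtype.val_injective
  have hr : Set.range α = {w | HH d (w.1 - w.2 • 1)} := by
    ext w
    constructor
    · rintro ⟨w, rfl⟩; exact w.2
    · intro hw; exact ⟨⟨w, hw⟩, rfl⟩
  refine ⟨⟨NN d hds⟩, ⟨sep_of_inj (α : (NN d hds) →⋆ₙₐ[ℂ] B × ℂ) hα, _,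
    nd_of_colorApprox (colorApprox_unitize α hα hr hdp hd1 hdd hB)⟩, α, fun w => ?_, fun y => ?_⟩
  · have hw : HH d ((α w).1 - (α w).2 • 1) := w.2
    generalize (α w).1 - (α w).2 • 1 = x at hw ⊢
    refine ⟨⟨fun n => z n * x, ?_⟩, ⟨fun n => x * z n, ?_⟩⟩
    · simpa only [← mul_assoc, ← hz1] using hw.1
    · simpa only [mul_assoc, ← hz2] using hw.2
  · refine ⟨⟨(c * y * c, 0), ?_⟩, rfl⟩
    rw [mem_NN, zero_smul, sub_zero]
    exact HH_mid hcH hcH y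

end unitize2


section gram

theorem posElem_zero_of {D : Type*} [CStarAlgebra D] {a : D} (h1 : IsPosElem a) (h2 : IsPosElem (-a)) :
    a = 0 := by
  have := norm_le_of_pos (b := 0) h1 (by rwa [zero_sub])
  simpa using this

theorem sum_star_zero {D : Type*} [CStarAlgebra D] {κ : Type*} [Fintype κ] [DecidableEq κ] (f : κ → D)
    (h : ∑ i, star (f i) * f i = 0) (i : κ) : f i = 0 := by
  have h1 : IsPosElem (∑ j ∈ Finset.univ.erase i, star (f j) * f j) :=
    posElem_sum _ _ fun j _ => ⟨f j, rfl⟩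
  have h2 : ‖star (f i) * f i‖ ≤ ‖∑ i, star (f i) * f i‖ := norm_le_of_pos ⟨_, rfl⟩ (by
    rw [← Finset.add_sum_erase _ _ (Finset.mem_univ i), add_sub_cancel_left]; exact h1)
  rw [h, norm_zero, CStarRing.norm_star_mul_self] at h2
  have := norm_nonneg (f i)
  exact norm_eq_zero.1 (by nlinarith)

theorem neg_part_lemma {M : Type*} [CStarAlgebra M] (x : M) (hsa : star x = x) :
    ∃ n : M, star n = n ∧ star n * x * n = - (n * n * n) ∧ IsPosElem (n * n * n) ∧
      (n * n * n = 0 → IsPosElem x) := by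
  letI := CStarAlgebra.spectralOrder M
  haveI := CStarAlgebra.spectralOrderedRing M
  have hsa : IsSelfAdjoint x := hsa
  have e1 : x = x⁺ - x⁻ := (CFC.posPart_sub_negPart x hsa).symm
  have e2 : x⁻ * x * x⁻ = - (x⁻ * x⁻ * x⁻) := by
    have : x⁻ * x = - (x⁻ * x⁻) := by
      nth_rw 2 [← CFC.posPart_sub_negPart x hsa]
      rw [mul_sub, CFC.negPart_mul_posPart, zero_sub]
    rw [this, neg_mul]
  have hn : 0 ≤ x⁻ := CFC.negPart_nonneg x
  have hns : star x⁻ = x⁻ := (IsSelfAdjoint.of_nonneg hn)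
  have h3 : 0 ≤ x⁻ * x⁻ * x⁻ := by
    have := star_left_conjugate_nonneg hn x⁻
    rwa [hns] at this
  refine ⟨x⁻, hns, by rw [hns, e2], posElem_iff.2 h3, fun h7 => ?_⟩
  have h8 : x⁻ * x⁻ = 0 := by
    have : star (x⁻ * x⁻) * (x⁻ * x⁻) = 0 := by
      rw [star_mul, hns, ← mul_assoc, h7, zero_mul]
    exact CStarRing.star_mul_self_eq_zero_iff _ |>.1 this
  have h9 : x⁻ = 0 := by
    have : star (x⁻) * (x⁻) = 0 := by rw [hns, h8]
    exact CStarRing.star_mul_self_eq_zero_iff _ |>.1 this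
  rw [posElem_iff, e1, h9, sub_zero]
  exact CFC.posPart_nonneg x

theorem gram_pos {D : Type*} [CStarAlgebra D] {k : ℕ} (G : Matrix (Fin k) (Fin k) D)
    (hs : ∀ i j, star (G i j) = G j i)
    (hp : ∀ c : Fin k → D, IsPosElem (∑ i, ∑ j, star (c i) * G i j * c j)) :
    ∃ Y : Fin k → Fin k → D, ∀ i j, G i j = ∑ l, star (Y l i) * Y l j := by
  letI := CStarAlgebra.spectralOrder D
  haveI := CStarAlgebra.spectralOrderedRing D
  obtain ⟨x, hx⟩ : ∃ x : CStarMatrix (Fin k) (Fin k) D, ∀ i j, x i j = G i j :=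
    ⟨CStarMatrix.ofMatrix G, fun _ _ => rfl⟩
  have hsa : star x = x := by
    ext i j
    rw [CStarMatrix.star_apply, hx, hx, hs]
  obtain ⟨n, hns, e2, ⟨Z, hZ⟩, hfin⟩ := neg_part_lemma x hsa
  have h4 : ∀ j, ∑ i, star (Z i j) * Z i j = 0 := fun j => by
    have h5 : (n * n * n) j j = ∑ i, star (Z i j) * Z i j := by
      rw [hZ, CStarMatrix.mul_apply]; rfl
    have h6 : (star n * x * n) j j = ∑ i, ∑ l, star (n i j) * G i l * n l j := by
      simp only [CStarMatrix.mul_apply, Finset.sum_mul, hx, CStarMatrix.star_apply]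
      rw [Finset.sum_comm]
    rw [e2, CStarMatrix.neg_apply, h5] at h6
    exact posElem_zero_of (posElem_sum _ _ fun i _ => ⟨_, rfl⟩) (by rw [h6]; exact hp _)
  have hZ0 : Z = 0 := by
    ext i j
    exact sum_star_zero (fun i => Z i j) (h4 j) i
  obtain ⟨Y, hY⟩ := hfin (by rw [hZ, hZ0, mul_zero])
  refine ⟨fun l i => Y l i, fun i j => ?_⟩
  rw [← hx, hY, CStarMatrix.mul_apply]; rfl

end gram

section condexp
variable [CStarAlgebra P] [CStarAlgebra A] {ι : P →⋆ₐ[ℂ] A} {E : A →ₗ[ℂ] P}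

theorem ce_left (hE : IsCondExpect ι E) (p : P) (x : A) : E (ι p * x) = p * E x := by
  simpa using hE.bimodule p 1 x

theorem ce_right (hE : IsCondExpect ι E) (x : A) (p : P) : E (x * ι p) = E x * p := by
  simpa using hE.bimodule 1 p x

theorem ce_one (hE : IsCondExpect ι E) : E 1 = 1 := by simpa using hE.restricts 1

theorem ce_star (hE : IsCondExpect ι E) (x : A) : E (star x) = star (E x) := by
  have hs : ∀ y, star (E (star y * y)) = E (star y * y) := fun y => posElem_star (hE.pos y)
  have h1 : star (E (star x) + E x) = E (star x) + E x := by
    have e : E (star x) + E x = E (star (x + 1) * (x + 1)) - E (star x * x) -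
        E (star (1 : A) * 1) := by
      rw [← map_add, ← map_sub, ← map_sub]; congr 1; simp only [star_add, star_one]; noncomm_ring
    rw [e, star_sub, star_sub, hs, hs, hs]
  have h2 : star (Complex.I • (E (star x) - E x)) = Complex.I • (E (star x) - E x) := by
    have e : Complex.I • (E (star x) - E x) =
        E (star (x + Complex.I • 1) * (x + Complex.I • 1)) - E (star x * x) -
        E (star (1 : A) * 1) := by
      rw [← map_sub, ← map_smul, ← map_sub, ← map_sub]; congr 1
      simp only [star_add, star_one, star_smul, add_mul, mul_add, smul_mul_assoc, mul_smul_comm,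
        one_mul, mul_one, smul_smul, smul_sub, smul_add, smul_neg, Complex.star_def, Complex.conj_I, neg_smul, neg_mul,
        Complex.I_mul_I, mul_neg, neg_neg, one_smul]
      abel
    rw [e, star_sub, star_sub, hs, hs, hs]
  rw [star_smul, Complex.star_def, Complex.conj_I, neg_smul, ← smul_neg] at h2
  have h3 := smul_right_injective P Complex.I_ne_zero h2
  simp only [star_sub, star_add, neg_sub] at h1 h3
  have h4 : (2 : ℂ) • star (E x) = (2 : ℂ) • E (star x) := by
    rw [two_smul, two_smul]
    calc star (E x) + star (E x) = (star (E (star x)) + star (E x)) +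
          (star (E x) - star (E (star x))) := by abel
      _ = _ := by rw [h1, h3]; abel
  exact (smul_right_injective P two_ne_zero h4).symm

theorem ce_pos (hE : IsCondExpect ι E) {x : A} (h : IsPosElem x) : IsPosElem (E x) := by
  obtain ⟨y, rfl⟩ := h; exact hE.pos y

theorem ce_norm (hE : IsCondExpect ι E) (x : A) : ‖E x‖ ≤ ‖x‖ := by
  have h1 : IsPosElem (E (star x * x) - star (E x) * E x) := by
    have := hE.pos (x - ι (E x))
    have e : E (star (x - ι (E x)) * (x - ι (E x))) = E (star x * x) - star (E x) * E x := by
      rw [star_sub, ← map_star, sub_mul, mul_sub, mul_sub, map_sub, map_sub, map_sub, ce_left hE,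
        ce_right hE, ce_left hE, hE.restricts, ce_star hE]
      abel
    rwa [e] at this
  have h1' := norm_le_of_pos ⟨_, rfl⟩ h1
  have h2 : ‖E (star x * x)‖ ≤ ‖x‖ ^ 2 := by
    have h3 : IsPosElem (((‖x‖ ^ 2 : ℝ) : ℂ) • (1 : A) - star x * x) :=
      posElem_norm_sub (by simp) (by rw [CStarRing.norm_star_mul_self, sq])
    have h4 := ce_pos hE h3
    rw [map_sub, map_smul, ce_one hE] at h4
    refine (norm_le_of_pos (hE.pos x) h4).trans ?_
    rw [norm_smul]
    have := norm_one_le_one (D := P)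
    simp only [Complex.norm_real, Real.norm_eq_abs, abs_pow, abs_norm]
    nlinarith [sq_nonneg ‖x‖]
  rw [CStarRing.norm_star_mul_self] at h1'
  nlinarith [norm_nonneg x, norm_nonneg (E x)]

theorem ind_central (hE : IsCondExpect ι E) {m : ℕ} {u v : Fin m → A} (hqb : IsQuasiBasis ι E u v) (a : A) :
    (∑ i, u i * v i) * a = a * ∑ i, u i * v i := by
  have h1 : ∀ i, v i * a = ∑ j, ι (E (v i * a * u j)) * v j := fun i => (hqb (v i * a)).2
  have h2 : ∀ j, a * u j = ∑ i, u i * ι (E (v i * a * u j)) := fun j => by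
    have := (hqb (a * u j)).1
    simpa only [mul_assoc] using this
  rw [Finset.sum_mul, Finset.mul_sum]
  calc ∑ i, u i * v i * a = ∑ i, ∑ j, u i * (ι (E (v i * a * u j)) * v j) := by
        refine Finset.sum_congr rfl fun i _ => ?_
        rw [mul_assoc, ← Finset.mul_sum, ← h1]
    _ = ∑ j, ∑ i, u i * (ι (E (v i * a * u j)) * v j) := Finset.sum_comm
    _ = _ := by
        refine Finset.sum_congr rfl fun j _ => ?_
        rw [← mul_assoc, h2 j, Finset.sum_mul]
        simp only [mul_assoc]

/-- symmetric quasi-basis -/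
theorem sym_qb (hE : IsCondExpect ι E) {m : ℕ} {u v : Fin m → A} (hqb : IsQuasiBasis ι E u v) :
    ∃ r : Fin m → A, (∀ a, a = ∑ k, r k * ι (E (star (r k) * a))) ∧
      ∑ i, u i * v i = ∑ k, r k * star (r k) := by
  obtain ⟨Y, hY⟩ := gram_pos (Matrix.of fun i j => E (v i * star (v j))) (fun i j => by
    simp only [Matrix.of_apply]
    rw [← ce_star hE, star_mul, star_star]) (fun c => by
    have := hE.pos (∑ j, star (v j) * ι (c j))
    have e : E (star (∑ j, star (v j) * ι (c j)) * ∑ j, star (v j) * ι (c j)) =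
        ∑ i, ∑ j, star (c i) * E (v i * star (v j)) * c j := by
      rw [star_sum, Finset.sum_mul, map_sum]
      refine Finset.sum_congr rfl fun i _ => ?_
      rw [Finset.mul_sum, map_sum]
      refine Finset.sum_congr rfl fun j _ => ?_
      rw [← hE.bimodule, star_mul, star_star, map_star]
      simp only [mul_assoc]
    rwa [e] at this)
  simp only [Matrix.of_apply] at hY
  have hst : ∀ a, a = ∑ j, star (v j) * ι (E (star (u j) * a)) := fun a => by
    have := congrArg star (hqb (star a)).2
    rw [star_star, star_sum] at this
    refine this.trans (Finset.sum_congr rfl fun j _ => ?_)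
    rw [star_mul, ← map_star, ← ce_star hE, star_mul, star_star]
  have key : ∀ p : Fin m → A, ∑ k, (∑ i, u i * ι (star (Y k i))) * (∑ j, ι (Y k j) * p j) =
      ∑ i, u i * ∑ j, ι (E (v i * star (v j))) * p j := fun p => by
    have e : ∀ k, (∑ i, u i * ι (star (Y k i))) * (∑ j, ι (Y k j) * p j) =
        ∑ i, ∑ j, u i * (ι (star (Y k i) * Y k j) * p j) := fun k => by
      rw [Finset.sum_mul]
      refine Finset.sum_congr rfl fun i _ => ?_
      rw [Finset.mul_sum]
      refine Finset.sum_congr rfl fun j _ => ?_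
      rw [map_mul]; simp only [mul_assoc]
    simp only [e]
    rw [Finset.sum_comm]
    refine Finset.sum_congr rfl fun i _ => ?_
    rw [Finset.sum_comm, Finset.mul_sum]
    refine Finset.sum_congr rfl fun j _ => ?_
    rw [← Finset.mul_sum, ← Finset.sum_mul, ← map_sum, ← hY]
  have hrs : ∀ k, star (∑ i, u i * ι (star (Y k i))) = ∑ j, ι (Y k j) * star (u j) := fun k => by
    rw [star_sum]
    refine Finset.sum_congr rfl fun i _ => ?_
    rw [star_mul, ← map_star, star_star]
  refine ⟨fun k => ∑ i, u i * ι (star (Y k i)), fun a => ?_, ?_⟩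
  · simp only [hrs]
    have e : ∀ k, ι (E ((∑ j, ι (Y k j) * star (u j)) * a)) =
        ∑ j, ι (Y k j) * ι (E (star (u j) * a)) := fun k => by
      rw [Finset.sum_mul, map_sum, map_sum]
      refine Finset.sum_congr rfl fun j _ => ?_
      rw [mul_assoc, ce_left hE, map_mul]
    simp only [e]
    rw [key]
    conv_lhs => rw [(hqb a).1]
    refine Finset.sum_congr rfl fun i _ => ?_
    conv_lhs => rw [hst a]
    rw [Finset.mul_sum, map_sum, map_sum]
    congr 1
    refine Finset.sum_congr rfl fun j _ => ?_
    rw [← mul_assoc, ce_right hE, map_mul]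
  · simp only [hrs]
    rw [key]
    refine Finset.sum_congr rfl fun i _ => ?_
    congr 1
    have h3 := congrArg star (hqb (star (v i))).1
    rw [star_star, star_sum] at h3
    conv_lhs => rw [h3]
    refine Finset.sum_congr rfl fun j _ => ?_
    rw [star_mul, ← map_star, ← ce_star hE, star_mul, star_star]

end condexp


section rok
variable [CStarAlgebra P] [CStarAlgebra A] {ι : P →⋆ₐ[ℂ] A} {E : A →ₗ[ℂ] P}

theorem proj_norm {D : Type*} [CStarAlgebra D] {q : D} (hqq : q * q = q) (hqs : star q = q) : ‖q‖ ≤ 1 := by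
  have h := CStarRing.norm_star_mul_self (x := q)
  rw [hqs, hqq] at h
  nlinarith [norm_nonneg q]

theorem hom_norm_le (p : P) : ‖ι p‖ ≤ ‖p‖ := NonUnitalStarAlgHom.norm_apply_le (ι : P →⋆ₙₐ[ℂ] A) p

theorem T_zero (hE : IsCondExpect ι E) {m : ℕ} {r : Fin m → A}
    (hr : ∀ a, a = ∑ k, r k * ι (E (star (r k) * a)))
    {ind : A} (hind : ind = ∑ k, r k * star (r k)) (hcen : ∀ a, ind * a = a * ind)
    {q : A} (hqq : q * q = q) (hqs : star q = q) {hi : P} (h1 : hi * E q = 1) (h2 : E q * hi = 1)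
    (hs : star hi = hi) {t : ℝ} (ht0 : 0 ≤ t) (ht : ‖ind - ι hi‖ ≤ t ^ 2) (htr : t * ∑ k, ‖r k‖ < 1)
    (a : A) : q * a = q * ι (hi * E (q * a)) := by
  let T : A → A := fun a => q * a - q * ι (hi * E (q * a))
  have hT : ∀ a, T a = q * a - q * ι (hi * E (q * a)) := fun a => rfl
  clear_value T
  have hqT : ∀ a, q * T a = T a := fun a => by
    rw [hT, mul_sub, ← mul_assoc, ← mul_assoc, hqq]
  have hEqT : ∀ a, E (T a) = 0 := fun a => by
    rw [hT, map_sub, ce_right hE, ← mul_assoc, h2, one_mul, sub_self]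
  have hTT : ∀ a, T (T a) = T a := fun a => by
    rw [hT (T a), hqT, hEqT, mul_zero, map_zero, mul_zero, sub_zero]
  have hTadd : ∀ s : Finset (Fin m), ∀ f : Fin m → A, T (∑ i ∈ s, f i) = ∑ i ∈ s, T (f i) :=
    fun s f => by
    simp only [hT, Finset.mul_sum, map_sum, Finset.sum_sub_distrib]
  have hTP : ∀ a p, T (a * ι p) = T a * ι p := fun a p => by
    rw [hT, hT, sub_mul, ← mul_assoc, ce_right hE, ← mul_assoc, map_mul _ _ p, ← mul_assoc]
  have hTadj : ∀ x y, E (star x * T y) = E (star (T x) * y) := fun x y => by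
    have a1 : ∀ p, E (star x * (q * ι p)) = E (star x * q) * p := fun p => by
      rw [← mul_assoc, ce_right hE]
    have a2 : ∀ p, E (ι p * q * y) = p * E (q * y) := fun p => by
      rw [mul_assoc, ce_left hE]
    have a3 : star (q * ι (hi * E (q * x))) = ι (E (star x * q) * hi) * q := by
      rw [star_mul, hqs, ← map_star, star_mul, hs, ← ce_star hE, star_mul, hqs]
    rw [hT, hT, mul_sub, star_sub, sub_mul, map_sub, map_sub, a3, a1, a2, star_mul, hqs,
      mul_assoc (star x), mul_assoc (E (star x * q))]
  have hexp : ∀ a, T a = ∑ k, T (r k) * ι (E (star (r k) * a)) := fun a => by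
    conv_lhs => rw [hr a, hTadd]
    simp only [hTP]
  have hb : ∑ k, T (r k) * star (T (r k)) = q * (ind - ι hi) * q := by
    have e1 : ∀ i, star (T (r i)) = ∑ j, ι (E (star (r i) * T (r j))) * star (r j) := fun i => by
      conv_lhs => rw [hr (T (r i))]
      rw [star_sum]
      refine Finset.sum_congr rfl fun j _ => ?_
      rw [star_mul, ← map_star, ← ce_star hE, star_mul, star_star, hTadj]
    have e2 : ∑ k, T (r k) * star (T (r k)) = ∑ j, T (r j) * star (r j) := by
      simp only [e1, Finset.mul_sum]
      rw [Finset.sum_comm]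
      refine Finset.sum_congr rfl fun j _ => ?_
      conv_rhs => rw [← hTT, hexp (T (r j)), Finset.sum_mul]
      simp only [mul_assoc]
    have e3 : q = ∑ j, ι (E (q * r j)) * star (r j) := by
      have := congrArg star (hr q)
      rw [star_sum, hqs] at this
      refine this.trans (Finset.sum_congr rfl fun j _ => ?_)
      rw [star_mul, ← map_star, ← ce_star hE, star_mul, star_star, hqs]
    rw [e2]
    have e4 : ∑ j, T (r j) * star (r j) = q * ind - q * ι hi * q := by
      simp only [hT, sub_mul, Finset.sum_sub_distrib]
      congr 1
      · rw [hind, Finset.mul_sum]; simp only [mul_assoc]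
      · have e5 : q * ι hi * q = q * ι hi * ∑ j, ι (E (q * r j)) * star (r j) :=
          congrArg (fun z => q * ι hi * z) e3
        rw [e5, Finset.mul_sum]
        refine Finset.sum_congr rfl fun j _ => ?_
        rw [map_mul]; simp only [mul_assoc]
    rw [e4, mul_sub, sub_mul, mul_assoc q ind, hcen, ← mul_assoc, hqq]
  have hqn := proj_norm hqq hqs
  have hTr : ∀ k, ‖T (r k)‖ ≤ t := fun k => by
    have h3 : ‖T (r k) * star (T (r k))‖ ≤ ‖∑ k, T (r k) * star (T (r k))‖ :=
      norm_le_of_pos ⟨star (T (r k)), by rw [star_star]⟩ (by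
        rw [← Finset.add_sum_erase _ _ (Finset.mem_univ k), add_sub_cancel_left]
        exact posElem_sum _ _ fun j _ => ⟨star (T (r j)), by rw [star_star]⟩)
    have h4 : ‖q * (ind - ι hi) * q‖ ≤ t ^ 2 := by
      refine (norm_mul_le _ _).trans ((mul_le_of_le_one_right (norm_nonneg _) hqn).trans ?_)
      exact (norm_mul_le _ _).trans ((mul_le_of_le_one_left (norm_nonneg _) hqn).trans ht)
    rw [hb, CStarRing.norm_self_mul_star, ← sq] at h3
    exact abs_le_of_sq_le_sq' (h3.trans h4) ht0 |>.2
  have hT0 : ∀ j, T (r j) = 0 := fun j => by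
    have h3 : ‖T (r j)‖ ≤ (t * ∑ k, ‖r k‖) * ‖T (r j)‖ := by
      conv_lhs => rw [← hTT, hexp]
      refine (norm_sum_le _ _).trans ?_
      rw [Finset.mul_sum, Finset.sum_mul]
      refine Finset.sum_le_sum fun k _ => ?_
      refine (norm_mul_le _ _).trans ?_
      rw [mul_assoc]
      refine mul_le_mul (hTr k) ?_ (norm_nonneg _) ht0
      refine (hom_norm_le _).trans ((ce_norm hE _).trans ((norm_mul_le _ _).trans ?_))
      rw [norm_star]
    have := norm_nonneg (T (r j))
    exact norm_eq_zero.1 (by nlinarith)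
  have := hexp a
  simp only [hT0, zero_mul, Finset.sum_const_zero] at this
  rw [hT] at this
  exact sub_eq_zero.1 this

theorem inv_sqrt_lemma {D : Type*} [CStarAlgebra D] {g : D} (hg : star g = g) {η : ℝ}
    (hη : η ≤ 1 / 2) (h : ‖g - 1‖ ≤ η) :
    ∃ s : D, star s = s ∧ s * g * s = 1 ∧ s * s * g = 1 ∧ g * (s * s) = 1 ∧ ‖s - 1‖ ≤ η := by
  have hsa : IsSelfAdjoint g := hg
  have hη0 : 0 ≤ η := (norm_nonneg _).trans h
  rcases subsingleton_or_nontrivial D with hD | hD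
  · exact ⟨1, star_one _, Subsingleton.elim _ _, Subsingleton.elim _ _, Subsingleton.elim _ _,
      by simpa using hη0⟩
  have hsp : ∀ t ∈ spectrum ℝ g, |t - 1| ≤ η := fun t ht => by
    have h1 : t - 1 ∈ spectrum ℝ (g - 1) := by
      have h2 := spectrum.sub_singleton_eq (R := ℝ) g 1
      rw [map_one] at h2
      rw [← h2]
      exact Set.sub_mem_sub ht rfl
    have := spectrum.norm_le_norm_of_mem h1
    exact this.trans h
  have hpos : ∀ t ∈ spectrum ℝ g, 1 / 2 ≤ t := fun t ht => by
    have := abs_le.1 (hsp t ht); linarith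
  have hcont : ContinuousOn (fun t : ℝ => (√t)⁻¹) (spectrum ℝ g) :=
    ContinuousOn.inv₀ (by fun_prop) fun t ht => by
      have := hpos t ht
      exact (Real.sqrt_pos.2 (by linarith)).ne'
  have hone : ∀ f : ℝ → ℝ, (∀ t ∈ spectrum ℝ g, f t = 1) → cfc f g = 1 := fun f hf => by
    rw [cfc_congr (g := fun _ => 1) (fun t ht => hf t ht), cfc_const_one ℝ g]
  have hss : ∀ t ∈ spectrum ℝ g, (√t)⁻¹ * (√t)⁻¹ * t = 1 := fun t ht => by
    have := hpos t ht
    rw [← mul_inv, Real.mul_self_sqrt (by linarith)]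
    exact inv_mul_cancel₀ (by linarith)
  refine ⟨cfc (fun t : ℝ => (√t)⁻¹) g, cfc_predicate (p := IsSelfAdjoint) _ g, ?_, ?_, ?_, ?_⟩
  · have e1 : cfc (fun t : ℝ => (√t)⁻¹) g * g * cfc (fun t : ℝ => (√t)⁻¹) g =
        cfc (fun t : ℝ => (√t)⁻¹ * t * (√t)⁻¹) g := by
      rw [cfc_mul (fun t : ℝ => (√t)⁻¹ * t) (fun t : ℝ => (√t)⁻¹) g (hcont.mul continuousOn_id) hcont,
        cfc_mul (fun t : ℝ => (√t)⁻¹) (fun t : ℝ => t) g hcont continuousOn_id, cfc_id' ℝ g]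
    rw [e1]
    exact hone _ fun t ht => by rw [mul_right_comm, hss t ht]
  · have e1 : cfc (fun t : ℝ => (√t)⁻¹) g * cfc (fun t : ℝ => (√t)⁻¹) g * g =
        cfc (fun t : ℝ => (√t)⁻¹ * (√t)⁻¹ * t) g := by
      rw [cfc_mul (fun t : ℝ => (√t)⁻¹ * (√t)⁻¹) (fun t : ℝ => t) g (hcont.mul hcont) continuousOn_id,
        cfc_mul (fun t : ℝ => (√t)⁻¹) (fun t : ℝ => (√t)⁻¹) g hcont hcont, cfc_id' ℝ g]
    rw [e1]
    exact hone _ hss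
  · have e1 : g * (cfc (fun t : ℝ => (√t)⁻¹) g * cfc (fun t : ℝ => (√t)⁻¹) g) =
        cfc (fun t : ℝ => t * ((√t)⁻¹ * (√t)⁻¹)) g := by
      rw [cfc_mul (fun t : ℝ => t) (fun t : ℝ => (√t)⁻¹ * (√t)⁻¹) g continuousOn_id (hcont.mul hcont),
        cfc_mul (fun t : ℝ => (√t)⁻¹) (fun t : ℝ => (√t)⁻¹) g hcont hcont, cfc_id' ℝ g]
    rw [e1]
    exact hone _ fun t ht => by rw [mul_comm, hss t ht]
  · have e1 : cfc (fun t : ℝ => (√t)⁻¹) g - 1 = cfc (fun t : ℝ => (√t)⁻¹ - 1) g := by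
      rw [cfc_sub (fun t : ℝ => (√t)⁻¹) (fun _ => 1) g hcont continuousOn_const, cfc_const_one ℝ g]
    rw [e1]
    refine norm_cfc_le hη0 fun t ht => ?_
    have h1 := hpos t ht
    have h2 := Real.mul_self_sqrt (show 0 ≤ t by linarith)
    have h3 : 0 < √t := Real.sqrt_pos.2 (by linarith)
    have h4 := abs_le.1 (hsp t ht)
    set y := √t
    have h5 : 1 / 2 ≤ y := by nlinarith
    have h6 : y⁻¹ * y = 1 := inv_mul_cancel₀ h3.ne'
    have h7 : 0 < y⁻¹ := inv_pos.2 h3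
    have h8 : 1 ≤ y * (y + 1) := by nlinarith
    rw [Real.norm_eq_abs]
    have h9 : y⁻¹ - 1 = y⁻¹ * (1 - y) := by rw [mul_sub, h6, mul_one]
    rw [h9, abs_mul, abs_of_pos h7]
    have h10 : |1 - y| * (1 + y) ≤ η := by
      rw [← abs_of_pos (show 0 < 1 + y by linarith), ← abs_mul]
      rw [show (1 - y) * (1 + y) = -(t - 1) by nlinarith, abs_neg]
      exact hsp t ht
    have h11 : y⁻¹ ≤ 1 + y := by
      have : y⁻¹ * 1 ≤ y⁻¹ * (y * (y + 1)) := by gcongr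
      rw [← mul_assoc, h6] at this
      linarith
    have := mul_le_mul_of_nonneg_right h11 (abs_nonneg (1 - y))
    linarith

end rok

section rok2
variable [CStarAlgebra P] [CStarAlgebra A] {ι : P →⋆ₐ[ℂ] A} {E : A →ₗ[ℂ] P}

theorem ind_lemma (hι : Function.Injective ι) (hE : IsCondExpect ι E) {ind w : A}
    (hcen : ∀ a, ind * a = a * ind) (hst : star ind = ind) (hw1 : w * ind = 1) (hw2 : ind * w = 1)
    {e : ℕ → A} (he : Tendsto (fun k => ‖ι (E (e k)) - w‖) atTop (𝓝 0)) :
    ∃ c w' : P, ι w' = w ∧ ι c = ind ∧ c * w' = 1 ∧ w' * c = 1 ∧ (∀ p, c * p = p * c) ∧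
      star c = c := by
  have h1 : ι (E w) = w := by
    refine eq_of_norm_sub_le_zero ?_
    have h0 : Tendsto (fun k => 2 * ‖ι (E (e k)) - w‖) atTop (𝓝 0) := by
      simpa using he.const_mul 2
    refine ge_of_tendsto' h0 fun k => ?_
    have a1 : ι (E w) - w = (ι (E (e k)) - w) - ι (E (ι (E (e k)) - w)) := by
      rw [map_sub E, hE.restricts, map_sub]; abel
    rw [a1, two_mul]
    exact (norm_sub_le _ _).trans (add_le_add le_rfl ((hom_norm_le _).trans (ce_norm hE _)))
  have h2 : ι (E w) * ind = 1 := by rw [h1, hw1]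
  have h3 : E w * E ind = 1 := by rw [← ce_left hE, h2, ce_one hE]
  have h4 : E ind * E w = 1 := by rw [← ce_right hE, h1, hw2, ce_one hE]
  have h5 : ι (E ind) = ind := by
    calc ι (E ind) = ι (E ind) * (ι (E w) * ind) := by rw [h2, mul_one]
      _ = ι (E ind * E w) * ind := by rw [map_mul, mul_assoc]
      _ = ind := by rw [h4, map_one, one_mul]
  refine ⟨E ind, E w, h1, h5, h4, h3, fun p => hι ?_, hι ?_⟩
  · rw [map_mul, map_mul, h5, hcen]
  · rw [map_star, h5, hst]

theorem theta_lemma (hE : IsCondExpect ι E) {m : ℕ} {r : Fin m → A}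
    (hr : ∀ a, a = ∑ k, r k * ι (E (star (r k) * a)))
    {ind : A} (hind : ind = ∑ k, r k * star (r k)) (hcen : ∀ a, ind * a = a * ind)
    {c w' : P} (hcι : ι c = ind) (hcw : c * w' = 1) (hcc : ∀ p, c * p = p * c) (hcs : star c = c) :
    ∃ K : ℝ, 0 < K ∧ ∀ ε : ℝ, 0 < ε → ∃ δ : ℝ, 0 < δ ∧ ∀ q : A, q * q = q → star q = q →
      ‖E q - w'‖ < δ → ∃ θ : A →ₗ[ℂ] P, θ q = 1 ∧
        (∀ x y, x * q = x → q * y = y → θ (x * y) = θ x * θ y) ∧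
        (∀ x, θ (star x) = star (θ x)) ∧ (∀ x, ‖θ x‖ ≤ K * ‖x‖) ∧
        ∀ p, ‖θ (q * ι p) - p‖ ≤ ε * ‖p‖ := by
  obtain ⟨C, hC⟩ : ∃ C, C = ‖c‖ := ⟨_, rfl⟩
  obtain ⟨R, hR⟩ : ∃ R, R = ∑ k, ‖r k‖ := ⟨_, rfl⟩
  have hC0 : 0 ≤ C := hC ▸ norm_nonneg _
  have hR0 : 0 ≤ R := hR ▸ Finset.sum_nonneg fun _ _ => norm_nonneg _
  refine ⟨4 * (C + 1), by linarith, fun ε hε => ?_⟩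
  obtain ⟨t, ht⟩ : ∃ t, t = 1 / (R + 1) := ⟨_, rfl⟩
  have ht0 : 0 < t := by rw [ht]; positivity
  have htR : t * R < 1 := by
    rw [ht, one_div, inv_mul_lt_iff₀ (by linarith)]; linarith
  obtain ⟨η, hη⟩ : ∃ η, η = min (min (1 / 2) (ε / 6)) (t ^ 2 / (3 * (C + 1))) := ⟨_, rfl⟩
  have hη0 : 0 < η := by rw [hη]; positivity
  have hη1 : η ≤ 1 / 2 := by rw [hη]; exact (min_le_left _ _).trans (min_le_left _ _)
  have hη2 : η ≤ ε / 6 := by rw [hη]; exact (min_le_left _ _).trans (min_le_right _ _)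
  have hη3 : η * (3 * (C + 1)) ≤ t ^ 2 := by
    rw [← le_div_iff₀ (by positivity), hη]; exact min_le_right _ _
  refine ⟨η / (C + 1), by positivity, fun q hqq hqs hq => ?_⟩
  have hgs : star (c * E q) = c * E q := by
    rw [star_mul, hcs, ← ce_star hE, hqs, hcc]
  have hg1 : ‖c * E q - 1‖ ≤ η := by
    rw [← hcw, ← mul_sub]
    refine (norm_mul_le _ _).trans ?_
    rw [← hC]
    rw [lt_div_iff₀ (by linarith)] at hq
    nlinarith [norm_nonneg (E q - w')]
  obtain ⟨s, hss, e1, e2, e3, hs1⟩ := inv_sqrt_lemma hgs hη1 hg1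
  have h1n : ‖(1 : P)‖ ≤ 1 := norm_one_le_one
  have hsn : ‖s‖ ≤ 3 / 2 := by
    have := norm_add_le (s - 1) 1
    rw [sub_add_cancel] at this; linarith
  have hgn : ‖c * E q‖ ≤ 3 / 2 := by
    have := norm_add_le (c * E q - 1) 1
    rw [sub_add_cancel] at this; linarith
  have hT := T_zero hE hr hind hcen hqq hqs (hi := c * (s * s)) (t := t)
    (by rw [hcc, mul_assoc, e2]) (by rw [← mul_assoc, ← hcc, e3])
    (by rw [star_mul, star_mul, hss, hcs, hcc]) ht0.le (by
      rw [← hcι, ← map_sub]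
      refine (hom_norm_le _).trans ?_
      have : c - c * (s * s) = -(c * ((s - 1) + (s - 1) * s)) := by noncomm_ring
      rw [this, norm_neg]
      refine (norm_mul_le _ _).trans ?_
      have h5 : ‖(s - 1) + (s - 1) * s‖ ≤ 3 * η := by
        refine (norm_add_le _ _).trans ?_
        have := norm_mul_le (s - 1) s
        nlinarith [norm_nonneg (s - 1), norm_nonneg s]
      rw [← hC]
      nlinarith [norm_nonneg ((s - 1) + (s - 1) * s)]) (by rw [← hR]; exact htR)
  let θ : A →ₗ[ℂ] P := (LinearMap.mulLeft ℂ (c * s)) ∘ₗ (LinearMap.mulRight ℂ s) ∘ₗ E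
  have hθ : ∀ x, θ x = c * s * (E x * s) := fun x => rfl
  clear_value θ
  refine ⟨θ, ?_, fun x y hx hy => ?_, fun x => ?_, fun x => ?_, fun p => ?_⟩
  · rw [hθ, ← e1, hcc s]; simp only [mul_assoc]
  · have h6 : E (x * y) = E x * (c * (s * s)) * E y := by
      have h7 := hT y
      rw [hy] at h7
      conv_lhs => rw [h7, ← mul_assoc, hx, ce_right hE]
      simp only [mul_assoc]
    rw [hθ, hθ, hθ, h6, hcc (s * s)]
    rw [hcc s]
    simp only [mul_assoc]
  · rw [hθ, hθ, ce_star hE, star_mul, star_mul, star_mul, hss, hcs, hcc s]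
    rw [mul_assoc, mul_assoc s (star (E x)), ← mul_assoc c, hcc, mul_assoc _ c s, hcc s]
  · rw [hθ]
    have a1 := norm_mul_le (c * s) (E x * s)
    have a2 := norm_mul_le c s
    have a3 := norm_mul_le (E x) s
    have a4 := ce_norm hE x
    rw [← hC] at a2
    have a5 : ‖c * s‖ ≤ C * (3 / 2) := a2.trans (by gcongr)
    have a6 : ‖E x * s‖ ≤ ‖x‖ * (3 / 2) := a3.trans (by gcongr)
    have a7 : ‖c * s‖ * ‖E x * s‖ ≤ C * (3 / 2) * (‖x‖ * (3 / 2)) := by gcongr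
    nlinarith [norm_nonneg x, mul_nonneg hC0 (norm_nonneg x)]
  · have b1 : θ (q * ι p) - p = s * (c * E q) * (p * (s - 1) - (s - 1) * p) := by
      have b2 : s * (c * E q) * (p * (s - 1) - (s - 1) * p) =
        s * (c * E q) * p * s - s * (c * E q) * s * p := by noncomm_ring
      rw [b2, e1, one_mul, hθ, ce_right hE, hcc s]; simp only [mul_assoc]
    rw [b1]
    have a1 := norm_mul_le (s * (c * E q)) (p * (s - 1) - (s - 1) * p)
    have a2 := norm_mul_le s (c * E q)
    have a3 := norm_sub_le (p * (s - 1)) ((s - 1) * p)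
    have a4 := norm_mul_le p (s - 1)
    have a5 := norm_mul_le (s - 1) p
    have a6 : ‖s * (c * E q)‖ ≤ 3 / 2 * (3 / 2) := a2.trans (by gcongr)
    have a7 : ‖p * (s - 1) - (s - 1) * p‖ ≤ 2 * η * ‖p‖ := by
      nlinarith [norm_nonneg p]
    have a8 : ‖s * (c * E q)‖ * ‖p * (s - 1) - (s - 1) * p‖ ≤ 3 / 2 * (3 / 2) * (2 * η * ‖p‖) := by
      gcongr
    nlinarith [norm_nonneg p, mul_le_mul_of_nonneg_right hη2 (norm_nonneg p)]

end rok2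

section fin

theorem proj_lift {B A : Type*} [CStarAlgebra B] [CStarAlgebra A] (Φ : B →⋆ₐ[ℂ] A) {b : B}
    (hb : star b = b) {η : ℝ} (hη : η ≤ 1 / 8) (h : ‖Φ b * Φ b - Φ b‖ ≤ η) :
    ∃ c : B, IsPosElem c ∧ Φ c * Φ c = Φ c ∧ star (Φ c) = Φ c ∧ ‖Φ c - Φ b‖ ≤ 2 * η := by
  have hη0 : 0 ≤ η := (norm_nonneg _).trans h
  have hbs : IsSelfAdjoint b := hb
  have hgs : IsSelfAdjoint (Φ b) := by rw [isSelfAdjoint_iff, ← map_star, hb]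
  let f : ℝ → ℝ := fun t => max 0 (min 1 (2 * t - 1 / 2))
  have hf : Continuous f := by fun_prop
  have hf0 : ∀ t, 0 ≤ f t := fun t => le_max_left _ _
  have hmap : Φ (cfc f b) = cfc f (Φ b) :=
    Φ.map_cfc f b hf.continuousOn
      (show Continuous (Φ : B →⋆ₙₐ[ℂ] A) by
        exact AddMonoidHomClass.continuous_of_bound (Φ : B →⋆ₙₐ[ℂ] A) 1 fun x => by
          rw [one_mul]; exact NonUnitalStarAlgHom.norm_apply_le (Φ : B →⋆ₙₐ[ℂ] A) x) hbs hgs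
  have hsp : ∀ t ∈ spectrum ℝ (Φ b), |t * t - t| ≤ η := fun t ht => by
    rcases subsingleton_or_nontrivial A with hD | hD
    · rw [spectrum.of_subsingleton] at ht; exact absurd ht (Set.notMem_empty _)
    have h1 : cfc (fun t : ℝ => t * t - t) (Φ b) = Φ b * Φ b - Φ b := by
      rw [cfc_sub (fun t : ℝ => t * t) (fun t => t) (Φ b), cfc_mul (fun t : ℝ => t) (fun t => t) (Φ b),
        cfc_id' ℝ (Φ b)]
    have h2 := cfc_map_spectrum (R := ℝ) (p := IsSelfAdjoint) (f := fun t : ℝ => t * t - t) (a := Φ b) hgs (by fun_prop)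
    rw [h1] at h2
    have h3 : t * t - t ∈ spectrum ℝ (Φ b * Φ b - Φ b) := by
      rw [h2]; exact ⟨t, ht, rfl⟩
    exact (spectrum.norm_le_norm_of_mem h3).trans h
  have hcase : ∀ t ∈ spectrum ℝ (Φ b), (t ≤ 1 / 4 ∧ f t = 0) ∨ (3 / 4 ≤ t ∧ f t = 1) := fun t ht => by
    have h1 := abs_le.1 (hsp t ht)
    rcases le_or_gt t (1 / 4) with h2 | h2
    · left; refine ⟨h2, max_eq_left ((min_le_right _ _).trans (by linarith))⟩
    rcases le_or_gt (3 / 4) t with h3 | h3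
    · right; refine ⟨h3, ?_⟩
      show max 0 (min 1 (2 * t - 1 / 2)) = 1
      rw [min_eq_left (by linarith), max_eq_right zero_le_one]
    · exfalso; nlinarith
  refine ⟨cfc f b, ?_, ?_, ?_, ?_⟩
  · letI := CStarAlgebra.spectralOrder B
    haveI := CStarAlgebra.spectralOrderedRing B
    rw [posElem_iff]
    exact cfc_nonneg fun t _ => hf0 t
  · rw [hmap, ← cfc_mul f f (Φ b) hf.continuousOn hf.continuousOn]
    refine cfc_congr fun t ht => ?_
    rcases hcase t ht with h1 | h1 <;> simp [h1.2]
  · rw [hmap]; exact cfc_predicate (p := IsSelfAdjoint) f (Φ b)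
  · rw [hmap]
    have h1 : cfc f (Φ b) - Φ b = cfc (fun t => f t - t) (Φ b) := by
      rw [cfc_sub f (fun t => t) (Φ b) hf.continuousOn continuousOn_id, cfc_id' ℝ (Φ b)]
    rw [h1]
    refine norm_cfc_le (by linarith) fun t ht => ?_
    have h2 := abs_le.1 (hsp t ht)
    rw [Real.norm_eq_abs]
    rcases hcase t ht with h3 | h3
    · rw [h3.2, abs_le]; constructor <;> nlinarith
    · rw [h3.2, abs_le]; constructor <;> nlinarith

theorem rho_lemma {N B A P : Type*} [CStarAlgebra N] [CStarAlgebra B] [CStarAlgebra A] [CStarAlgebra P]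
    (α : N →⋆ₐ[ℂ] B × ℂ) (Φ : B →⋆ₐ[ℂ] A) {c : B}
    (hα : ∀ w, (∃ z : ℕ → B, Tendsto (fun n => c * z n) atTop (𝓝 ((α w).1 - (α w).2 • 1))) ∧
        ∃ z : ℕ → B, Tendsto (fun n => z n * c) atTop (𝓝 ((α w).1 - (α w).2 • 1)))
    (hqq : Φ c * Φ c = Φ c) (hqs : star (Φ c) = Φ c) (θ : A →ₗ[ℂ] P) (h1 : θ (Φ c) = 1)
    (hm : ∀ x y, x * Φ c = x → Φ c * y = y → θ (x * y) = θ x * θ y)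
    (hst : ∀ x, θ (star x) = star (θ x)) :
    ∃ ψ : N →⋆ₐ[ℂ] P, ∀ w z, α w = (z, 0) → ψ w = θ (Φ z) := by
  have hcont : Continuous Φ := by
    have : Continuous (Φ : B →⋆ₙₐ[ℂ] A) := 
      AddMonoidHomClass.continuous_of_bound (Φ : B →⋆ₙₐ[ℂ] A) 1 fun x => by
          rw [one_mul]; exact NonUnitalStarAlgHom.norm_apply_le (Φ : B →⋆ₙₐ[ℂ] A) x
    exact this
  let X : N → A := fun w => Φ ((α w).1 - (α w).2 • 1)
  have hX : ∀ w, X w = Φ ((α w).1 - (α w).2 • 1) := fun w => rfl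
  have hX' : ∀ w, Φ (α w).1 = X w + (α w).2 • 1 := fun w => by
    rw [hX, map_sub, map_smul, map_one, sub_add_cancel]
  clear_value X
  have hqX : ∀ w, Φ c * X w = X w := fun w => by
    obtain ⟨z, hz⟩ := (hα w).1
    have a1 := (hcont.tendsto _).comp hz
    rw [← hX] at a1
    have a2 := a1.const_mul (Φ c)
    refine tendsto_nhds_unique a2 (a1.congr fun n => ?_)
    simp only [Function.comp, map_mul, ← mul_assoc, hqq]
  have hXq : ∀ w, X w * Φ c = X w := fun w => by
    obtain ⟨z, hz⟩ := (hα w).2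
    have a1 := (hcont.tendsto _).comp hz
    rw [← hX] at a1
    have a2 := a1.mul_const (Φ c)
    refine tendsto_nhds_unique a2 (a1.congr fun n => ?_)
    simp only [Function.comp, map_mul, mul_assoc, hqq]
  have hXX : ∀ w w', X (w * w') = X w * X w' + (α w').2 • X w + (α w).2 • X w' := fun w w' => by
    rw [hX (w * w'), map_mul, map_sub, Prod.fst_mul, Prod.snd_mul, map_mul, hX', hX', map_smul, map_one]
    simp only [mul_add, add_mul, smul_mul_assoc, mul_smul_comm, one_mul, mul_one, smul_smul, smul_add]
    rw [mul_comm (α w').2]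
    abel
  let G : N →ₗ[ℂ] A := (Φ : B →⋆ₐ[ℂ] A).toAlgHom.toLinearMap ∘ₗ LinearMap.fst ℂ B ℂ ∘ₗ α.toAlgHom.toLinearMap
    + (LinearMap.toSpanSingleton ℂ A (Φ c - 1)) ∘ₗ LinearMap.snd ℂ B ℂ ∘ₗ α.toAlgHom.toLinearMap
  have hG : ∀ w, G w = X w + (α w).2 • Φ c := fun w => by
    show Φ (α w).1 + (α w).2 • (Φ c - 1) = _
    rw [hX', smul_sub]; abel
  clear_value G
  have hqG : ∀ w, Φ c * G w = G w := fun w => by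
    rw [hG, mul_add, hqX, mul_smul_comm, hqq]
  have hGq : ∀ w, G w * Φ c = G w := fun w => by
    rw [hG, add_mul, hXq, smul_mul_assoc, hqq]
  have hGG : ∀ w w', G (w * w') = G w * G w' := fun w w' => by
    simp only [hG, hXX, map_mul, Prod.snd_mul, add_mul, mul_add, smul_mul_assoc, mul_smul_comm, hqX, hXq,
      hqq, smul_smul, smul_add]
    rw [mul_comm (α w').2]
    abel
  have hG1 : G 1 = Φ c := by
    rw [hG, hX, map_one]; simp
  have hGs : ∀ w, G (star w) = star (G w) := fun w => by
    have a1 : (α (star w)).1 = star (α w).1 := by rw [map_star]; rfl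
    have a2 : (α (star w)).2 = star (α w).2 := by rw [map_star]; rfl
    rw [hG, hG, hX, hX, a1, a2]
    simp only [map_sub, map_smul, map_one, map_star, star_add, star_sub, star_smul, star_one, hqs]
  let ψ : N →ₐ[ℂ] P := AlgHom.ofLinearMap (θ ∘ₗ G) (by
    show θ (G 1) = 1
    rw [hG1, h1]) (fun x y => by
    show θ (G (x * y)) = θ (G x) * θ (G y)
    rw [hGG, hm _ _ (hGq x) (hqG y)])
  refine ⟨⟨ψ, fun w => ?_⟩, fun w z hw => ?_⟩
  · show θ (G (star w)) = star (θ (G w))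
    rw [hGs, hst]
  · show θ (G w) = θ (Φ z)
    rw [hG, hX, hw]; simp

end fin

theorem main_thm (P A : Type) [CStarAlgebra P] [CStarAlgebra A]
    (ι : P →⋆ₐ[ℂ] A) (hι : Function.Injective ι)
    (E : A →ₗ[ℂ] P) (hE : IsCondExpect ι E)
    (m : ℕ) (u v : Fin m → A) (hqb : IsQuasiBasis ι E u v)
    (hRok : CondExpectHasRokhlin ι E (∑ i, u i * v i))
    (hA : HasLocallyFiniteNuclearDimension A) :
    HasLocallyFiniteNuclearDimension P := by
  classical
  obtain ⟨e, ⟨M, hM⟩, he1, he2, he3, ⟨w, hw1, hw2, hw3⟩, -⟩ := hRok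
  obtain ⟨r, hr, hind⟩ := sym_qb hE hqb
  have hcen := ind_central hE hqb
  have hst : star (∑ i, u i * v i) = ∑ i, u i * v i := by
    rw [hind, star_sum]; simp only [star_mul, star_star]
  obtain ⟨c, w', hw', hcι, hcw, hwc, hcc, hcs⟩ := ind_lemma hι hE hcen hst hw1 hw2 hw3
  obtain ⟨K, hK, hth⟩ := theta_lemma hE hr hind hcen hcι hcw hcc hcs
  have hM0 : 0 ≤ M := (norm_nonneg _).trans (hM 0)
  intro S ε hε
  obtain ⟨L, hL0, hL⟩ : ∃ L : ℝ, 0 ≤ L ∧ ∀ p ∈ S, ‖p‖ ≤ L :=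
    ⟨∑ p ∈ S, ‖p‖, Finset.sum_nonneg fun _ _ => norm_nonneg _, fun p hp =>
      Finset.single_le_sum (f := fun p => ‖p‖) (fun _ _ => norm_nonneg _) hp⟩
  obtain ⟨δ, hδ, hθ⟩ := hth (ε / (2 * (L + 1))) (by positivity)
  obtain ⟨τ, hτ0, hτ1, hτ2, hτ3, hτ4⟩ : ∃ τ : ℝ, 0 < τ ∧ τ ≤ 1 ∧ τ * (4 * M + 7) ≤ 1 / 8 ∧
      τ * (8 * M + 17) < δ ∧ τ * (K * (2 + 2 * (8 * M + 16) * L)) < ε / 2 := by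
    have hZ : 0 < K * (2 + 2 * (8 * M + 16) * L) := by positivity
    refine ⟨min (min 1 ((1 / 8) / (4 * M + 7))) (min (δ / 2 / (8 * M + 17))
      (ε / 4 / (K * (2 + 2 * (8 * M + 16) * L)))), by positivity,
      (min_le_left _ _).trans (min_le_left _ _), ?_, ?_, ?_⟩
    · rw [← le_div_iff₀ (by linarith)]
      exact (min_le_left _ _).trans (min_le_right _ _)
    · refine lt_of_le_of_lt (b := δ / 2) ?_ (by linarith)
      rw [← le_div_iff₀ (by linarith)]
      exact (min_le_right _ _).trans (min_le_left _ _)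
    · refine lt_of_le_of_lt (b := ε / 4) ?_ (by linarith)
      rw [← le_div_iff₀ hZ]
      exact (min_le_right _ _).trans (min_le_right _ _)
  have hev : ∀ᶠ k in atTop, ‖e k * e k - e k‖ < τ ∧ ‖star (e k) - e k‖ < τ ∧ ‖ι (E (e k)) - w‖ < τ ∧
      ∀ p ∈ S, ‖e k * ι p - ι p * e k‖ < τ :=
    (he1.eventually_lt_const hτ0).and ((he2.eventually_lt_const hτ0).and
      ((hw3.eventually_lt_const hτ0).and ((Filter.eventually_all_finset S).2 fun p _ =>
        (he3 (ι p)).eventually_lt_const hτ0)))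
  obtain ⟨k, k1, k2, k3, k4⟩ := hev.exists
  have k5 := hM k
  generalize e k = f at k1 k2 k3 k4 k5
  obtain ⟨B, hB, Φ, hΦ⟩ := hA (insert f (S.image ι)) τ hτ0
  obtain ⟨hsep, κ, _, hκ⟩ := finSat_lnuc hB
  obtain ⟨b0, hb0⟩ := hΦ f (Finset.mem_insert_self _ _)
  have hΦS : ∀ p ∈ S, ∃ b, ‖ι p - Φ b‖ < τ := fun p hp =>
    hΦ _ (Finset.mem_insert_of_mem (Finset.mem_image_of_mem _ hp))
  obtain ⟨b, hbs, hb⟩ : ∃ b : B.carrier, star b = b ∧ ‖f - Φ b‖ ≤ 2 * τ := by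
    refine ⟨(1 / 2 : ℂ) • (b0 + star b0), ?_, ?_⟩
    · rw [star_smul, star_add, star_star, add_comm]
      simp
    · have a1 : f - Φ ((1 / 2 : ℂ) • (b0 + star b0)) =
        (1 / 2 : ℂ) • ((f - Φ b0) + (star (f - Φ b0) - (star f - f))) := by
        rw [map_smul, map_add, map_star, star_sub]
        have : f = (1 / 2 : ℂ) • (f + f) := by rw [← two_smul ℂ f, smul_smul]; simp
        nth_rw 1 [this]
        rw [← smul_sub]; congr 1; abel
      rw [a1, norm_smul]
      have a2 := norm_add_le (f - Φ b0) (star (f - Φ b0) - (star f - f))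
      have a3 := norm_sub_le (star (f - Φ b0)) (star f - f)
      rw [norm_star] at a3
      have a4 : ‖(1 / 2 : ℂ)‖ = 1 / 2 := by norm_num
      rw [a4]; linarith
  have hbb : ‖Φ b * Φ b - Φ b‖ ≤ τ * (4 * M + 7) := by
    have a1 : Φ b * Φ b - Φ b = (f * f - f) - (f - Φ b) * f - Φ b * (f - Φ b) + (f - Φ b) := by
      noncomm_ring
    have a2 : ‖Φ b‖ ≤ M + 2 := by
      have := norm_sub_le f (f - Φ b)
      rw [sub_sub_cancel] at this
      linarith
    have a3 : ‖(f - Φ b) * f‖ ≤ 2 * τ * M := (norm_mul_le _ _).trans (by gcongr)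
    have a4 : ‖Φ b * (f - Φ b)‖ ≤ (M + 2) * (2 * τ) := (norm_mul_le _ _).trans (by gcongr)
    have a5 := norm_add_le ((f * f - f) - (f - Φ b) * f - Φ b * (f - Φ b)) (f - Φ b)
    have a6 := norm_sub_le ((f * f - f) - (f - Φ b) * f) (Φ b * (f - Φ b))
    have a7 := norm_sub_le (f * f - f) ((f - Φ b) * f)
    rw [← a1] at a5
    linarith
  obtain ⟨c0, hc0, hqq, hqs, hqb'⟩ := proj_lift Φ hbs hτ2 hbb
  have hqf : ‖Φ c0 - f‖ ≤ τ * (8 * M + 16) := by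
    have a1 := norm_sub_le (Φ c0 - Φ b) (f - Φ b)
    rw [sub_sub_sub_cancel_right] at a1
    linarith
  have hqn := proj_norm hqq hqs
  have hEq : ‖E (Φ c0) - w'‖ < δ := by
    have a1 : E (Φ c0) - w' = E (Φ c0 - f) + E (ι (E f) - w) := by
      rw [map_sub, map_sub, hE.restricts, ← hw', hE.restricts]; abel
    have a2 := norm_add_le (E (Φ c0 - f)) (E (ι (E f) - w))
    have a3 := ce_norm hE (Φ c0 - f)
    have a4 := ce_norm hE (ι (E f) - w)
    rw [a1]; linarith
  obtain ⟨θ, t1, t2, t3, t4, t5⟩ := hθ (Φ c0) hqq hqs hEq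
  haveI := hsep
  obtain ⟨N, hN, α, hα, hα2⟩ := unitize_thm hκ c0 hc0
  obtain ⟨ψ, hψ⟩ := rho_lemma α Φ hα hqq hqs θ t1 t2 t3
  refine ⟨N, FinSat.base hN, ψ, fun p hp => ?_⟩
  obtain ⟨z, hz⟩ := hΦS p hp
  obtain ⟨x, hx⟩ := hα2 z
  refine ⟨x, ?_⟩
  rw [hψ _ _ hx, map_mul Φ, map_mul Φ]
  generalize Φ c0 = q at *
  have hpL := hL p hp
  have hιp : ‖ι p‖ ≤ L := (hom_norm_le p).trans hpL
  have hcomm : ‖q * ι p - ι p * q‖ ≤ 2 * (τ * (8 * M + 16) * L) + τ := by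
    have a1 : q * ι p - ι p * q = (q - f) * ι p - ι p * (q - f) + (f * ι p - ι p * f) := by
      noncomm_ring
    have a2 : ‖(q - f) * ι p‖ ≤ τ * (8 * M + 16) * L := (norm_mul_le _ _).trans (by gcongr)
    have a3 : ‖ι p * (q - f)‖ ≤ L * (τ * (8 * M + 16)) := (norm_mul_le _ _).trans (by gcongr)
    have a4 := norm_add_le ((q - f) * ι p - ι p * (q - f)) (f * ι p - ι p * f)
    have a5 := norm_sub_le ((q - f) * ι p) (ι p * (q - f))
    have a6 := k4 p hp
    rw [a1]; linarith
  have a1 : p - θ (q * Φ z * q) = θ (q * (ι p - Φ z) * q + q * (q * ι p - ι p * q)) - (θ (q * ι p) - p) := by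
    have : q * (ι p - Φ z) * q + q * (q * ι p - ι p * q) = q * q * ι p - q * Φ z * q := by noncomm_ring
    rw [this, hqq, map_sub]; abel
  rw [a1]
  have a2 : ‖q * (ι p - Φ z) * q‖ ≤ τ := by
    refine (norm_mul_le _ _).trans ((mul_le_of_le_one_right (norm_nonneg _) hqn).trans ?_)
    exact (norm_mul_le _ _).trans ((mul_le_of_le_one_left (norm_nonneg _) hqn).trans hz.le)
  have a3 : ‖q * (q * ι p - ι p * q)‖ ≤ 2 * (τ * (8 * M + 16) * L) + τ :=
    (norm_mul_le _ _).trans ((mul_le_of_le_one_left (norm_nonneg _) hqn).trans hcomm)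
  have a4 := norm_add_le (q * (ι p - Φ z) * q) (q * (q * ι p - ι p * q))
  have a5 := norm_sub_le (θ (q * (ι p - Φ z) * q + q * (q * ι p - ι p * q))) (θ (q * ι p) - p)
  have a6 := t4 (q * (ι p - Φ z) * q + q * (q * ι p - ι p * q))
  have a7 : K * ‖q * (ι p - Φ z) * q + q * (q * ι p - ι p * q)‖ ≤
      K * (τ * (2 + 2 * (8 * M + 16) * L)) := by
    gcongr; linarith
  have a8 := t5 p
  have a9 : ε / (2 * (L + 1)) * ‖p‖ ≤ ε / 2 := by
    rw [div_mul_eq_mul_div, div_le_iff₀ (by positivity)]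
    nlinarith
  have a10 : K * (τ * (2 + 2 * (8 * M + 16) * L)) = τ * (K * (2 + 2 * (8 * M + 16) * L)) := by ring
  linarith

open TopologicalSpace in
theorem stmt7 (P A : Type) [CStarAlgebra P] [CStarAlgebra A]
    [SeparableSpace P] [SeparableSpace A]
    (ι : P →⋆ₐ[ℂ] A) (hι : Function.Injective ι)
    (E : A →ₗ[ℂ] P) (hE : IsCondExpect ι E)
    (hfaithful : ∀ x : A, E (star x * x) = 0 → x = 0)
    (m : ℕ) (u v : Fin m → A) (hqb : IsQuasiBasis ι E u v)
    (hRok : CondExpectHasRokhlin ι E (∑ i, u i * v i))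
    (hA : HasLocallyFiniteNuclearDimension A) :
    HasLocallyFiniteNuclearDimension P := by
  exact main_thm P A ι hι E hE m u v hqb hRok hA

end
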